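/- For every universal oracle machine U, the probability that U computes a function whose domain computes the halting problem is a 4-random 0'''-left-c.e. real. Conversely, every 4-random 0'''-left-c.e. real in (0,1) is the probability that some universal oracle machine computes a function whose domain computes the halting problem. -/

import Mathlib

open scoped Classical
open MeasureTheory

namespace RandProb

/-- Cantor space: the space of infinite binary sequences. -/
abbrev Cantor := ℕ → Bool

/-! ### Oracle partial recursive functions, via codes -/

/-- Codes for partial recursive functions with access to an oracle `O : ℕ → ℕ`.
These codes play the role of (oracle) Turing machines. -/
inductive CodeO : Type
  | zero : CodeO
  | succ : CodeO
  | left : CodeO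
  | right : CodeO
  | oracle : CodeO
  | pair : CodeO → CodeO → CodeO
  | comp : CodeO → CodeO → CodeO
  | prec : CodeO → CodeO → CodeO
  | rfind' : CodeO → CodeO

/-- Evaluation of an oracle code with (total) oracle `O`. -/
def CodeO.eval (O : ℕ → ℕ) : CodeO → ℕ →. ℕ
  | .zero => pure 0
  | .succ => Nat.succ
  | .left => ↑fun n : ℕ => n.unpair.1
  | .right => ↑fun n : ℕ => n.unpair.2
  | .oracle => ↑fun n : ℕ => O n
  | .pair cf cg => fun n => Nat.pair <$> cf.eval O n <*> cg.eval O n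
  | .comp cf cg => fun n => cg.eval O n >>= cf.eval O
  | .prec cf cg =>
    Nat.unpaired fun a n =>
      n.rec (cf.eval O a) fun y IH => do
        let i ← IH
        cg.eval O (Nat.pair a (Nat.pair y i))
  | .rfind' cf =>
    Nat.unpaired fun a m =>
      (Nat.rfind fun n => (fun m => m = 0) <$> cf.eval O (Nat.pair a (n + m))).map (· + m)

/-- A canonical injective numbering of oracle codes. -/
def CodeO.encode : CodeO → ℕ
  | .zero => 0
  | .succ => 1
  | .left => 2
  | .right => 3
  | .oracle => 4
  | .pair cf cg => 2 * (2 * Nat.pair cf.encode cg.encode) + 5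
  | .comp cf cg => 2 * (2 * Nat.pair cf.encode cg.encode + 1) + 5
  | .prec cf cg => 2 * (2 * Nat.pair cf.encode cg.encode) + 6
  | .rfind' cf => 2 * (2 * cf.encode + 1) + 6

/-- The Turing jump of an oracle: the halting problem relative to `O`,
as a `{0,1}`-valued function. -/
noncomputable def jump (O : ℕ → ℕ) : ℕ → ℕ := fun e =>
  if ∃ c : CodeO, c.encode = e ∧ (c.eval O e).Dom then 1 else 0

/-- `iterJump n` is `∅^(n)`, the `n`-th iterate of the halting problem (as an oracle). -/
noncomputable def iterJump : ℕ → ℕ → ℕ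
  | 0 => fun _ => 0
  | n + 1 => jump (iterJump n)

/-- `S ⊆ ℕ` is computably enumerable relative to the oracle `O`. -/
def CeIn (O : ℕ → ℕ) (S : Set ℕ) : Prop := ∃ c : CodeO, S = {m | (c.eval O m).Dom}

/-- The left Dedekind cut of `α` (as a set of codes of rationals) is c.e. in `O`. -/
def LeftCeIn (O : ℕ → ℕ) (α : ℝ) : Prop :=
  CeIn O {m | ∃ q : ℚ, Encodable.encode q = m ∧ (q : ℝ) < α}

/-- The right Dedekind cut of `α` (as a set of codes of rationals) is c.e. in `O`. -/
def RightCeIn (O : ℕ → ℕ) (α : ℝ) : Prop :=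
  CeIn O {m | ∃ q : ℚ, Encodable.encode q = m ∧ α < (q : ℝ)}

/-! ### Martin-Löf randomness for real numbers -/

/-- The `i`-th component of a Martin-Löf test coded by the set `W ⊆ ℕ`:
the union of all open rational intervals whose codes are enumerated into the
`i`-th section of `W`. -/
def testSet (W : Set ℕ) (i : ℕ) : Set ℝ :=
  {x | ∃ p q : ℚ, Nat.pair i (Encodable.encode (p, q)) ∈ W ∧ (p : ℝ) < x ∧ x < (q : ℝ)}

/-- `α` is Martin-Löf random relative to the oracle `O`. -/
def MLRandomIn (O : ℕ → ℕ) (α : ℝ) : Prop :=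
  ∀ W : Set ℕ, CeIn O W →
    (∀ i, volume (testSet W i) ≤ ENNReal.ofReal ((2 : ℝ)⁻¹ ^ i)) →
    ∃ i, α ∉ testSet W i

/-- `α` is `n`-random: Martin-Löf random relative to `∅^(n-1)`. -/
def NRandom (n : ℕ) (α : ℝ) : Prop := MLRandomIn (iterJump (n - 1)) α

/-! ### The uniform measure on Cantor space -/

/-- The binary digits of a real number (meaningful on `[0,1)`). -/
noncomputable def digits (x : ℝ) : Cantor := fun n => decide (⌊x * 2 ^ (n + 1)⌋ % 2 = 1)

/-- The uniform (Lebesgue) product measure on Cantor space, obtained as the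
pushforward of Lebesgue measure on `[0,1)` under the binary-digit map. -/
noncomputable def mu : Measure Cantor :=
  Measure.map digits (volume.restrict (Set.Ico (0 : ℝ) 1))

/-- The uniform measure of a set of elements of Cantor space, as a real number. -/
noncomputable def muR (S : Set Cantor) : ℝ := (mu S).toReal

/-! ### Strings, prefixes and cylinders -/

/-- The length-`n` initial segment of `X ∈ 2^ω`, as a finite binary string. -/
def initSeg (X : Cantor) (n : ℕ) : List Bool := (List.range n).map X

/-- `⟦S⟧`: the elements of Cantor space having a prefix in the set of strings `S`. -/
def cyl (S : Set (List Bool)) : Set Cantor := {X | ∃ n, initSeg X n ∈ S}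

/-- A set of strings is prefix-free if none of its elements properly extends another. -/
def IsPrefixFree (S : Set (List Bool)) : Prop := ∀ σ ∈ S, ∀ τ ∈ S, σ <+: τ → σ = τ

/-- A set of strings is upward closed if it is closed under taking extensions. -/
def UpClosed (S : Set (List Bool)) : Prop := ∀ σ ∈ S, ∀ τ, σ <+: τ → τ ∈ S

/-- Two strings are compatible if one is a prefix of the other. -/
def Compatible (σ τ : List Bool) : Prop := σ <+: τ ∨ τ <+: σ

/-! ### Oracle machines -/

/-- An element of Cantor space viewed as a `{0,1}`-valued oracle. -/
def oX (X : Cantor) : ℕ → ℕ := fun n => cond (X n) 1 0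

/-- `evalO X c n`: the (possibly divergent) output of the oracle machine `c`
on input `n` with oracle `X`. -/
def evalO (X : Cantor) (c : CodeO) (n : ℕ) : Part ℕ := c.eval (oX X) n

/-- The oracle obtained by writing the string `ρ` before the bits of `X`. -/
def prepend (ρ : List Bool) (X : Cantor) : Cantor := fun n =>
  if n < ρ.length then ρ.getD n false else X (n - ρ.length)

/-- `X ∈ 2^ω` extends the finite string `ρ`. -/
def Extends (X : Cantor) (ρ : List Bool) : Prop := initSeg X ρ.length = ρ

/-- `u` is a universal oracle machine: some effective, prefix-free translation
`c ↦ σ_c` satisfies `u(σ_c * X, n) ≃ c(X, n)` for all machines `c`. -/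
def UniversalOM (u : CodeO) : Prop :=
  ∃ σ : CodeO → List Bool,
    (∃ f : ℕ → ℕ, Computable f ∧ ∀ c : CodeO, f c.encode = Encodable.encode (σ c)) ∧
    IsPrefixFree (Set.range σ) ∧
    ∀ (c : CodeO) (X : Cantor) (n : ℕ), evalO (prepend (σ c) X) u n = evalO X c n

/-- `TOT(c)`: the oracles `X` such that the function `c(X)` is total. -/
def TOT (c : CodeO) : Set Cantor := {X | ∀ n, (evalO X c n).Dom}

/-- The domain of the partial function `c(X)`. -/
def domSet (c : CodeO) (X : Cantor) : Set ℕ := {n | (evalO X c n).Dom}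

/-- The range of the partial function `c(X)`. -/
def ranSet (c : CodeO) (X : Cantor) : Set ℕ := {v | ∃ n, v ∈ evalO X c n}

/-- `INF(c)`: the oracles `X` such that `c(X)` has infinite domain. -/
def INF (c : CodeO) : Set Cantor := {X | (domSet c X).Infinite}

/-- `COF(c)`: the oracles `X` such that `c(X)` has cofinite domain. -/
def COF (c : CodeO) : Set Cantor := {X | (domSet c X)ᶜ.Finite}

/-- `COM(c)`: the oracles `X` such that `c(X)` has computable domain. -/
def COM (c : CodeO) : Set Cantor := {X | ComputablePred fun n => n ∈ domSet c X}

/-- The characteristic function of a set of naturals. -/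
noncomputable def chi (A : Set ℕ) : ℕ → ℕ := fun n => if n ∈ A then 1 else 0

/-- Turing reducibility between sets of naturals. -/
def TuringLEs (B A : Set ℕ) : Prop := ∃ c : CodeO, ∀ n, c.eval (chi A) n = Part.some (chi B n)

/-- The halting problem `∅'` as a set of naturals. -/
noncomputable def HaltingSet : Set ℕ := {e | iterJump 1 e = 1}

/-- `COMPL(c)`: the oracles `X` such that the domain of `c(X)` computes the halting problem. -/
noncomputable def COMPL (c : CodeO) : Set Cantor := {X | TuringLEs HaltingSet (domSet c X)}

/-- Turing reducibility between total functions on ℕ. -/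
def TuringLEf (f g : ℕ → ℕ) : Prop := ∃ c : CodeO, ∀ n, c.eval g n = Part.some (f n)

/-- A real number viewed as an oracle, via its binary expansion. -/
noncomputable def realOracle (α : ℝ) : ℕ → ℕ := oX (digits α)

/-- Two reals have Turing-incomparable degrees. -/
noncomputable def TIncompReal (α β : ℝ) : Prop :=
  ¬ TuringLEf (realOracle α) (realOracle β) ∧ ¬ TuringLEf (realOracle β) (realOracle α)

/-! ### Arithmetical hierarchy -/

/-- Evaluation with the trivial (empty) oracle: ordinary partial recursion. -/
def eval0 (c : CodeO) : ℕ →. ℕ := c.eval fun _ => 0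

/-- `SigmaNumIdx n c` is the `Σ^0_{n+1}` subset of `ℕ` with index `c`. -/
def SigmaNumIdx : ℕ → CodeO → Set ℕ
  | 0, c => {m | (eval0 c m).Dom}
  | n + 1, c => {m | ∃ k, Nat.pair m k ∉ SigmaNumIdx n c}

/-- `S ⊆ ℕ` is `Σ^0_n` (intended for `n ≥ 1`). -/
def SigmaN (n : ℕ) (S : Set ℕ) : Prop := ∃ c : CodeO, S = SigmaNumIdx (n - 1) c

/-- The set of codes of the elements of a set of binary strings. -/
def strCodes (S : Set (List Bool)) : Set ℕ := {m | ∃ σ ∈ S, Encodable.encode σ = m}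

/-- A set of binary strings is `Σ^0_n`. -/
def SigmaStr (n : ℕ) (S : Set (List Bool)) : Prop := SigmaN n (strCodes S)

/-- A set of binary strings is `Π^0_n`: its complement is `Σ^0_n`. -/
def PiStr (n : ℕ) (S : Set (List Bool)) : Prop := SigmaStr n Sᶜ

/-- A set of binary strings is c.e. relative to the oracle `O`. -/
def CeStrIn (O : ℕ → ℕ) (S : Set (List Bool)) : Prop := CeIn O (strCodes S)

/-- `SigmaClassIdx n c m` is the `Σ^0_{n+1}` class of elements of Cantor space
with index `c` and parameter `m`. -/
def SigmaClassIdx : ℕ → CodeO → ℕ → Set Cantor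
  | 0, c, m => {X | (evalO X c m).Dom}
  | n + 1, c, m => {X | ∃ k, X ∉ SigmaClassIdx n c (Nat.pair m k)}

/-! ### Monotone machines -/

/-- A monotone machine: a partial computable, monotone map on finite binary strings. -/
structure MonoMachine where
  f : List Bool →. List Bool
  partrec : Partrec f
  mono : ∀ ⦃σ τ a b : List Bool⦄, σ <+: τ → a ∈ f σ → b ∈ f τ → a <+: b

/-- The oracles `X` such that the output of the monotone machine on `X` is infinite. -/
def MonoINF (M : MonoMachine) : Set Cantor :=
  {X | ∀ k, ∃ n a, a ∈ M.f (initSeg X n) ∧ k ≤ a.length}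

/-- The `k`-th bit of the output `M(X)` of a monotone machine is `b`. -/
def MonoMachine.hasBit (M : MonoMachine) (X : Cantor) (k : ℕ) (b : Bool) : Prop :=
  ∃ n a, a ∈ M.f (initSeg X n) ∧ a[k]? = some b

/-- `U` is a universal monotone machine. -/
def UniversalMono (U : MonoMachine) : Prop :=
  ∃ (M : ℕ → MonoMachine) (σ : ℕ → List Bool),
    Partrec₂ (fun (e : ℕ) (τ : List Bool) => (M e).f τ) ∧
    (∀ V : MonoMachine, ∃ e, (M e).f = V.f) ∧
    Computable σ ∧ IsPrefixFree (Set.range σ) ∧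
    ∀ e τ, U.f (σ e ++ τ) = (M e).f τ

/-! ### Infinitary self-delimiting machines -/

/-- Chaitin's infinitary self-delimiting machines: `f σ n` is the `n`-th approximation
of the output on program `σ` (`none` meaning divergence); the convergence relation is
decidable, approximations are monotone, and machines are self-delimiting. -/
structure InfMachine where
  f : List Bool → ℕ → Option (List Bool)
  computable : Computable₂ f
  mono : ∀ σ m n a, n < m → f σ m = some a → ∃ b, f σ n = some b ∧ b <+: a
  sd : ∀ σ τ n a, f σ n = some a → f (σ ++ τ) n = some a

/-- `M^∞(σ)↓`: all approximations converge. -/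
def InfMachine.domInf (M : InfMachine) (σ : List Bool) : Prop := ∀ n, M.f σ n ≠ none

/-- The domain of `M^∞`. -/
def InfMachine.DOM (M : InfMachine) : Set (List Bool) := {σ | M.domInf σ}

/-- The output `M^∞(σ)` is infinite (a stream). -/
def InfMachine.outInf (M : InfMachine) (σ : List Bool) : Prop :=
  ∀ k, ∃ n a, M.f σ n = some a ∧ k ≤ a.length

/-- `FIN(M^∞)`: programs in the domain with finite output. -/
def InfMachine.FIN (M : InfMachine) : Set (List Bool) := {σ | M.domInf σ ∧ ¬ M.outInf σ}

/-- `INF(M^∞)`: programs in the domain with infinite output. -/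
def InfMachine.INF (M : InfMachine) : Set (List Bool) := {σ | M.domInf σ ∧ M.outInf σ}

/-- The `k`-th bit of the output `M^∞(σ)` is `b`. -/
def InfMachine.hasBit (M : InfMachine) (σ : List Bool) (k : ℕ) (b : Bool) : Prop :=
  ∃ n a, M.f σ n = some a ∧ a[k]? = some b

/-- The domain of the prefix-free machine `M^*`: minimal strings in the domain of `M^∞`. -/
def InfMachine.DOMstar (M : InfMachine) : Set (List Bool) :=
  {σ | M.domInf σ ∧ ∀ τ, τ <+: σ → τ ≠ σ → ¬ M.domInf τ}

/-- Programs whose output is a stream with a tail of 1s. -/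
def InfMachine.COFout (M : InfMachine) : Set (List Bool) :=
  {σ | M.domInf σ ∧ M.outInf σ ∧ ∃ t, ∀ k, t ≤ k → M.hasBit σ k true}

/-- `A^∞(σ) ≃ B^∞(τ)`: both converge or both diverge, with equal outputs. -/
def InfAgree (A : InfMachine) (σ : List Bool) (B : InfMachine) (τ : List Bool) : Prop :=
  (A.domInf σ ↔ B.domInf τ) ∧ (A.domInf σ → ∀ k b, (A.hasBit σ k b ↔ B.hasBit τ k b))

/-- `U` is a universal infinitary self-delimiting machine. -/
def UniversalInf (U : InfMachine) : Prop :=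
  ∃ (M : ℕ → InfMachine) (σ : ℕ → List Bool),
    Computable (fun p : ℕ × List Bool × ℕ => (M p.1).f p.2.1 p.2.2) ∧
    (∀ V : InfMachine, ∃ e, ∀ τ, InfAgree (M e) τ V τ) ∧
    Computable σ ∧ IsPrefixFree (Set.range σ) ∧
    ∀ e τ, InfAgree U (σ e ++ τ) (M e) τ

end RandProb

set_option linter.unusedVariables false
set_option linter.unusedSectionVars false
namespace RandProb

/-! ### Automation for primitive recursiveness -/

attribute [fun_prop] Primrec
attribute [fun_prop] PrimrecPred
attribute [fun_prop] Primrec.id Primrec.const Primrec.comp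

section prim
variable {α β γ σ : Type*} [Primcodable α] [Primcodable β] [Primcodable γ] [Primcodable σ]

@[fun_prop] theorem P_pair {f : α → β} {g : α → γ} (hf : Primrec f) (hg : Primrec g) :
    Primrec fun a => (f a, g a) := hf.pair hg
@[fun_prop] theorem P_fst {f : α → β × γ} (hf : Primrec f) : Primrec fun a => (f a).1 :=
  Primrec.fst.comp hf
@[fun_prop] theorem P_snd {f : α → β × γ} (hf : Primrec f) : Primrec fun a => (f a).2 :=
  Primrec.snd.comp hf
@[fun_prop] theorem P_add {f g : α → ℕ} (hf : Primrec f) (hg : Primrec g) :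
    Primrec fun a => f a + g a := Primrec.nat_add.comp hf hg
@[fun_prop] theorem P_sub {f g : α → ℕ} (hf : Primrec f) (hg : Primrec g) :
    Primrec fun a => f a - g a := Primrec.nat_sub.comp hf hg
@[fun_prop] theorem P_mul {f g : α → ℕ} (hf : Primrec f) (hg : Primrec g) :
    Primrec fun a => f a * g a := Primrec.nat_mul.comp hf hg
@[fun_prop] theorem P_div {f g : α → ℕ} (hf : Primrec f) (hg : Primrec g) :
    Primrec fun a => f a / g a := Primrec.nat_div.comp hf hg
@[fun_prop] theorem P_mod {f g : α → ℕ} (hf : Primrec f) (hg : Primrec g) :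
    Primrec fun a => f a % g a := Primrec.nat_mod.comp hf hg
@[fun_prop] theorem P_max {f g : α → ℕ} (hf : Primrec f) (hg : Primrec g) :
    Primrec fun a => max (f a) (g a) := Primrec.nat_max.comp hf hg
@[fun_prop] theorem P_min {f g : α → ℕ} (hf : Primrec f) (hg : Primrec g) :
    Primrec fun a => min (f a) (g a) := Primrec.nat_min.comp hf hg
@[fun_prop] theorem P_natpair {f g : α → ℕ} (hf : Primrec f) (hg : Primrec g) :
    Primrec fun a => Nat.pair (f a) (g a) := Primrec₂.natPair.comp hf hg
@[fun_prop] theorem P_unpair {f : α → ℕ} (hf : Primrec f) :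
    Primrec fun a => Nat.unpair (f a) := Primrec.unpair.comp hf
@[fun_prop] theorem P_succ {f : α → ℕ} (hf : Primrec f) :
    Primrec fun a => Nat.succ (f a) := Primrec.succ.comp hf
@[fun_prop] theorem P_pred {f : α → ℕ} (hf : Primrec f) :
    Primrec fun a => Nat.pred (f a) := Primrec.pred.comp hf
@[fun_prop] theorem P_encode {f : α → β} (hf : Primrec f) :
    Primrec fun a => Encodable.encode (f a) := Primrec.encode.comp hf
@[fun_prop] theorem P_decode {f : α → ℕ} (hf : Primrec f) :
    Primrec fun a => (Encodable.decode (f a) : Option β) := Primrec.decode.comp hf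
@[fun_prop] theorem P_some {f : α → β} (hf : Primrec f) :
    Primrec fun a => some (f a) := Primrec.option_some.comp hf
@[fun_prop] theorem P_isSome {f : α → Option β} (hf : Primrec f) :
    Primrec fun a => (f a).isSome := Primrec.option_isSome.comp hf
@[fun_prop] theorem P_optgetD {f : α → Option β} {g : α → β} (hf : Primrec f) (hg : Primrec g) :
    Primrec fun a => (f a).getD (g a) := Primrec.option_getD.comp hf hg
@[fun_prop] theorem P_length {f : α → List β} (hf : Primrec f) :
    Primrec fun a => (f a).length := Primrec.list_length.comp hf
@[fun_prop] theorem P_take {f : α → ℕ} {g : α → List β} (hf : Primrec f) (hg : Primrec g) :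
    Primrec fun a => (g a).take (f a) := Primrec.list_take.comp hf hg
@[fun_prop] theorem P_drop {f : α → ℕ} {g : α → List β} (hf : Primrec f) (hg : Primrec g) :
    Primrec fun a => (g a).drop (f a) := Primrec.list_drop.comp hf hg
@[fun_prop] theorem P_append {f g : α → List β} (hf : Primrec f) (hg : Primrec g) :
    Primrec fun a => f a ++ g a := Primrec.list_append.comp hf hg
@[fun_prop] theorem P_cons {f : α → β} {g : α → List β} (hf : Primrec f) (hg : Primrec g) :
    Primrec fun a => f a :: g a := Primrec.list_cons.comp hf hg
@[fun_prop] theorem P_range {f : α → ℕ} (hf : Primrec f) :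
    Primrec fun a => List.range (f a) := Primrec.list_range.comp hf
@[fun_prop] theorem P_getE {f : α → ℕ} {g : α → List β} (hf : Primrec f) (hg : Primrec g) :
    Primrec fun a => (g a)[f a]? := Primrec.list_getElem?.comp hg hf
@[fun_prop] theorem P_getD {f : α → ℕ} {g : α → List β} (hg : Primrec g) (hf : Primrec f) (d : β) :
    Primrec fun a => (g a).getD (f a) d := (Primrec.list_getD d).comp hg hf
@[fun_prop] theorem P_map {n : α → List β} {b : α → β → γ} (hn : Primrec n)
    (hs : Primrec fun x : α × β => b x.1 x.2) :
    Primrec fun a => (n a).map (b a) := Primrec.list_map hn hs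
@[fun_prop] theorem P_flatMap {n : α → List β} {b : α → β → List γ} (hn : Primrec n)
    (hs : Primrec fun x : α × β => b x.1 x.2) :
    Primrec fun a => (n a).flatMap (b a) := Primrec.list_flatMap hn hs
@[fun_prop] theorem P_ite {p : α → Prop} [DecidablePred p] {f g : α → β} (hp : PrimrecPred p)
    (hf : Primrec f) (hg : Primrec g) : Primrec fun a => if p a then f a else g a :=
  Primrec.ite hp hf hg
@[fun_prop] theorem P_decide {p : α → Prop} [DecidablePred p] (hp : PrimrecPred p) :
    Primrec fun a => decide (p a) := primrecPred_iff_primrec_decide.1 hp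
@[fun_prop] theorem P_cond {p : α → Bool} {f g : α → β} (hp : Primrec p)
    (hf : Primrec f) (hg : Primrec g) : Primrec fun a => cond (p a) (f a) (g a) :=
  Primrec.cond hp hf hg
@[fun_prop] theorem P_lt {f g : α → ℕ} (hf : Primrec f) (hg : Primrec g) :
    PrimrecPred fun a => f a < g a := Primrec.nat_lt.comp hf hg
@[fun_prop] theorem P_le {f g : α → ℕ} (hf : Primrec f) (hg : Primrec g) :
    PrimrecPred fun a => f a ≤ g a := Primrec.nat_le.comp hf hg
@[fun_prop] theorem P_eq {f g : α → β} (hf : Primrec f) (hg : Primrec g) :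
    PrimrecPred fun a => f a = g a := Primrec.eq.comp hf hg
@[fun_prop] theorem P_and {f g : α → Prop} (hf : PrimrecPred f) (hg : PrimrecPred g) :
    PrimrecPred fun a => f a ∧ g a := hf.and hg
@[fun_prop] theorem P_or {f g : α → Prop} (hf : PrimrecPred f) (hg : PrimrecPred g) :
    PrimrecPred fun a => f a ∨ g a := hf.or hg
@[fun_prop] theorem P_not {f : α → Prop} (hf : PrimrecPred f) :
    PrimrecPred fun a => ¬ f a := hf.not
/-- Implication as a named function, for automation. -/
def Imp (p q : Prop) : Prop := p → q
@[fun_prop] theorem P_Imp {f g : α → Prop} (hf : PrimrecPred f) (hg : PrimrecPred g) :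
    PrimrecPred fun a => Imp (f a) (g a) := by
  refine (P_or (P_not hf) hg).of_eq fun a => ?_
  unfold Imp; tauto
@[fun_prop] theorem P_constProp (p : Prop) : PrimrecPred fun _ : α => p := by
  by_cases h : p
  · exact (P_eq (Primrec.const 0) (Primrec.const 0)).of_eq (by simp [h])
  · exact (P_eq (Primrec.const 0) (Primrec.const 1)).of_eq (by simp [h])
@[fun_prop] theorem P_compPred {f : α → Prop} {g : β → α} (hf : PrimrecPred f) (hg : Primrec g) :
    PrimrecPred fun a => f (g a) := hf.comp hg

/-- Bounded universal quantification. -/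
def allLt (n : ℕ) (p : ℕ → Prop) : Prop := ∀ i < n, p i
/-- Bounded existential quantification. -/
def exLt (n : ℕ) (p : ℕ → Prop) : Prop := ∃ i < n, p i
/-- Quantification over a list. -/
def allMem (l : List β) (p : β → Prop) : Prop := ∀ i ∈ l, p i
/-- Quantification over a list. -/
def exMem (l : List β) (p : β → Prop) : Prop := ∃ i ∈ l, p i
/-- Recursion. -/
def natR (n : ℕ) (b : β) (s : ℕ → β → β) : β := Nat.rec b s n
/-- Counting. -/
noncomputable def cnt (n : ℕ) (p : ℕ → Prop) : ℕ := natR n 0 fun i r => if p i then r + 1 else r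

@[fun_prop] theorem P_natR {n : α → ℕ} {b : α → β} {s : α → ℕ → β → β} (hn : Primrec n)
    (hb : Primrec b) (hs : Primrec fun x : α × ℕ × β => s x.1 x.2.1 x.2.2) :
    Primrec fun a => natR (n a) (b a) (s a) := 
  Primrec.nat_rec' (h := fun a x => s a x.1 x.2) hn hb hs
@[fun_prop] theorem P_cnt {n : α → ℕ} {p : α → ℕ → Prop} (hn : Primrec n)
    (hp : PrimrecPred fun x : α × ℕ => p x.1 x.2) :
    Primrec fun a => cnt (n a) (p a) := by
  unfold cnt
  fun_prop
@[fun_prop] theorem P_exMem {n : α → List β} {p : α → β → Prop} (hn : Primrec n)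
    (hp : PrimrecPred fun x : α × β => p x.1 x.2) :
    PrimrecPred fun a => exMem (n a) (p a) := by
  have h : PrimrecRel fun (L : List β) (a : α) => ∃ x ∈ L, p a x :=
    PrimrecRel.exists_mem_list (R := fun b a => p a b) (hp.comp (f := fun x : β × α => (x.2, x.1)) (by fun_prop))
  exact h.comp hn Primrec.id
@[fun_prop] theorem P_allMem {n : α → List β} {p : α → β → Prop} (hn : Primrec n)
    (hp : PrimrecPred fun x : α × β => p x.1 x.2) :
    PrimrecPred fun a => allMem (n a) (p a) := by
  refine (P_not (P_exMem (p := fun a b => ¬ p a b) hn (P_not hp))).of_eq fun a => ?_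
  simp [exMem, allMem]
@[fun_prop] theorem P_exLt {n : α → ℕ} {p : α → ℕ → Prop} (hn : Primrec n)
    (hp : PrimrecPred fun x : α × ℕ => p x.1 x.2) :
    PrimrecPred fun a => exLt (n a) (p a) := by
  refine (P_exMem (P_range hn) hp).of_eq fun a => ?_
  simp [exMem, exLt]
@[fun_prop] theorem P_allLt {n : α → ℕ} {p : α → ℕ → Prop} (hn : Primrec n)
    (hp : PrimrecPred fun x : α × ℕ => p x.1 x.2) :
    PrimrecPred fun a => allLt (n a) (p a) := by
  refine (P_allMem (P_range hn) hp).of_eq fun a => ?_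
  simp [allMem, allLt]
@[fun_prop] theorem P_pow {f g : α → ℕ} (hf : Primrec f) (hg : Primrec g) :
    Primrec fun a => f a ^ g a := by
  have : Primrec fun a => natR (g a) 1 (fun i r => r * f a) := by fun_prop
  refine this.of_eq fun a => ?_
  unfold natR
  induction g a with
  | zero => rfl
  | succ n ih => simp only; rw [ih, pow_succ]
@[fun_prop] theorem P_replicate {f : α → ℕ} {g : α → β} (hf : Primrec f) (hg : Primrec g) :
    Primrec fun a => List.replicate (f a) (g a) := by
  have : Primrec fun a => (List.range (f a)).map (fun _ => g a) := by fun_prop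
  refine this.of_eq fun a => ?_
  simp

/-- least `i < n` with `p i`, or `n`. -/
noncomputable def lst (n : ℕ) (p : ℕ → Prop) : ℕ := natR n n fun i r => if p i ∧ r = n then i else r

/-- `Primrec` for nat least witnesses. -/
@[fun_prop] theorem P_lst {n : α → ℕ} {p : α → ℕ → Prop} (hn : Primrec n)
    (hp : PrimrecPred fun x : α × ℕ => p x.1 x.2) :
    Primrec fun a => lst (n a) (p a) := by
  unfold lst
  fun_prop

theorem cnt_eq (n : ℕ) (p : ℕ → Prop) : cnt n p = ((Finset.range n).filter p).card := by
  unfold cnt natR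
  induction n with
  | zero => simp
  | succ n ih =>
    simp only [Finset.range_add_one, Finset.filter_insert]
    rw [ih]
    split_ifs with h <;> simp

theorem lst_spec (n : ℕ) (p : ℕ → Prop) : (lst n p ≤ n) ∧ (lst n p < n → p (lst n p)) ∧ ∀ i < lst n p, ¬ p i := by
  have H : ∀ m ≤ n, let r := natR (β := ℕ) m n (fun i r => if p i ∧ r = n then i else r)
      (r = n ∧ ∀ i < m, ¬ p i) ∨ (r < m ∧ p r ∧ ∀ i < r, ¬ p i) := by
    intro m hm
    induction m with
    | zero => left; simp [natR]
    | succ m ih =>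
      have := ih (by omega)
      simp only [natR] at this ⊢
      rcases this with ⟨h1, h2⟩ | ⟨h1, h2, h3⟩
      · rw [h1]
        by_cases hp : p m
        · right; simp only [hp, and_self, if_true]; exact ⟨by omega, trivial, h2⟩
        · left; simp only [hp, false_and, if_false]; refine ⟨trivial, fun i hi => ?_⟩
          rcases Nat.lt_succ_iff_lt_or_eq.1 hi with h | h
          · exact h2 i h
          · rw [h]; exact hp
      · right
        rw [if_neg (by omega)]
        exact ⟨by omega, h2, h3⟩
  have := H n le_rfl
  simp only at this
  change (lst n p = n ∧ _) ∨ (lst n p < n ∧ p (lst n p) ∧ _) at this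
  rcases this with ⟨h1, h2⟩ | ⟨h1, h2, h3⟩
  · rw [h1]; exact ⟨le_rfl, by omega, h2⟩
  · exact ⟨h1.le, fun _ => h2, h3⟩
end prim

end RandProb

namespace RandProb

/-! ### Foundations: use principle, step-bounded oracle evaluation -/

/-- initial segment of an oracle. -/
def pre (O : ℕ → ℕ) (k : ℕ) : List ℕ := (List.range k).map O

@[simp] theorem pre_length (O : ℕ → ℕ) (k : ℕ) : (pre O k).length = k := by simp [pre]
theorem pre_getElem? (O : ℕ → ℕ) (k n : ℕ) : (pre O k)[n]? = if n < k then some (O n) else none := by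
  unfold pre
  by_cases h : n < k <;> simp [h]
theorem pre_take (O : ℕ → ℕ) {k j : ℕ} (h : j ≤ k) : (pre O k).take j = pre O j := by
  unfold pre
  rw [← List.map_take, List.take_range, min_eq_left h]
theorem pre_prefix (O : ℕ → ℕ) {k j : ℕ} (h : j ≤ k) : pre O j <+: pre O k := by
  rw [← pre_take O h]; exact List.take_prefix _ _
theorem pre_succ (O : ℕ → ℕ) (k : ℕ) : pre O (k+1) = pre O k ++ [O k] := by
  simp [pre, List.range_succ]
theorem pre_eq_of_prefix {O : ℕ → ℕ} {k : ℕ} {L : List ℕ} (h : L <+: pre O k) : L = pre O L.length := by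
  have h1 := h.length_le
  rw [pre_length] at h1
  rw [← pre_take O h1]
  exact List.prefix_iff_eq_take.1 h
theorem pre_congr {O O' : ℕ → ℕ} {k : ℕ} (h : ∀ i < k, O i = O' i) : pre O k = pre O' k := by
  unfold pre
  exact List.map_congr_left fun i hi => h i (List.mem_range.1 hi)

/-- decoding numbers to oracle codes -/
def dec : ℕ → CodeO
  | 0 => .zero
  | 1 => .succ
  | 2 => .left
  | 3 => .right
  | 4 => .oracle
  | n + 5 =>
    if n % 4 = 0 then .pair (dec (n/4).unpair.1) (dec (n/4).unpair.2)
    else if n % 4 = 1 then .prec (dec (n/4).unpair.1) (dec (n/4).unpair.2)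
    else if n % 4 = 2 then .comp (dec (n/4).unpair.1) (dec (n/4).unpair.2)
    else .rfind' (dec (n/4))
decreasing_by
  all_goals
    have h1 := Nat.unpair_left_le (n/4)
    have h2 := Nat.unpair_right_le (n/4)
    omega

theorem dec_encode (c : CodeO) : dec c.encode = c := by
  induction c with
  | zero => simp [CodeO.encode, dec]
  | succ => simp [CodeO.encode, dec]
  | left => simp [CodeO.encode, dec]
  | right => simp [CodeO.encode, dec]
  | oracle => simp [CodeO.encode, dec]
  | pair a b ha hb =>
    unfold CodeO.encode dec
    have h1 : (2 * (2 * Nat.pair a.encode b.encode)) % 4 = 0 := by omega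
    have h2 : (2 * (2 * Nat.pair a.encode b.encode)) / 4 = Nat.pair a.encode b.encode := by omega
    rw [if_pos h1, h2]; simp [ha, hb]
  | comp a b ha hb =>
    unfold CodeO.encode dec
    have h1 : (2 * (2 * Nat.pair a.encode b.encode + 1)) % 4 = 2 := by omega
    have h2 : (2 * (2 * Nat.pair a.encode b.encode + 1)) / 4 = Nat.pair a.encode b.encode := by omega
    rw [if_neg (by omega), if_neg (by omega), if_pos h1, h2]; simp [ha, hb]
  | prec a b ha hb =>
    unfold CodeO.encode
    rw [show 2 * (2 * Nat.pair a.encode b.encode) + 6 = (2 * (2 * Nat.pair a.encode b.encode) + 1) + 5 by omega]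
    unfold dec
    have h1 : (2 * (2 * Nat.pair a.encode b.encode) + 1) % 4 = 1 := by omega
    have h2 : (2 * (2 * Nat.pair a.encode b.encode) + 1) / 4 = Nat.pair a.encode b.encode := by omega
    rw [if_neg (by omega), if_pos h1, h2]; simp [ha, hb]
  | rfind' a ha =>
    unfold CodeO.encode
    rw [show 2 * (2 * a.encode + 1) + 6 = (2 * (2 * a.encode + 1) + 1) + 5 by omega]
    unfold dec
    have h2 : (2 * (2 * a.encode + 1) + 1) / 4 = a.encode := by omega
    rw [if_neg (by omega), if_neg (by omega), if_neg (by omega), h2]; simp [ha]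

theorem encode_dec (n : ℕ) : (dec n).encode = n := by
  induction n using Nat.strong_induction_on with
  | _ n ih =>
    match n with
    | 0 => simp [dec, CodeO.encode]
    | 1 => simp [dec, CodeO.encode]
    | 2 => simp [dec, CodeO.encode]
    | 3 => simp [dec, CodeO.encode]
    | 4 => simp [dec, CodeO.encode]
    | n + 5 =>
      have h1 := Nat.unpair_left_le (n/4)
      have h2 := Nat.unpair_right_le (n/4)
      have i1 := ih (n/4).unpair.1 (by omega)
      have i2 := ih (n/4).unpair.2 (by omega)
      have i3 := ih (n/4) (by omega)
      unfold dec
      split_ifs <;> simp only [CodeO.encode, i1, i2, i3, Nat.pair_unpair] <;> omega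

/-- evaluation with a partial oracle -/
def ev (P : ℕ →. ℕ) : CodeO → ℕ →. ℕ
  | .zero => pure 0
  | .succ => Nat.succ
  | .left => ↑fun n : ℕ => n.unpair.1
  | .right => ↑fun n : ℕ => n.unpair.2
  | .oracle => P
  | .pair cf cg => fun n => Nat.pair <$> ev P cf n <*> ev P cg n
  | .comp cf cg => fun n => ev P cg n >>= ev P cf
  | .prec cf cg =>
    Nat.unpaired fun a n =>
      n.rec (ev P cf a) fun y IH => do
        let i ← IH
        ev P cg (Nat.pair a (Nat.pair y i))
  | .rfind' cf =>
    Nat.unpaired fun a m =>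
      (Nat.rfind fun n => (fun m => m = 0) <$> ev P cf (Nat.pair a (n + m))).map (· + m)

theorem ev_coe (O : ℕ → ℕ) (c : CodeO) : ev (O : ℕ →. ℕ) c = c.eval O := by
  induction c with
  | zero => rfl
  | succ => rfl
  | left => rfl
  | right => rfl
  | oracle => rfl
  | pair a b ha hb => simp only [ev, CodeO.eval, ha, hb]; rfl
  | comp a b ha hb => simp only [ev, CodeO.eval, ha, hb]; rfl
  | prec a b ha hb => simp only [ev, CodeO.eval, ha, hb]; rfl
  | rfind' a ha => simp only [ev, CodeO.eval, ha]; rfl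

/-- membership characterisation of prec -/
theorem prec_chain (f : Part ℕ) (g : ℕ → ℕ → Part ℕ) (n v : ℕ) :
    v ∈ (Nat.rec f (fun y IH => IH >>= g y) n : Part ℕ) ↔
      ∃ w : ℕ → ℕ, w 0 ∈ f ∧ w n = v ∧ ∀ y < n, w (y+1) ∈ g y (w y) := by
  induction n generalizing v with
  | zero =>
    constructor
    · intro h; exact ⟨fun _ => v, h, rfl, by simp⟩
    · rintro ⟨w, h1, h2, -⟩; simpa [h2] using h1
  | succ n ih =>
    simp only [Part.bind_eq_bind, Part.mem_bind_iff] at ih ⊢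
    constructor
    · rintro ⟨a, ha, hv⟩
      obtain ⟨w, h1, h2, h3⟩ := (ih a).1 ha
      refine ⟨fun i => if i ≤ n then w i else v, by simpa using h1, by simp, fun y hy => ?_⟩
      rcases Nat.lt_succ_iff_lt_or_eq.1 hy with h | h
      · have := h3 y h
        simp only [show y + 1 ≤ n by omega, show y ≤ n by omega, if_true]; exact this
      · subst h; simpa [h2] using hv
    · rintro ⟨w, h1, h2, h3⟩
      exact ⟨w n, (ih _).2 ⟨w, h1, rfl, fun y hy => h3 y (by omega)⟩, by rw [← h2]; exact h3 n (by omega)⟩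

theorem mem_ev_pair {P : ℕ →. ℕ} {a b : CodeO} {n v : ℕ} :
    v ∈ ev P (.pair a b) n ↔ ∃ x ∈ ev P a n, ∃ y ∈ ev P b n, Nat.pair x y = v := by
  simp [ev, Seq.seq]
theorem mem_ev_comp {P : ℕ →. ℕ} {a b : CodeO} {n v : ℕ} :
    v ∈ ev P (.comp a b) n ↔ ∃ x ∈ ev P b n, v ∈ ev P a x := by
  exact Part.mem_bind_iff
theorem mem_ev_prec {P : ℕ →. ℕ} {a b : CodeO} {n v : ℕ} :
    v ∈ ev P (.prec a b) n ↔ ∃ w : ℕ → ℕ, w 0 ∈ ev P a n.unpair.1 ∧ w n.unpair.2 = v ∧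
      ∀ y < n.unpair.2, w (y+1) ∈ ev P b (Nat.pair n.unpair.1 (Nat.pair y (w y))) := by
  exact prec_chain (ev P a n.unpair.1) (fun y i => ev P b (Nat.pair n.unpair.1 (Nat.pair y i))) n.unpair.2 v
theorem mem_ev_rfind {P : ℕ →. ℕ} {a : CodeO} {n v : ℕ} :
    v ∈ ev P (.rfind' a) n ↔ ∃ w : ℕ → ℕ, ∃ k, k + n.unpair.2 = v ∧ w k = 0 ∧ (∀ i < k, w i ≠ 0) ∧
      ∀ i ≤ k, w i ∈ ev P a (Nat.pair n.unpair.1 (i + n.unpair.2)) := by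
  have key : v ∈ ev P (.rfind' a) n ↔ ∃ k, ((∃ x ∈ ev P a (Nat.pair n.unpair.1 (k + n.unpair.2)), decide (x = 0) = true) ∧
      ∀ {i}, i < k → ∃ x ∈ ev P a (Nat.pair n.unpair.1 (i + n.unpair.2)), decide (x = 0) = false) ∧
      k + n.unpair.2 = v := by
    refine (Part.mem_map_iff _).trans (exists_congr fun k => and_congr_left fun _ => ?_)
    refine Nat.mem_rfind.trans (and_congr ?_ ?_)
    · exact Part.mem_map_iff _
    · exact forall_congr' fun i => imp_congr_right fun _ => Part.mem_map_iff _
  rw [key]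
  constructor
  · rintro ⟨k, ⟨⟨x, hx, hx0⟩, h2⟩, rfl⟩
    have : ∀ i, ∃ w, (i < k → w ∈ ev P a (Nat.pair n.unpair.1 (i + n.unpair.2)) ∧ w ≠ 0) := by
      intro i
      by_cases hi : i < k
      · obtain ⟨w, h3, h4⟩ := h2 hi
        exact ⟨w, fun _ => ⟨h3, by simpa using h4⟩⟩
      · exact ⟨0, fun h => absurd h hi⟩
    choose w hw using this
    refine ⟨fun i => if i < k then w i else 0, k, rfl, by simp, fun i hi => ?_, fun i hi => ?_⟩
    · simpa [hi] using (hw i hi).2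
    · by_cases h : i < k
      · simpa [h] using (hw i h).1
      · have : i = k := by omega
        subst this
        have hx0 : x = 0 := by simpa using hx0
        simpa [hx0] using hx
  · rintro ⟨w, k, rfl, h0, h1, h2⟩
    refine ⟨k, ⟨⟨w k, h2 k le_rfl, by simp [h0]⟩, fun {i} hi => ⟨w i, h2 i hi.le, by simpa using h1 i hi⟩⟩, rfl⟩

theorem ev_mono {P Q : ℕ →. ℕ} (h : ∀ n v, v ∈ P n → v ∈ Q n) (c : CodeO) :
    ∀ n v, v ∈ ev P c n → v ∈ ev Q c n := by
  induction c with
  | zero => exact fun n v => id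
  | succ => exact fun n v => id
  | left => exact fun n v => id
  | right => exact fun n v => id
  | oracle => exact h
  | pair a b ha hb =>
    intro n v; rw [mem_ev_pair, mem_ev_pair]
    rintro ⟨x, hx, y, hy, e⟩; exact ⟨x, ha _ _ hx, y, hb _ _ hy, e⟩
  | comp a b ha hb =>
    intro n v; rw [mem_ev_comp, mem_ev_comp]
    rintro ⟨x, hx, hy⟩; exact ⟨x, hb _ _ hx, ha _ _ hy⟩
  | prec a b ha hb =>
    intro n v; rw [mem_ev_prec, mem_ev_prec]
    rintro ⟨w, h1, h2, h3⟩; exact ⟨w, ha _ _ h1, h2, fun y hy => hb _ _ (h3 y hy)⟩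
  | rfind' a ha =>
    intro n v; rw [mem_ev_rfind, mem_ev_rfind]
    rintro ⟨w, k, h1, h2, h3, h4⟩; exact ⟨w, k, h1, h2, h3, fun i hi => ha _ _ (h4 i hi)⟩

/-- partial lookup -/
def lk (L : List ℕ) : ℕ →. ℕ := fun n => (L[n]? : Part ℕ)

theorem mem_lk {L : List ℕ} {n v : ℕ} : v ∈ lk L n ↔ L[n]? = some v := by
  simp [lk]

theorem lk_mono {L L' : List ℕ} (h : L <+: L') : ∀ n v, v ∈ lk L n → v ∈ lk L' n := by
  intro n v; rw [mem_lk, mem_lk]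
  exact fun h1 => by
    obtain ⟨t, rfl⟩ := h
    rw [List.getElem?_append_left (List.getElem?_eq_some_iff.1 h1).1]; exact h1

theorem unif {p : ℕ → ℕ → Prop} (hm : ∀ i k k', k ≤ k' → p i k → p i k') (n : ℕ)
    (h : ∀ i < n, ∃ k, p i k) : ∃ k, ∀ i < n, p i k := by
  induction n with
  | zero => exact ⟨0, by simp⟩
  | succ n ih =>
    obtain ⟨k, hk⟩ := ih fun i hi => h i (by omega)
    obtain ⟨k', hk'⟩ := h n (by omega)
    refine ⟨max k k', fun i hi => ?_⟩
    rcases Nat.lt_succ_iff_lt_or_eq.1 hi with h | h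
    · exact hm _ _ _ (le_max_left _ _) (hk i h)
    · subst h; exact hm _ _ _ (le_max_right _ _) hk'

theorem ev_pre_mono (O : ℕ → ℕ) (c : CodeO) {n v k k' : ℕ} (h : k ≤ k') (hv : v ∈ ev (lk (pre O k)) c n) :
    v ∈ ev (lk (pre O k')) c n := ev_mono (lk_mono (pre_prefix O h)) c n v hv

theorem ev_use (O : ℕ → ℕ) (c : CodeO) : ∀ n v, v ∈ ev (O : ℕ →. ℕ) c n → ∃ k, v ∈ ev (lk (pre O k)) c n := by
  induction c with
  | zero => exact fun n v h => ⟨0, h⟩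
  | succ => exact fun n v h => ⟨0, h⟩
  | left => exact fun n v h => ⟨0, h⟩
  | right => exact fun n v h => ⟨0, h⟩
  | oracle =>
    intro n v h
    refine ⟨n+1, ?_⟩
    have : v = O n := by simpa [ev] using h
    show v ∈ lk (pre O (n+1)) n
    rw [mem_lk, pre_getElem?, if_pos (by omega), this]
  | pair a b ha hb =>
    intro n v; rw [mem_ev_pair]
    rintro ⟨x, hx, y, hy, e⟩
    obtain ⟨k, hk⟩ := ha _ _ hx
    obtain ⟨k', hk'⟩ := hb _ _ hy
    exact ⟨max k k', mem_ev_pair.2 ⟨x, ev_pre_mono O a (le_max_left _ _) hk, y, ev_pre_mono O b (le_max_right _ _) hk', e⟩⟩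
  | comp a b ha hb =>
    intro n v; rw [mem_ev_comp]
    rintro ⟨x, hx, hy⟩
    obtain ⟨k, hk⟩ := hb _ _ hx
    obtain ⟨k', hk'⟩ := ha _ _ hy
    exact ⟨max k k', mem_ev_comp.2 ⟨x, ev_pre_mono O b (le_max_left _ _) hk, ev_pre_mono O a (le_max_right _ _) hk'⟩⟩
  | prec a b ha hb =>
    intro n v; rw [mem_ev_prec]
    rintro ⟨w, h1, h2, h3⟩
    obtain ⟨k, hk⟩ := ha _ _ h1
    obtain ⟨k', hk'⟩ := unif (p := fun y k => w (y+1) ∈ ev (lk (pre O k)) b (Nat.pair n.unpair.1 (Nat.pair y (w y))))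
      (fun i k k' h => ev_pre_mono O b h) n.unpair.2 fun y hy => hb _ _ (h3 y hy)
    exact ⟨max k k', mem_ev_prec.2 ⟨w, ev_pre_mono O a (le_max_left _ _) hk, h2,
      fun y hy => ev_pre_mono O b (le_max_right _ _) (hk' y hy)⟩⟩
  | rfind' a ha =>
    intro n v; rw [mem_ev_rfind]
    rintro ⟨w, k, h1, h2, h3, h4⟩
    obtain ⟨k', hk'⟩ := unif (p := fun y k => w y ∈ ev (lk (pre O k)) a (Nat.pair n.unpair.1 (y + n.unpair.2)))
      (fun i k k' h => ev_pre_mono O a h) (k+1) fun y hy => ha _ _ (h4 y (by omega))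
    exact ⟨k', mem_ev_rfind.2 ⟨w, k, h1, h2, h3, fun i hi => hk' i (by omega)⟩⟩

theorem lk_le (O : ℕ → ℕ) (k : ℕ) : ∀ n v, v ∈ lk (pre O k) n → v ∈ (O : ℕ →. ℕ) n := by
  intro n v; rw [mem_lk, pre_getElem?]
  split_ifs <;> simp [eq_comm]

theorem eval_use (O : ℕ → ℕ) (c : CodeO) (n v : ℕ) : v ∈ c.eval O n ↔ ∃ k, v ∈ ev (lk (pre O k)) c n := by
  rw [← ev_coe]
  exact ⟨ev_use O c n v, fun ⟨k, h⟩ => ev_mono (lk_le O k) c n v h⟩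

end RandProb

namespace RandProb
open Nat.Partrec (Code)

theorem exists_lookupC : ∃ c : Code, ∀ (L : List ℕ) (n : ℕ), c.eval (Nat.pair (Encodable.encode L) n) = (L[n]? : Part ℕ) := by
  have h : Computable fun p : List ℕ × ℕ => p.1[p.2]? := by
    have : Primrec fun p : List ℕ × ℕ => p.1[p.2]? := by fun_prop
    exact this.to_comp
  have h2 : Partrec fun p : List ℕ × ℕ => (p.1[p.2]? : Part ℕ) := h.ofOption
  obtain ⟨c, hc⟩ := Code.exists_code.1 h2
  refine ⟨c, fun L n => ?_⟩
  have := congrFun hc (Nat.pair (Encodable.encode L) n)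
  rw [this]
  simp only [Encodable.decode_prod_val, Nat.unpair_pair, Encodable.encodek, Encodable.decode_nat]
  cases h : L[n]? <;> simp [h]

/-- code for list lookup -/
noncomputable def lookupC : Code := Classical.choose exists_lookupC
theorem lookupC_eval (L : List ℕ) (n : ℕ) : lookupC.eval (Nat.pair (Encodable.encode L) n) = (L[n]? : Part ℕ) :=
  Classical.choose_spec exists_lookupC L n

/-- translation -/
noncomputable def tr (L : List ℕ) : CodeO → Code
  | .zero => .zero
  | .succ => .succ
  | .left => .left
  | .right => .right
  | .oracle => Code.curry lookupC (Encodable.encode L)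
  | .pair a b => .pair (tr L a) (tr L b)
  | .comp a b => .comp (tr L a) (tr L b)
  | .prec a b => .prec (tr L a) (tr L b)
  | .rfind' a => .rfind' (tr L a)

theorem tr_eval (L : List ℕ) (c : CodeO) : (tr L c).eval = ev (lk L) c := by
  induction c with
  | zero => rfl
  | succ => rfl
  | left => rfl
  | right => rfl
  | oracle => funext n; exact (Code.eval_curry _ _ _).trans (lookupC_eval L n)
  | pair a b ha hb => simp only [ev, tr, Code.eval, ha, hb]; rfl
  | comp a b ha hb => simp only [ev, tr, Code.eval, ha, hb]; rfl
  | prec a b ha hb => simp only [ev, tr, Code.eval, ha, hb]; rfl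
  | rfind' a ha => simp only [ev, tr, Code.eval, ha]; rfl

section
variable {α : Type*} [Primcodable α]
@[fun_prop] theorem P_codePair {f g : α → Code} (hf : Primrec f) (hg : Primrec g) :
    Primrec fun a => Code.pair (f a) (g a) := Code.primrec₂_pair.comp hf hg
@[fun_prop] theorem P_codeComp {f g : α → Code} (hf : Primrec f) (hg : Primrec g) :
    Primrec fun a => Code.comp (f a) (g a) := Code.primrec₂_comp.comp hf hg
@[fun_prop] theorem P_codePrec {f g : α → Code} (hf : Primrec f) (hg : Primrec g) :
    Primrec fun a => Code.prec (f a) (g a) := Code.primrec₂_prec.comp hf hg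
@[fun_prop] theorem P_codeRfind {f : α → Code} (hf : Primrec f) :
    Primrec fun a => Code.rfind' (f a) := Code.primrec_rfind'.comp hf
@[fun_prop] theorem P_codeCurry {f : α → Code} {g : α → ℕ} (hf : Primrec f) (hg : Primrec g) :
    Primrec fun a => Code.curry (f a) (g a) := Code.primrec₂_curry.comp hf hg
@[fun_prop] theorem P_evaln {k : α → ℕ} {f : α → Code} {g : α → ℕ} (hk : Primrec k) (hf : Primrec f) (hg : Primrec g) :
    Primrec fun a => Code.evaln (k a) (f a) (g a) :=
  Code.primrec_evaln.comp (P_pair (P_pair hk hf) hg)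
end

theorem P_tr0 : Primrec₂ fun (L : List ℕ) (e : ℕ) => tr L (dec e) := by
  let g : List ℕ → List Code → Option Code := fun L R =>
    let n := R.length - 5
    some (if R.length = 0 then Code.zero else if R.length = 1 then Code.succ else if R.length = 2 then Code.left
      else if R.length = 3 then Code.right else if R.length = 4 then Code.curry lookupC (Encodable.encode L)
      else if n % 4 = 0 then Code.pair (R.getD (n/4).unpair.1 Code.zero) (R.getD (n/4).unpair.2 Code.zero)
      else if n % 4 = 1 then Code.prec (R.getD (n/4).unpair.1 Code.zero) (R.getD (n/4).unpair.2 Code.zero)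
      else if n % 4 = 2 then Code.comp (R.getD (n/4).unpair.1 Code.zero) (R.getD (n/4).unpair.2 Code.zero)
      else Code.rfind' (R.getD (n/4) Code.zero))
  have hg : Primrec₂ g := by
    unfold Primrec₂
    simp only [g]
    fun_prop
  refine Primrec.nat_strong_rec _ hg fun L n => ?_
  simp only [g, List.length_map, List.length_range]
  congr 1
  match n with
  | 0 => simp [dec, tr]
  | 1 => simp [dec, tr]
  | 2 => simp [dec, tr]
  | 3 => simp [dec, tr]
  | 4 => simp [dec, tr]
  | n + 5 =>
    have hget : ∀ m, m < n + 5 → (List.map (fun e => tr L (dec e)) (List.range (n + 5))).getD m Code.zero = tr L (dec m) := by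
      intro m hm
      simp [List.getD, hm]
    have h1 := Nat.unpair_left_le (n/4)
    have h2 := Nat.unpair_right_le (n/4)
    simp only [Nat.add_sub_cancel]
    rw [if_neg (by omega), if_neg (by omega), if_neg (by omega), if_neg (by omega), if_neg (by omega)]
    rw [hget _ (by omega), hget _ (by omega), hget _ (by omega)]
    conv_rhs => unfold dec
    split_ifs <;> simp [tr]

@[fun_prop] theorem P_tr {α : Type*} [Primcodable α] {L : α → List ℕ} {e : α → ℕ} (hL : Primrec L) (he : Primrec e) :
    Primrec fun a => tr (L a) (dec (e a)) := P_tr0.comp hL he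

/-- step-bounded evaluation of code number `e` with finite oracle `L`. -/
def E (e : ℕ) (L : List ℕ) (n v : ℕ) : Prop :=
  exLt (L.length + 1) fun j => Code.evaln L.length (tr (L.take j) (dec e)) n = some v
/-- convergence -/
def conv (e : ℕ) (L : List ℕ) (n : ℕ) : Prop :=
  exLt (L.length + 1) fun j => (Code.evaln L.length (tr (L.take j) (dec e)) n).isSome = true

@[fun_prop] theorem P_E : PrimrecPred fun a : ℕ × List ℕ × ℕ × ℕ => E a.1 a.2.1 a.2.2.1 a.2.2.2 := by
  unfold E; fun_prop
@[fun_prop] theorem P_conv : PrimrecPred fun a : ℕ × List ℕ × ℕ => conv a.1 a.2.1 a.2.2 := by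
  unfold conv; fun_prop

theorem conv_iff {e : ℕ} {L : List ℕ} {n : ℕ} : conv e L n ↔ ∃ v, E e L n v := by
  unfold conv E exLt
  simp only [Option.isSome_iff_exists]
  constructor
  · rintro ⟨i, h, v, hv⟩; exact ⟨v, i, h, hv⟩
  · rintro ⟨v, i, h, hv⟩; exact ⟨i, h, v, hv⟩

theorem E_mono {e : ℕ} {L L' : List ℕ} {n v : ℕ} (h : L <+: L') : E e L n v → E e L' n v := by
  rintro ⟨j, hj, h1⟩
  have hl := h.length_le
  refine ⟨j, by omega, ?_⟩
  have : L'.take j = L.take j := by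
    obtain ⟨t, rfl⟩ := h
    rw [List.take_append_of_le_length (by omega)]
  show Code.evaln _ _ _ = _
  rw [this]
  exact Code.evaln_mono hl h1

theorem conv_mono {e : ℕ} {L L' : List ℕ} {n : ℕ} (h : L <+: L') : conv e L n → conv e L' n := by
  rw [conv_iff, conv_iff]; exact fun ⟨v, hv⟩ => ⟨v, E_mono h hv⟩

theorem E_bound {e : ℕ} {L : List ℕ} {n v : ℕ} : E e L n v → n < L.length := by
  rintro ⟨j, hj, h1⟩
  exact Code.evaln_bound h1

theorem E_ev {e : ℕ} {L : List ℕ} {n v : ℕ} (h : E e L n v) : v ∈ ev (lk L) (dec e) n := by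
  obtain ⟨j, hj, h1⟩ := h
  have := Code.evaln_sound h1
  rw [tr_eval] at this
  exact ev_mono (lk_mono (List.take_prefix _ _)) _ _ _ this

theorem E_unique {e : ℕ} {L : List ℕ} {n v w : ℕ} (h : E e L n v) (h' : E e L n w) : v = w :=
  Part.mem_unique (E_ev h) (E_ev h')

theorem E_sound {O : ℕ → ℕ} {e k n v : ℕ} (h : E e (pre O k) n v) : v ∈ (dec e).eval O n :=
  (eval_use O _ _ _).2 ⟨k, E_ev h⟩

theorem eval_iff (O : ℕ → ℕ) (e n v : ℕ) : v ∈ (dec e).eval O n ↔ ∃ k, E e (pre O k) n v := by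
  refine ⟨fun h => ?_, fun ⟨k, hk⟩ => E_sound hk⟩
  obtain ⟨k, hk⟩ := (eval_use O _ _ _).1 h
  rw [← tr_eval] at hk
  obtain ⟨s, hs⟩ := Code.evaln_complete.1 hk
  refine ⟨max s k, k, by simp, ?_⟩
  show Code.evaln _ _ _ = _
  rw [pre_take O (le_max_right _ _), pre_length]
  exact Code.evaln_mono (le_max_left _ _) hs

theorem dom_iff (O : ℕ → ℕ) (e n : ℕ) : ((dec e).eval O n).Dom ↔ ∃ k, conv e (pre O k) n := by
  simp only [conv_iff]
  rw [Part.dom_iff_mem]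
  simp only [eval_iff]
  exact exists_comm

/-! ### Uniform Σ₁ predicates -/

section Sg
variable {ι κ : Type*} {α β : Type} [Primcodable α] [Primcodable β]

/-- uniformly Σ₁ relative to a family of oracles. -/
def Sg (O : ι → ℕ → ℕ) (p : ι → α → Prop) : Prop :=
  ∃ f : α × List ℕ → Prop, PrimrecPred f ∧ ∀ i a, p i a ↔ ∃ k, f (a, pre (O i) k)

theorem Sg.of_eq {O : ι → ℕ → ℕ} {p q : ι → α → Prop} (h : Sg O p) (e : ∀ i a, q i a ↔ p i a) : Sg O q := by
  obtain ⟨f, hf, h⟩ := h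
  exact ⟨f, hf, fun i a => (e i a).trans (h i a)⟩

theorem Sg.reindex {O : ι → ℕ → ℕ} {p : ι → α → Prop} (h : Sg O p) (φ : κ → ι) :
    Sg (fun i => O (φ i)) (fun i a => p (φ i) a) := by
  obtain ⟨f, hf, h⟩ := h
  exact ⟨f, hf, fun i a => h _ a⟩

theorem Sg.comp {O : ι → ℕ → ℕ} {p : ι → α → Prop} (h : Sg O p) {g : β → α} (hg : Primrec g) :
    Sg O (fun i a => p i (g a)) := by
  obtain ⟨f, hf, h⟩ := h
  exact ⟨fun x => f (g x.1, x.2), by fun_prop, fun i a => h i _⟩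

/-- monotone normal form -/
theorem Sg.mono {O : ι → ℕ → ℕ} {p : ι → α → Prop} (h : Sg O p) :
    ∃ f : α × List ℕ → Prop, PrimrecPred f ∧ (∀ a L L', L <+: L' → f (a, L) → f (a, L')) ∧
      ∀ i a, p i a ↔ ∃ k, f (a, pre (O i) k) := by
  obtain ⟨f, hf, h⟩ := h
  refine ⟨fun x => exLt (x.2.length + 1) fun j => f (x.1, x.2.take j), by fun_prop, ?_, ?_⟩
  · rintro a L L' hL ⟨j, hj, h1⟩
    have hl := hL.length_le
    simp only at hj
    refine ⟨j, by simp only; omega, ?_⟩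
    obtain ⟨t, rfl⟩ := hL
    simpa only [List.take_append_of_le_length (show j ≤ L.length by omega)] using h1
  · intro i a
    rw [h]
    constructor
    · rintro ⟨k, hk⟩
      exact ⟨k, k, by simp, by simpa [pre_take _ le_rfl] using hk⟩
    · rintro ⟨k, j, hj, h1⟩
      simp only [pre_length] at hj
      simp only [pre_take (O i) (show j ≤ k by omega)] at h1
      exact ⟨j, h1⟩

theorem Sg.prim {O : ι → ℕ → ℕ} {p : α → Prop} (h : PrimrecPred p) : Sg O (fun _ => p) :=
  ⟨fun x => p x.1, by fun_prop, fun i a => by simp⟩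

theorem Sg.primL {O : ι → ℕ → ℕ} {p : α × List ℕ → Prop} (h : PrimrecPred p) :
    Sg O (fun i a => ∃ k, p (a, pre (O i) k)) := ⟨p, h, fun i a => Iff.rfl⟩

theorem Sg.and {O : ι → ℕ → ℕ} {p q : ι → α → Prop} (hp : Sg O p) (hq : Sg O q) : Sg O (fun i a => p i a ∧ q i a) := by
  obtain ⟨f, hf, fm, h⟩ := hp.mono
  obtain ⟨g, hg, gm, h'⟩ := hq.mono
  refine ⟨fun x => f x ∧ g x, by fun_prop, fun i a => ?_⟩
  simp only [h, h']
  constructor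
  · rintro ⟨⟨k, hk⟩, ⟨k', hk'⟩⟩
    exact ⟨max k k', fm _ _ _ (pre_prefix _ (le_max_left _ _)) hk, gm _ _ _ (pre_prefix _ (le_max_right _ _)) hk'⟩
  · rintro ⟨k, h1, h2⟩; exact ⟨⟨k, h1⟩, ⟨k, h2⟩⟩

theorem Sg.or {O : ι → ℕ → ℕ} {p q : ι → α → Prop} (hp : Sg O p) (hq : Sg O q) : Sg O (fun i a => p i a ∨ q i a) := by
  obtain ⟨f, hf, h⟩ := hp
  obtain ⟨g, hg, h'⟩ := hq
  refine ⟨fun x => f x ∨ g x, by fun_prop, fun i a => ?_⟩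
  simp only [h, h', exists_or]

theorem Sg.ex {O : ι → ℕ → ℕ} {p : ι → α × β → Prop} (hp : Sg O p) : Sg O (fun i a => ∃ b, p i (a, b)) := by
  obtain ⟨f, hf, h⟩ := hp
  refine ⟨fun x => exLt (x.2.length+1) fun w => exMem ((Encodable.decode w.unpair.1 : Option β).elim [] fun b => [b]) fun b =>
    f ((x.1, b), x.2.take w.unpair.2), ?_, fun i a => ?_⟩
  · have : Primrec fun o : Option β => o.elim [] (fun b => [b]) := by
      refine (Primrec.option_casesOn (f := fun _ => []) (g := fun _ b => [b]) Primrec.id (Primrec.const _) ?_).of_eq ?_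
      · exact (Primrec.list_cons.comp Primrec.snd (Primrec.const []))
      · rintro (_ | _) <;> rfl
    have h2 : Primrec fun w : ℕ => (Encodable.decode w : Option β).elim [] fun b => [b] := this.comp Primrec.decode
    have h3 : Primrec fun x : (α × List ℕ) × ℕ => (Encodable.decode x.2.unpair.1 : Option β).elim [] fun b => [b] :=
      h2.comp (by fun_prop)
    have h4 : PrimrecPred fun x : (α × List ℕ) × ℕ => exMem ((Encodable.decode x.2.unpair.1 : Option β).elim [] fun b => [b]) fun b =>
        f ((x.1.1, b), x.1.2.take x.2.unpair.2) := P_exMem h3 (by fun_prop)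
    exact P_exLt (by fun_prop) h4
  · constructor
    · rintro ⟨b, hb⟩
      obtain ⟨k, hk⟩ := (h i _).1 hb
      refine ⟨Nat.pair (Encodable.encode b) k, Nat.pair (Encodable.encode b) k, by simp, b, by simp, ?_⟩
      simpa [pre_take _ (Nat.right_le_pair _ _)] using hk
    · rintro ⟨k, w, hw, b, hb, h1⟩
      simp only [pre_length] at hw
      refine ⟨b, (h i _).2 ⟨w.unpair.2, ?_⟩⟩
      have := Nat.unpair_right_le w
      simpa only [pre_take (O i) (show w.unpair.2 ≤ k by omega)] using h1

theorem Sg.all_lt {O : ι → ℕ → ℕ} {p : ι → α × ℕ → Prop} (hp : Sg O p) {n : α → ℕ} (hn : Primrec n) :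
    Sg O (fun i a => ∀ m < n a, p i (a, m)) := by
  obtain ⟨f, hf, fm, h⟩ := hp.mono
  refine ⟨fun x => allLt (n x.1) fun m => f ((x.1, m), x.2), by fun_prop, fun i a => ?_⟩
  simp only [h]
  constructor
  · intro H
    exact unif (p := fun m k => f ((a, m), pre (O i) k)) (fun m k k' hk => fm _ _ _ (pre_prefix _ hk)) _ H
  · rintro ⟨k, hk⟩ m hm; exact ⟨k, hk m hm⟩

theorem Sg.ofDom (O : ι → ℕ → ℕ) (c : CodeO) : Sg O (fun i n => (c.eval (O i) n).Dom) := by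
  refine ⟨fun x => conv c.encode x.2 x.1, by fun_prop, fun i n => ?_⟩
  have := dom_iff (O i) c.encode n
  rwa [dec_encode] at this

/-- embed ordinary codes -/
def emb : Code → CodeO
  | .zero => .zero
  | .succ => .succ
  | .left => .left
  | .right => .right
  | .pair a b => .pair (emb a) (emb b)
  | .comp a b => .comp (emb a) (emb b)
  | .prec a b => .prec (emb a) (emb b)
  | .rfind' a => .rfind' (emb a)

theorem emb_eval (O : ℕ → ℕ) (c : Code) : (emb c).eval O = c.eval := by
  induction c with
  | zero => rfl
  | succ => rfl
  | left => rfl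
  | right => rfl
  | pair a b ha hb => simp only [emb, CodeO.eval, Code.eval, ha, hb]; rfl
  | comp a b ha hb => simp only [emb, CodeO.eval, Code.eval, ha, hb]; rfl
  | prec a b ha hb => simp only [emb, CodeO.eval, Code.eval, ha, hb]; rfl
  | rfind' a ha => simp only [emb, CodeO.eval, Code.eval, ha]; rfl

theorem exists_primC {f : ℕ → ℕ} (hf : Primrec f) : ∃ c : CodeO, ∀ O n, c.eval O n = Part.some (f n) := by
  obtain ⟨c, hc⟩ := Code.exists_code.1 (Partrec.nat_iff.1 hf.to_comp)
  refine ⟨emb c, fun O n => ?_⟩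
  rw [emb_eval, hc]; rfl

theorem eval_comp_some {O : ℕ → ℕ} {a b : CodeO} {n x : ℕ} (h : b.eval O n = Part.some x) :
    (CodeO.comp a b).eval O n = a.eval O x := by
  have : (CodeO.comp a b).eval O n = (b.eval O n).bind (fun x => a.eval O x) := rfl
  rw [this, h, Part.bind_some]
theorem eval_pair_some {O : ℕ → ℕ} {a b : CodeO} {n x y : ℕ} (h : a.eval O n = Part.some x) (h' : b.eval O n = Part.some y) :
    (CodeO.pair a b).eval O n = Part.some (Nat.pair x y) := by
  show Nat.pair <$> a.eval O n <*> b.eval O n = _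
  rw [h, h']; simp [Seq.seq]

theorem exists_preC : ∃ c : CodeO, ∀ O k, c.eval O k = Part.some (Encodable.encode (pre O k)) := by
  obtain ⟨st, hst⟩ := exists_primC (f := fun x => Encodable.encode (((Encodable.decode x.unpair.1 : Option (List ℕ)).getD []) ++ [x.unpair.2]))
    (by fun_prop)
  obtain ⟨yc, hyc⟩ := exists_primC (f := fun x => x.unpair.2.unpair.1) (by fun_prop)
  obtain ⟨ic, hic⟩ := exists_primC (f := fun x => x.unpair.2.unpair.2) (by fun_prop)
  obtain ⟨kc, hkc⟩ := exists_primC (f := fun x => Nat.pair 0 x) (by fun_prop)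
  obtain ⟨zc, hzc⟩ := exists_primC (f := fun x => Encodable.encode ([] : List ℕ)) (by fun_prop)
  refine ⟨.comp (.prec zc (.comp st (.pair ic (.comp .oracle yc)))) kc, fun O k => ?_⟩
  rw [eval_comp_some (hkc O k)]
  rw [Part.eq_some_iff, ← ev_coe, mem_ev_prec]
  simp only [ev_coe, Nat.unpair_pair]
  refine ⟨fun y => Encodable.encode (pre O y), ?_, rfl, fun y hy => ?_⟩
  · rw [hzc]; exact Part.mem_some _
  · have h1 : (CodeO.comp .oracle yc).eval O (Nat.pair 0 (Nat.pair y (Encodable.encode (pre O y)))) = Part.some (O y) := by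
      rw [eval_comp_some (hyc O _)]; simp [CodeO.eval]
    rw [eval_comp_some (eval_pair_some (hic O _) h1), hst]
    simp [pre_succ]

theorem exists_code_graph {O : ι → ℕ → ℕ} {p : ι → ℕ × ℕ → Prop} (hp : Sg O p)
    (hu : ∀ i n v w, p i (n, v) → p i (n, w) → v = w) :
    ∃ c : CodeO, ∀ i n v, v ∈ c.eval (O i) n ↔ p i (n, v) := by
  obtain ⟨f, hf, h⟩ := hp
  obtain ⟨pc, hpc⟩ := exists_preC
  obtain ⟨hc, hhc⟩ := exists_primC (f := fun x => if f ((x.unpair.1.unpair.1, x.unpair.1.unpair.2.unpair.1),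
    ((Encodable.decode x.unpair.2 : Option (List ℕ)).getD []).take x.unpair.1.unpair.2.unpair.2) then 0 else 1) (by fun_prop)
  obtain ⟨ic, hic⟩ := exists_primC (f := fun x => x) (by fun_prop)
  obtain ⟨sc, hsc⟩ := exists_primC (f := fun x => x.unpair.2) (by fun_prop)
  obtain ⟨kc, hkc⟩ := exists_primC (f := fun x => Nat.pair x 0) (by fun_prop)
  have hg : ∀ i n w, (CodeO.comp hc (.pair ic (.comp pc sc))).eval (O i) (Nat.pair n w) =
      Part.some (if f ((n, w.unpair.1), pre (O i) w.unpair.2) then 0 else 1) := by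
    intro i n w
    have h1 : (CodeO.comp pc sc).eval (O i) (Nat.pair n w) = Part.some (Encodable.encode (pre (O i) w)) := by
      rw [eval_comp_some (hsc _ _), hpc]; simp
    rw [eval_comp_some (eval_pair_some (hic _ _) h1), hhc]
    simp [pre_take _ (Nat.unpair_right_le w)]
  refine ⟨.comp .left (.comp (.rfind' (.comp hc (.pair ic (.comp pc sc)))) kc), fun i n v => ?_⟩
  have key : ∀ w, w ∈ (CodeO.comp (.rfind' (.comp hc (.pair ic (.comp pc sc)))) kc).eval (O i) n ↔
      f ((n, w.unpair.1), pre (O i) w.unpair.2) ∧ ∀ m < w, ¬ f ((n, m.unpair.1), pre (O i) m.unpair.2) := by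
    intro w
    rw [eval_comp_some (hkc _ _), ← ev_coe, mem_ev_rfind]
    simp only [ev_coe, Nat.unpair_pair, hg, Nat.add_zero, Part.mem_some_iff]
    constructor
    · rintro ⟨w', k, rfl, h0, h1, h2⟩
      refine ⟨by_contra fun hn => ?_, fun m hm hn => ?_⟩
      · have := h2 k le_rfl; rw [if_neg hn] at this; omega
      · have := h2 m hm.le; rw [if_pos hn] at this; exact h1 m hm this
    · rintro ⟨h1, h2⟩
      exact ⟨fun w => if f ((n, w.unpair.1), pre (O i) w.unpair.2) then 0 else 1, w, rfl, if_pos h1, fun m hm => by simp [h2 m hm], fun _ _ => rfl⟩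
  have key2 : v ∈ (CodeO.comp .left (.comp (.rfind' (.comp hc (.pair ic (.comp pc sc)))) kc)).eval (O i) n ↔
      ∃ w, w ∈ (CodeO.comp (.rfind' (.comp hc (.pair ic (.comp pc sc)))) kc).eval (O i) n ∧ v = w.unpair.1 := by
    refine Part.mem_bind_iff.trans (exists_congr fun w => and_congr_right fun _ => ?_)
    exact Part.mem_some_iff
  rw [key2]
  simp only [key]
  constructor
  · rintro ⟨w, ⟨h1, -⟩, rfl⟩
    exact (h i _).2 ⟨_, h1⟩
  · intro hv
    have : ∃ w : ℕ, f ((n, w.unpair.1), pre (O i) w.unpair.2) := by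
      obtain ⟨k, hk⟩ := (h i _).1 hv
      exact ⟨Nat.pair v k, by simpa using hk⟩
    refine ⟨Nat.find this, ⟨Nat.find_spec this, fun m hm => Nat.find_min this hm⟩, ?_⟩
    exact hu i n _ _ hv ((h i _).2 ⟨_, Nat.find_spec this⟩)

theorem exists_code_dom {O : ι → ℕ → ℕ} {p : ι → ℕ → Prop} (hp : Sg O p) :
    ∃ c : CodeO, ∀ i n, (c.eval (O i) n).Dom ↔ p i n := by
  have : Sg O (fun i (x : ℕ × ℕ) => p i x.1 ∧ x.2 = 0) := (hp.comp Primrec.fst).and (Sg.prim (by fun_prop))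
  obtain ⟨c, hc⟩ := exists_code_graph this (by rintro i n v w ⟨-, h1⟩ ⟨-, h2⟩; simp_all)
  refine ⟨c, fun i n => ?_⟩
  rw [Part.dom_iff_mem]
  simp [hc]

/-- single-oracle version -/
def S1 (O : ℕ → ℕ) (p : α → Prop) : Prop := Sg (fun _ : Unit => O) (fun _ => p)

theorem ceIn_iff {O : ℕ → ℕ} {S : Set ℕ} : CeIn O S ↔ S1 O (fun n => n ∈ S) := by
  constructor
  · rintro ⟨c, rfl⟩; exact Sg.ofDom (fun _ : Unit => O) c
  · intro h
    obtain ⟨c, hc⟩ := exists_code_dom h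
    exact ⟨c, Set.ext fun n => (hc () n).symm⟩

end Sg

end RandProb

namespace RandProb
open Nat.Partrec (Code)

/-! ### Post-style lemmas -/
section post
variable {α β : Type} [Primcodable α] [Primcodable β]

theorem jump_iff {O : ℕ → ℕ} {e : ℕ} : jump O e = 1 ↔ ((dec e).eval O e).Dom := by
  unfold jump
  constructor
  · intro h
    split_ifs at h with h1
    · obtain ⟨c, rfl, h2⟩ := h1
      rwa [dec_encode]
  · intro h
    rw [if_pos ⟨dec e, encode_dec e, h⟩]

theorem jump_zero_or (O : ℕ → ℕ) (e : ℕ) : jump O e = 0 ∨ jump O e = 1 := by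
  unfold jump; split_ifs <;> simp

theorem jump_conv {O : ℕ → ℕ} {e : ℕ} : jump O e = 1 ↔ ∃ k, conv e (pre O k) e := by
  rw [jump_iff, dom_iff]

theorem S1.of_eq {O : ℕ → ℕ} {p q : α → Prop} (h : S1 O p) (e : ∀ a, q a ↔ p a) : S1 O q :=
  Sg.of_eq h fun _ => e
theorem S1.comp {O : ℕ → ℕ} {p : α → Prop} (h : S1 O p) {g : β → α} (hg : Primrec g) : S1 O (fun a => p (g a)) :=
  Sg.comp h hg
theorem S1.and {O : ℕ → ℕ} {p q : α → Prop} (h : S1 O p) (h' : S1 O q) : S1 O (fun a => p a ∧ q a) := Sg.and h h'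
theorem S1.or {O : ℕ → ℕ} {p q : α → Prop} (h : S1 O p) (h' : S1 O q) : S1 O (fun a => p a ∨ q a) := Sg.or h h'
theorem S1.ex {O : ℕ → ℕ} {p : α × β → Prop} (h : S1 O p) : S1 O (fun a => ∃ b, p (a, b)) := Sg.ex h
theorem S1.prim {O : ℕ → ℕ} {p : α → Prop} (h : PrimrecPred p) : S1 O p := Sg.prim h
theorem S1.all_lt {O : ℕ → ℕ} {p : α × ℕ → Prop} (hp : S1 O p) {n : α → ℕ} (hn : Primrec n) :
    S1 O (fun a => ∀ m < n a, p (a, m)) := Sg.all_lt hp hn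
theorem S1.primL {O : ℕ → ℕ} {p : α × List ℕ → Prop} (h : PrimrecPred p) :
    S1 O (fun a => ∃ k, p (a, pre O k)) := Sg.primL (O := fun _ : Unit => O) h
theorem S1.mono {O : ℕ → ℕ} {p : α → Prop} (h : S1 O p) :
    ∃ f : α × List ℕ → Prop, PrimrecPred f ∧ (∀ a L L', L <+: L' → f (a, L) → f (a, L')) ∧
      ∀ a, p a ↔ ∃ k, f (a, pre O k) := by
  obtain ⟨f, h1, h2, h3⟩ := Sg.mono h
  exact ⟨f, h1, h2, h3 ()⟩

/-- code numbers of constant functions -/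
def constN (k : ℕ) : ℕ := natR k 0 fun _ r => 2 * (2 * Nat.pair 1 r + 1) + 5
@[fun_prop] theorem P_constN : Primrec constN := by unfold constN; fun_prop

theorem constN_eval (O : ℕ → ℕ) (k n : ℕ) : (dec (constN k)).eval O n = Part.some k := by
  have : ∃ c : CodeO, c.encode = constN k ∧ c.eval O n = Part.some k := by
    induction k with
    | zero => exact ⟨.zero, rfl, rfl⟩
    | succ k ih =>
      obtain ⟨c, h1, h2⟩ := ih
      refine ⟨.comp .succ c, ?_, ?_⟩
      · simp only [CodeO.encode, h1]; rfl
      · rw [eval_comp_some h2]; simp [CodeO.eval]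
  obtain ⟨c, h1, h2⟩ := this
  rw [← h1, dec_encode, h2]

theorem jump_red {O : ℕ → ℕ} {p : α → Prop} (h : S1 O p) :
    ∃ t : α → ℕ, Primrec t ∧ ∀ a, p a ↔ jump O (t a) = 1 := by
  have h' : S1 O (fun n : ℕ => ∃ a : α, Encodable.encode a = n ∧ p a) := by
    refine S1.ex (p := fun x : ℕ × α => Encodable.encode x.2 = x.1 ∧ p x.2) ?_
    exact (S1.prim (by fun_prop)).and (h.comp Primrec.snd)
  obtain ⟨c, hc⟩ := exists_code_dom h'
  refine ⟨fun a => 2 * (2 * Nat.pair c.encode (constN (Encodable.encode a)) + 1) + 5, by fun_prop, fun a => ?_⟩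
  have e : 2 * (2 * Nat.pair c.encode (constN (Encodable.encode a)) + 1) + 5 =
      (CodeO.comp c (dec (constN (Encodable.encode a)))).encode := by
    simp [CodeO.encode, encode_dec]
  rw [jump_iff]
  beta_reduce
  rw [e, dec_encode, eval_comp_some (constN_eval O _ _), hc () _]
  constructor
  · intro h; exact ⟨a, rfl, h⟩
  · rintro ⟨b, hb, h⟩; rwa [← Encodable.encode_injective hb]

theorem S1.jump_not {O : ℕ → ℕ} {p : α → Prop} (h : S1 O p) : S1 (jump O) (fun a => ¬ p a) := by
  obtain ⟨t, ht, h⟩ := jump_red h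
  refine ⟨fun x => x.2[t x.1]? = some 0, by fun_prop, fun _ a => ?_⟩
  simp only [h, pre_getElem?]
  constructor
  · intro h1
    exact ⟨t a + 1, by rw [if_pos (by omega), (jump_zero_or O (t a)).resolve_right h1]⟩
  · rintro ⟨k, hk⟩
    split_ifs at hk
    simp at hk; omega

theorem S1.jump {O : ℕ → ℕ} {p : α → Prop} (h : S1 O p) : S1 (jump O) p := by
  obtain ⟨t, ht, h⟩ := jump_red h
  refine ⟨fun x => x.2[t x.1]? = some 1, by fun_prop, fun _ a => ?_⟩
  simp only [h, pre_getElem?]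
  constructor
  · intro h1
    exact ⟨t a + 1, by rw [if_pos (by omega), h1]⟩
  · rintro ⟨k, hk⟩
    split_ifs at hk
    simpa using hk

theorem S1.jump_all {O : ℕ → ℕ} {p : α × β → Prop} (h : S1 O (fun x => ¬ p x)) : S1 (RandProb.jump O) (fun a => ∀ b, p (a, b)) := by
  refine (S1.jump_not (S1.ex h)).of_eq fun a => ?_
  simp

theorem post2 {O : ℕ → ℕ} {p : α → Prop} (h : S1 (jump O) p) :
    ∃ r : α × ℕ → Prop, S1 O r ∧ ∀ a, p a ↔ ∃ k, ¬ r (a, k) := by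
  obtain ⟨f, hf, hp⟩ := h
  have hp := hp ()
  let d : ℕ → List ℕ × ℕ := fun k => (Encodable.decode k : Option (List ℕ × ℕ)).getD ([], 0)
  have hd : Primrec d := by simp only [d]; fun_prop
  let G : (α × (List ℕ × ℕ)) × List ℕ → Prop := fun x => x.1.2.2 ≤ x.2.length ∧
    (¬ (f (x.1.1, x.1.2.1) ∧ allLt x.1.2.1.length fun i => x.1.2.1.getD i 0 = 0 ∨
        (x.1.2.1.getD i 0 = 1 ∧ conv i (x.2.take x.1.2.2) i)) ∨
      exLt x.1.2.1.length fun i => x.1.2.1.getD i 0 = 0 ∧ conv i x.2 i)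
  have hG : PrimrecPred G := by simp only [G]; fun_prop
  have hr : S1 O (fun y : α × (List ℕ × ℕ) => ∃ k, G (y, pre O k)) := S1.primL hG
  refine ⟨fun x => ∃ k, G ((x.1, d x.2), pre O k), hr.comp (g := fun x : α × ℕ => (x.1, d x.2)) (by fun_prop), fun a => ?_⟩
  have key : ∀ L t, (¬ ∃ k, G ((a, (L, t)), pre O k)) ↔ (f (a, L) ∧ (∀ i < L.length, L.getD i 0 = 0 ∨
        (L.getD i 0 = 1 ∧ conv i (pre O t) i))) ∧ ∀ i < L.length, L.getD i 0 = 0 → jump O i = 0 := by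
    intro L t
    simp only [G, pre_length]
    constructor
    · intro h
      push Not at h
      refine ⟨?_, fun i hi h0 => ?_⟩
      · have := (h t le_rfl).1
        rw [pre_take _ le_rfl] at this
        exact this
      · rcases jump_zero_or O i with h1 | h1
        · exact h1
        · exfalso
          obtain ⟨k, hk⟩ := jump_conv.1 h1
          exact (h (max t k) (le_max_left _ _)).2 ⟨i, hi, h0, conv_mono (pre_prefix _ (le_max_right _ _)) hk⟩
    · rintro ⟨h1, h2⟩ ⟨k, hk, h3 | ⟨i, hi, h3, h4⟩⟩
      · rw [pre_take _ hk] at h3; exact h3 h1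
      · have := h2 i hi h3
        have := jump_conv.2 ⟨k, h4⟩
        omega
  constructor
  · intro hpa
    obtain ⟨k, hk⟩ := (hp a).1 hpa
    have hget : ∀ i < k, (pre (jump O) k).getD i 0 = jump O i := by
      intro i hi; simp only [List.getD, pre_getElem?, hi, if_true, Option.getD_some]
    have : ∃ t, ∀ i < k, jump O i = 1 → conv i (pre O t) i := by
      refine unif (p := fun i t => jump O i = 1 → conv i (pre O t) i) (fun i t t' htt h1 h2 => conv_mono (pre_prefix _ htt) (h1 h2)) k ?_
      intro i hi
      by_cases h : jump O i = 1
      · obtain ⟨t, ht⟩ := jump_conv.1 h; exact ⟨t, fun _ => ht⟩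
      · exact ⟨0, fun h' => absurd h' h⟩
    obtain ⟨t, ht⟩ := this
    refine ⟨Encodable.encode (pre (jump O) k, t), ?_⟩
    simp only [d, Encodable.encodek, Option.getD_some]
    rw [key, pre_length]
    refine ⟨⟨hk, fun i hi => ?_⟩, fun i hi h0 => by rwa [hget i hi] at h0⟩
    rw [hget i hi]
    rcases jump_zero_or O i with h1 | h1
    · exact Or.inl h1
    · exact Or.inr ⟨h1, ht i hi h1⟩
  · rintro ⟨k, hk⟩
    obtain ⟨L, t⟩ : List ℕ × ℕ := d k
    have hk' : ¬ ∃ k', G ((a, ((d k).1, (d k).2)), pre O k') := hk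
    rw [key] at hk'
    obtain ⟨⟨h1, h2⟩, h3⟩ := hk'
    refine (hp a).2 ⟨(d k).1.length, ?_⟩
    have : (d k).1 = pre (jump O) (d k).1.length := by
      refine List.ext_getElem (by simp) fun i hi hi' => ?_
      have e1 : (d k).1.getD i 0 = (d k).1[i] := by simp [List.getD, hi]
      have e2 : (pre (jump O) (d k).1.length)[i] = jump O i := by simp [pre]
      rw [e2, ← e1]
      rcases h2 i hi with h0 | ⟨h0, hc⟩
      · rw [h3 i hi h0, h0]
      · rw [h0, jump_conv.2 ⟨_, hc⟩]
    rwa [← this]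

theorem diag (O : ℕ → ℕ) : ¬ S1 O (fun e => jump O e ≠ 1) := by
  intro h
  obtain ⟨c, hc⟩ := exists_code_dom h
  have := hc () c.encode
  have h2 := jump_iff (O := O) (e := c.encode)
  rw [dec_encode] at h2
  tauto

end post
end RandProb

namespace RandProb
open Nat.Partrec (Code)

/-! ### Rationals and dyadics -/

theorem enc_int (z : ℤ) : Encodable.encode z = if 0 ≤ z then 2 * z.natAbs else 2 * (z.natAbs - 1) + 1 := by
  rcases z with n | n
  · simp
    rfl
  · have : ¬ (0 ≤ Int.negSucc n) := by omega
    rw [if_neg this]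
    rfl
theorem enc_rat (q : ℚ) : Encodable.encode q = Nat.pair (Encodable.encode q.num) q.den := by
  rcases q with ⟨n, d, h1, h2⟩
  rfl

/-- value of a dyadic -/
noncomputable def dv (x : ℕ × ℕ) : ℝ := (x.1 : ℝ) / 2 ^ x.2

theorem dv_nonneg (x : ℕ × ℕ) : 0 ≤ dv x := by unfold dv; positivity

/-- rational code `m` is less than `j/2^s` -/
def rl (m j s : ℕ) : Prop := m.unpair.1 % 2 = 1 ∨ m.unpair.1 / 2 * 2 ^ s < j * m.unpair.2
/-- rational code `m` is greater than `j/2^s` -/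
def rg (m j s : ℕ) : Prop := m.unpair.1 % 2 = 0 ∧ j * m.unpair.2 < m.unpair.1 / 2 * 2 ^ s
@[fun_prop] theorem P_rl : PrimrecPred fun x : ℕ × ℕ × ℕ => rl x.1 x.2.1 x.2.2 := by unfold rl; fun_prop
@[fun_prop] theorem P_rg : PrimrecPred fun x : ℕ × ℕ × ℕ => rg x.1 x.2.1 x.2.2 := by unfold rg; fun_prop

theorem rat_cast_div (q : ℚ) : (q : ℝ) = (q.num : ℝ) / (q.den : ℝ) := by
  exact_mod_cast congrArg (Rat.cast (K := ℝ)) (Rat.num_div_den q).symm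

theorem rl_iff (q : ℚ) (j s : ℕ) : rl (Encodable.encode q) j s ↔ (q : ℝ) < dv (j, s) := by
  unfold rl dv
  have hd : (0 : ℝ) < q.den := by exact_mod_cast q.den_pos
  have h2 : (0 : ℝ) < 2 ^ s := by positivity
  rw [enc_rat, enc_int, Nat.unpair_pair]
  simp only
  rw [rat_cast_div, div_lt_div_iff₀ hd h2]
  split_ifs with h
  · have e : (q.num : ℝ) = (q.num.natAbs : ℝ) := by
      have : q.num = (q.num.natAbs : ℤ) := by omega
      conv_lhs => rw [this]
      exact Int.cast_natCast _
    rw [e]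
    have : ¬ (2 * q.num.natAbs % 2 = 1) := by omega
    simp only [this, false_or]
    rw [Nat.mul_div_cancel_left _ (by norm_num)]
    exact_mod_cast Iff.rfl
  · have : (2 * (q.num.natAbs - 1) + 1) % 2 = 1 := by omega
    simp only [this, true_or, true_iff]
    have hn : (q.num : ℝ) < 0 := by exact_mod_cast (not_le.1 h)
    calc (q.num : ℝ) * 2 ^ s < 0 := mul_neg_of_neg_of_pos hn h2
      _ ≤ _ := by positivity

theorem rg_iff (q : ℚ) (j s : ℕ) : rg (Encodable.encode q) j s ↔ dv (j, s) < (q : ℝ) := by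
  unfold rg dv
  have hd : (0 : ℝ) < q.den := by exact_mod_cast q.den_pos
  have h2 : (0 : ℝ) < 2 ^ s := by positivity
  rw [enc_rat, enc_int, Nat.unpair_pair]
  simp only
  rw [rat_cast_div, div_lt_div_iff₀ h2 hd]
  split_ifs with h
  · have e : (q.num : ℝ) = (q.num.natAbs : ℝ) := by
      have : q.num = (q.num.natAbs : ℤ) := by omega
      conv_lhs => rw [this]
      exact Int.cast_natCast _
    rw [e]
    have : (2 * q.num.natAbs % 2 = 0) := by omega
    simp only [this, true_and]
    rw [Nat.mul_div_cancel_left _ (by norm_num)]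
    exact_mod_cast Iff.rfl
  · have : ¬ (2 * (q.num.natAbs - 1) + 1) % 2 = 0 := by omega
    simp only [this, false_and, false_iff, not_lt]
    have hn : (q.num : ℝ) < 0 := by exact_mod_cast (not_le.1 h)
    calc (q.num : ℝ) * 2 ^ s ≤ 0 := (mul_neg_of_neg_of_pos hn h2).le
      _ ≤ _ := by positivity

/-- valid rational codes -/
def rvalid (m : ℕ) : Prop := 0 < m.unpair.2 ∧ allLt (m + 3) fun d =>
  Imp ((if m.unpair.1 % 2 = 0 then m.unpair.1 / 2 else m.unpair.1 / 2 + 1) % d = 0 ∧ m.unpair.2 % d = 0) (d ≤ 1)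
@[fun_prop] theorem P_rvalid : PrimrecPred rvalid := by unfold rvalid; fun_prop

theorem rvalid_iff (m : ℕ) : rvalid m ↔ ∃ q : ℚ, Encodable.encode q = m := by
  have cop : ∀ a b c : ℕ, 0 < b → b < c → (Nat.Coprime a b ↔ ∀ d < c, (a % d = 0 ∧ b % d = 0) → d ≤ 1) := by
    intro a b c hb hbc
    constructor
    · rintro h d - ⟨h1, h2⟩
      have := Nat.dvd_gcd (Nat.dvd_of_mod_eq_zero h1) (Nat.dvd_of_mod_eq_zero h2)
      rw [h] at this
      exact Nat.le_of_dvd one_pos this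
    · intro h
      have := h (Nat.gcd a b) (lt_of_le_of_lt (Nat.gcd_le_right _ hb) hbc)
        ⟨Nat.mod_eq_zero_of_dvd (Nat.gcd_dvd_left _ _), Nat.mod_eq_zero_of_dvd (Nat.gcd_dvd_right _ _)⟩
      have h2 := Nat.gcd_pos_of_pos_right a hb
      unfold Nat.Coprime; omega
  have hr := Nat.unpair_right_le m
  constructor
  · rintro ⟨h1, h2⟩
    have h3 := (cop _ _ (m+3) h1 (by omega)).2 h2
    let z : ℤ := if m.unpair.1 % 2 = 0 then ((m.unpair.1 / 2 : ℕ) : ℤ) else -((m.unpair.1 / 2 + 1 : ℕ) : ℤ)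
    have hz : z.natAbs = if m.unpair.1 % 2 = 0 then m.unpair.1 / 2 else m.unpair.1 / 2 + 1 := by
      simp only [z]; split_ifs
      · rw [Int.natAbs_natCast]
      · rw [Int.natAbs_neg, Int.natAbs_natCast]
    refine ⟨⟨z, m.unpair.2, by omega, by rw [hz]; exact h3⟩, ?_⟩
    rw [enc_rat, enc_int]
    simp only
    conv_rhs => rw [← Nat.pair_unpair m]
    congr 1
    by_cases h : m.unpair.1 % 2 = 0
    · have : 0 ≤ z := by simp only [z, h, if_true]; positivity
      rw [if_pos this, hz, if_pos h]; omega
    · have : ¬ 0 ≤ z := by simp only [z, h, if_false]; omega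
      rw [if_neg this, hz, if_neg h]; omega
  · rintro ⟨q, rfl⟩
    unfold rvalid
    have hr : q.den < Encodable.encode q + 3 := by
      rw [enc_rat]; have := Nat.right_le_pair (Encodable.encode q.num) q.den; omega
    refine ⟨?_, ?_⟩
    · rw [enc_rat, Nat.unpair_pair]; exact q.den_pos
    · have h := (cop q.num.natAbs q.den _ q.den_pos hr).1 q.reduced
      have e : (if (Encodable.encode q).unpair.1 % 2 = 0 then (Encodable.encode q).unpair.1 / 2 else (Encodable.encode q).unpair.1 / 2 + 1) = q.num.natAbs := by
        rw [enc_rat, Nat.unpair_pair, enc_int]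
        simp only
        split_ifs <;> omega
      rw [e]
      have e2 : (Encodable.encode q).unpair.2 = q.den := by rw [enc_rat, Nat.unpair_pair]
      rw [e2]
      exact h

/-- dyadic left-c.e. -/
def DLeft (O : ℕ → ℕ) (γ : ℝ) : Prop := S1 O (fun x : ℕ × ℕ => dv x < γ)

theorem exists_dv_between {a b : ℝ} (ha : 0 ≤ a) (hab : a < b) : ∃ x : ℕ × ℕ, a < dv x ∧ dv x < b := by
  obtain ⟨n, hn⟩ := exists_nat_gt (2 / (b - a))
  have hba : 0 < b - a := by linarith
  have h2n : (n : ℝ) < 2 ^ n := by exact_mod_cast Nat.lt_two_pow_self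
  have h2 : (0 : ℝ) < 2 ^ n := by positivity
  have h3 : 2 < (b - a) * 2 ^ n := by
    rw [div_lt_iff₀ hba] at hn
    nlinarith
  refine ⟨(⌊a * 2 ^ n⌋₊ + 1, n), ?_, ?_⟩
  · unfold dv
    rw [lt_div_iff₀ h2]
    push_cast
    exact Nat.lt_floor_add_one _
  · unfold dv
    rw [div_lt_iff₀ h2]
    have := Nat.floor_le (show 0 ≤ a * 2 ^ n by positivity)
    push_cast
    nlinarith

theorem leftCe_iff {O : ℕ → ℕ} {γ : ℝ} (hγ : 0 ≤ γ) : LeftCeIn O γ ↔ DLeft O γ := by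
  unfold LeftCeIn DLeft
  rw [ceIn_iff]
  constructor
  · intro h
    have h2 : S1 O (fun x : (ℕ × ℕ) × ℕ => rg x.2 x.1.1 x.1.2 ∧ x.2 ∈ {m | ∃ q : ℚ, Encodable.encode q = m ∧ (q : ℝ) < γ}) :=
      (S1.prim (by fun_prop)).and (h.comp Primrec.snd)
    refine (S1.ex h2).of_eq fun x => ?_
    constructor
    · intro hx
      obtain ⟨q, h1, h2⟩ := exists_rat_btwn hx
      exact ⟨Encodable.encode q, (rg_iff q _ _).2 h1, q, rfl, h2⟩
    · rintro ⟨m, h1, q, rfl, h2⟩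
      exact ((rg_iff q _ _).1 h1).trans h2
  · intro h
    have h2 : S1 O (fun x : ℕ × (ℕ × ℕ) => rl x.1 x.2.1 x.2.2 ∧ dv x.2 < γ) :=
      (S1.prim (by fun_prop)).and (h.comp Primrec.snd)
    have h3 : S1 O (fun m : ℕ => rvalid m ∧ (rl m 0 0 ∨ ∃ x : ℕ × ℕ, rl m x.1 x.2 ∧ dv x < γ)) :=
      (S1.prim (by fun_prop)).and ((S1.prim (by fun_prop)).or (S1.ex h2))
    refine h3.of_eq fun m => ?_
    rw [rvalid_iff]
    constructor
    · rintro ⟨q, rfl, hq⟩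
      refine ⟨⟨q, rfl⟩, ?_⟩
      simp only [rl_iff]
      rcases lt_or_ge (q : ℝ) 0 with h0 | h0
      · left; simpa [dv] using h0
      · right
        obtain ⟨x, h1, h2⟩ := exists_dv_between h0 hq
        exact ⟨x, h1, h2⟩
    · rintro ⟨⟨q, rfl⟩, h1⟩
      simp only [rl_iff] at h1
      refine ⟨q, rfl, ?_⟩
      rcases h1 with h1 | ⟨x, h1, h2⟩
      · have : (q : ℝ) < 0 := by simpa [dv] using h1
        linarith
      · exact lt_trans h1 h2

@[fun_prop] theorem P_findGreatest {α : Type*} [Primcodable α] {f : α → ℕ} {p : α → ℕ → Prop} [DecidableRel p]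
    (hf : Primrec f) (hp : PrimrecPred fun x : α × ℕ => p x.1 x.2) :
    Primrec fun x => (f x).findGreatest (p x) := Primrec.nat_findGreatest hf hp

theorem dv_scale (j t s : ℕ) (h : t ≤ s) : dv (j * 2 ^ (s - t), s) = dv (j, t) := by
  unfold dv
  have : (2 : ℝ) ^ s = 2 ^ (s - t) * 2 ^ t := by rw [← pow_add]; congr 1; omega
  push_cast
  rw [this]
  field_simp

/-- Approximations from below. -/
theorem approx {O : ℕ → ℕ} {γ : ℝ} (h0 : 0 ≤ γ) (h1 : γ ≤ 1) (h : DLeft O γ) :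
    ∃ A : List ℕ → ℕ, Primrec A ∧ (∀ s, dv (A (pre O s), s) ≤ γ) ∧ (0 < γ → ∀ s, dv (A (pre O s), s) < γ) ∧
      (Monotone fun s => dv (A (pre O s), s)) ∧ Filter.Tendsto (fun s => dv (A (pre O s), s)) Filter.atTop (nhds γ) := by
  obtain ⟨f, hf, fm, hp⟩ := h.mono
  let Q : List ℕ → ℕ → Prop := fun L j => j = 0 ∨ exLt (L.length + 1) fun t => exLt (j + 1) fun j' =>
    j = j' * 2 ^ (L.length - t) ∧ f ((j', t), L)
  have hQ : PrimrecPred fun x : List ℕ × ℕ => Q x.1 x.2 := by simp only [Q]; fun_prop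
  let A : List ℕ → ℕ := fun L => Nat.findGreatest (Q L) (2 ^ L.length)
  have hA : Primrec A := by simp only [A]; fun_prop
  have hAQ : ∀ s, Q (pre O s) (A (pre O s)) := fun s =>
    Nat.findGreatest_spec (P := Q (pre O s)) (m := 0) (Nat.zero_le _) (Or.inl rfl)
  have hQlt : ∀ s j, Q (pre O s) j → j = 0 ∨ dv (j, s) < γ := by
    rintro s j (h | ⟨t, ht, j', hj', e, h2⟩)
    · exact Or.inl h
    · right
      simp only [pre_length] at ht e
      rw [e, dv_scale _ _ _ (by omega)]
      exact (hp _).2 ⟨s, h2⟩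
  have hge : ∀ s t j, t ≤ s → dv (j, t) < γ → f ((j, t), pre O s) → dv (j, t) ≤ dv (A (pre O s), s) := by
    intro s t j hts hlt hf
    have hj : j ≤ 2 ^ t := by
      have : dv (j, t) ≤ 1 := by linarith
      unfold dv at this
      rw [div_le_one (by positivity)] at this
      exact_mod_cast this
    have h3 : j * 2 ^ (s - t) ≤ A (pre O s) := by
      refine Nat.le_findGreatest ?_ ?_
      · rw [pre_length]
        calc j * 2 ^ (s - t) ≤ 2 ^ t * 2 ^ (s - t) := Nat.mul_le_mul_right _ hj
          _ = 2 ^ s := by rw [← pow_add]; congr 1; omega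
      · right
        refine ⟨t, by rw [pre_length]; omega, j, ?_, by rw [pre_length], hf⟩
        have : 1 ≤ 2 ^ (s - t) := Nat.one_le_two_pow
        nlinarith
    rw [← dv_scale j t s hts]
    unfold dv
    simp only
    gcongr
  have hle : ∀ s, dv (A (pre O s), s) ≤ γ := by
    intro s
    rcases hQlt s _ (hAQ s) with h | h
    · rw [h]; simpa [dv] using h0
    · exact h.le
  have hmono : Monotone fun s => dv (A (pre O s), s) := by
    refine monotone_nat_of_le_succ fun s => ?_
    rcases hAQ s with h | ⟨t, ht, j', hj', e, h2⟩
    · rw [h]; simpa [dv] using dv_nonneg (A (pre O (s+1)), s+1)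
    · simp only [pre_length] at ht e
      rw [e, dv_scale _ _ _ (by omega)]
      exact hge (s+1) t j' (by omega) ((hp _).2 ⟨s, h2⟩) (fm _ _ _ (pre_prefix _ (by omega)) h2)
  refine ⟨A, hA, hle, fun hpos s => ?_, hmono, ?_⟩
  · rcases hQlt s _ (hAQ s) with h | h
    · rw [h]; simpa [dv] using hpos
    · exact h
  · refine tendsto_order.2 ⟨fun a ha => ?_, fun a ha => Filter.Eventually.of_forall fun s => lt_of_le_of_lt (hle s) ha⟩
    rcases lt_or_ge a 0 with hneg | hpos
    · exact Filter.Eventually.of_forall fun s => lt_of_lt_of_le hneg (dv_nonneg _)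
    · obtain ⟨⟨j, t⟩, hx1, hx2⟩ := exists_dv_between hpos ha
      obtain ⟨k, hk⟩ := (hp _).1 hx2
      filter_upwards [Filter.eventually_ge_atTop (max t k)] with s hs
      exact lt_of_lt_of_le hx1 (hge s t j (le_trans (le_max_left _ _) hs) hx2
        (fm _ _ _ (pre_prefix _ (le_trans (le_max_right _ _) hs)) hk))

/-- From approximations to left-c.e. -/
theorem DLeft.of_approx {O : ℕ → ℕ} {γ : ℝ} {N D : List ℕ → ℕ} (hN : Primrec N) (hD : Primrec D)
    (h : ∀ x : ℕ × ℕ, dv x < γ ↔ ∃ s, dv x < dv (N (pre O s), D (pre O s))) : DLeft O γ := by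
  have : PrimrecPred fun y : (ℕ × ℕ) × List ℕ => y.1.1 * 2 ^ (D y.2) < N y.2 * 2 ^ y.1.2 := by fun_prop
  refine (S1.primL this).of_eq fun x => ?_
  rw [h]
  refine exists_congr fun s => ?_
  unfold dv
  rw [div_lt_div_iff₀ (by positivity) (by positivity)]
  exact_mod_cast Iff.rfl

end RandProb

namespace RandProb
open Nat.Partrec (Code)

/-! ### Tests -/

theorem encode_pair_rat (p q : ℚ) : Encodable.encode (p, q) = Nat.pair (Encodable.encode p) (Encodable.encode q) := rfl

theorem random_dyadic {O : ℕ → ℕ} {α : ℝ} (h : MLRandomIn O α) {P : ℕ × (ℕ × ℕ) × (ℕ × ℕ) → Prop} (hP : S1 O P)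
    (hvol : ∀ i, volume {x : ℝ | ∃ d, P (i, d) ∧ dv d.1 < x ∧ x < dv d.2} ≤ ENNReal.ofReal ((2 : ℝ)⁻¹ ^ i)) :
    ∃ i, ∀ d, P (i, d) → ¬ (dv d.1 < α ∧ α < dv d.2) := by
  let eqc : ℕ → ℕ × ℕ → Prop := fun m d => ¬ rl m d.1 d.2 ∧ ¬ rg m d.1 d.2
  have heqc : ∀ q : ℚ, ∀ d, eqc (Encodable.encode q) d ↔ (q : ℝ) = dv d := by
    intro q d
    simp only [eqc, rl_iff, rg_iff, not_lt]
    exact ⟨fun h => le_antisymm h.2 h.1, fun h => ⟨h.ge, h.le⟩⟩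
  let W : Set ℕ := {w | ∃ d : (ℕ × ℕ) × (ℕ × ℕ), P (w.unpair.1, d) ∧ (eqc w.unpair.2.unpair.1 d.1 ∧ eqc w.unpair.2.unpair.2 d.2)}
  have hW : CeIn O W := by
    rw [ceIn_iff]
    refine S1.ex (p := fun x : ℕ × ((ℕ × ℕ) × (ℕ × ℕ)) => P (x.1.unpair.1, x.2) ∧ (eqc x.1.unpair.2.unpair.1 x.2.1 ∧ eqc x.1.unpair.2.unpair.2 x.2.2)) ?_
    refine S1.and ?_ (S1.prim (by simp only [eqc]; fun_prop))
    exact hP.comp (g := fun x : ℕ × ((ℕ × ℕ) × (ℕ × ℕ)) => (x.1.unpair.1, x.2)) (by fun_prop)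
  have hT : ∀ i, testSet W i = {x : ℝ | ∃ d, P (i, d) ∧ dv d.1 < x ∧ x < dv d.2} := by
    intro i
    ext x
    constructor
    · rintro ⟨p, q, ⟨d, hd, h1, h2⟩, h3, h4⟩
      rw [encode_pair_rat] at h1 h2 hd
      simp only [Nat.unpair_pair] at h1 h2 hd
      rw [heqc] at h1 h2
      exact ⟨d, hd, h1 ▸ h3, h2 ▸ h4⟩
    · rintro ⟨d, hd, h1, h2⟩
      refine ⟨(d.1.1 : ℚ) / 2 ^ d.1.2, (d.2.1 : ℚ) / 2 ^ d.2.2, ⟨d, ?_, ?_, ?_⟩, ?_, ?_⟩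
      · simpa only [Nat.unpair_pair] using hd
      · rw [encode_pair_rat]; simp only [Nat.unpair_pair]
        rw [heqc]; simp [dv]
      · rw [encode_pair_rat]; simp only [Nat.unpair_pair]
        rw [heqc]; simp [dv]
      · simpa [dv] using h1
      · simpa [dv] using h2
  obtain ⟨i, hi⟩ := h W hW (fun i => by rw [hT]; exact hvol i)
  rw [hT] at hi
  exact ⟨i, fun d hd hx => hi ⟨d, hd, hx.1, hx.2⟩⟩

/-! ### Dyadic cells -/

noncomputable def lvl (x : ℝ) (s : ℕ) : ℕ := ⌊x * 2 ^ s⌋₊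

theorem lvl_div {x : ℝ} {t s : ℕ} (h : t ≤ s) : lvl x s / 2 ^ (s - t) = lvl x t := by
  unfold lvl
  have := Nat.floor_div_natCast (x * 2 ^ s) (2 ^ (s - t))
  rw [← this]
  congr 1
  have e : (2 : ℝ) ^ s = 2 ^ t * 2 ^ (s - t) := by rw [← pow_add]; congr 1; omega
  rw [e]
  push_cast
  field_simp

def icell (j s : ℕ) : Set ℝ := Set.Ico (dv (j, s)) (dv (j + 1, s))

theorem mem_icell {x : ℝ} {j s : ℕ} : x ∈ icell j s ↔ 0 ≤ x ∧ lvl x s = j := by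
  unfold icell lvl dv
  have h2 : (0 : ℝ) < 2 ^ s := by positivity
  rw [Set.mem_Ico, div_le_iff₀ h2, lt_div_iff₀ h2]
  push_cast
  constructor
  · rintro ⟨h1, h3⟩
    have h4 : 0 ≤ x * 2 ^ s := le_trans (by positivity) h1
    refine ⟨by by_contra h; nlinarith, ?_⟩
    rw [Nat.floor_eq_iff h4]
    exact ⟨h1, h3⟩
  · rintro ⟨h1, h3⟩
    exact (Nat.floor_eq_iff (by positivity)).1 h3

theorem mem_icell_lvl {x : ℝ} (h : 0 ≤ x) (s : ℕ) : x ∈ icell (lvl x s) s := mem_icell.2 ⟨h, rfl⟩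

theorem lvl_le {x : ℝ} (h : 0 ≤ x) (s : ℕ) : dv (lvl x s, s) ≤ x := (mem_icell_lvl h s).1
theorem lt_lvl {x : ℝ} (h : 0 ≤ x) (s : ℕ) : x < dv (lvl x s + 1, s) := (mem_icell_lvl h s).2

theorem dv_succ (j s : ℕ) : dv (j + 1, s) = dv (j, s) + (2⁻¹ : ℝ) ^ s := by
  unfold dv
  rw [inv_pow]; push_cast; field_simp

theorem volume_icell (j s : ℕ) : volume (icell j s) = ENNReal.ofReal ((2⁻¹ : ℝ) ^ s) := by
  unfold icell
  rw [Real.volume_Ico, dv_succ]; congr 1; ring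

def MinC (C : ℕ → ℕ → Prop) (s j : ℕ) : Prop := C s j ∧ ∀ t < s, ¬ C t (j / 2 ^ (s - t))

def UC (C : ℕ → ℕ → Prop) : Set ℝ := {x | 0 ≤ x ∧ ∃ s, C s (lvl x s)}

theorem exists_min {C : ℕ → ℕ → Prop} {s j : ℕ} (h : C s j) : ∃ t ≤ s, MinC C t (j / 2 ^ (s - t)) := by
  have hex : ∃ t, t ≤ s ∧ C t (j / 2 ^ (s - t)) := ⟨s, le_rfl, by simpa using h⟩
  refine ⟨Nat.find hex, (Nat.find_spec hex).1, (Nat.find_spec hex).2, fun u hu => ?_⟩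
  have := Nat.find_min hex hu
  have h1 := (Nat.find_spec hex).1
  rw [Nat.div_div_eq_div_mul, ← pow_add]
  have e : s - Nat.find hex + (Nat.find hex - u) = s - u := by omega
  rw [e]
  exact fun h => this ⟨by omega, h⟩

theorem min_sum (C : ℕ → ℕ → Prop) :
    ∑' p : {p : ℕ × ℕ // MinC C p.1 p.2}, ENNReal.ofReal ((2⁻¹ : ℝ) ^ p.1.1) ≤ volume (UC C) := by
  have hd : Pairwise (Function.onFun Disjoint fun p : {p : ℕ × ℕ // MinC C p.1 p.2} => icell p.1.2 p.1.1) := by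
    rintro ⟨⟨s, j⟩, hp⟩ ⟨⟨s', j'⟩, hp'⟩ hne
    refine Set.disjoint_left.2 fun x hx hx' => hne ?_
    simp only [mem_icell] at hx hx' hp hp'
    rcases lt_trichotomy s s' with h | h | h
    · exfalso
      refine hp'.2 s h ?_
      rw [← hx'.2, lvl_div h.le, hx.2]; exact hp.1
    · subst h
      have : j = j' := by rw [← hx.2, hx'.2]
      subst this; rfl
    · exfalso
      refine hp.2 s' h ?_
      rw [← hx.2, lvl_div h.le, hx'.2]; exact hp'.1
  have h1 := measure_iUnion (μ := (volume : Measure ℝ)) hd (fun p => measurableSet_Ico)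
  simp only [volume_icell] at h1
  rw [← h1]
  refine measure_mono ?_
  refine Set.iUnion_subset fun p x hx => ?_
  rw [mem_icell] at hx
  exact ⟨hx.1, p.1.1, hx.2 ▸ p.2.1⟩

theorem min_cover (C : ℕ → ℕ → Prop) (T : ℕ → ℕ → Set ℝ) (c : ENNReal)
    (hT : ∀ s j, MinC C s j → volume (T s j) ≤ c * ENNReal.ofReal ((2⁻¹ : ℝ) ^ s)) :
    volume {x | ∃ s j, MinC C s j ∧ x ∈ T s j} ≤ c * volume (UC C) := by
  have e : {x | ∃ s j, MinC C s j ∧ x ∈ T s j} = ⋃ p : {p : ℕ × ℕ // MinC C p.1 p.2}, T p.1.1 p.1.2 := by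
    ext x
    simp only [Set.mem_setOf_eq, Set.mem_iUnion]
    constructor
    · rintro ⟨s, j, h, hx⟩; exact ⟨⟨(s, j), h⟩, hx⟩
    · rintro ⟨⟨⟨s, j⟩, h⟩, hx⟩; exact ⟨s, j, h, hx⟩
  rw [e]
  calc _ ≤ ∑' p : {p : ℕ × ℕ // MinC C p.1 p.2}, volume (T p.1.1 p.1.2) := measure_iUnion_le _
    _ ≤ ∑' p : {p : ℕ × ℕ // MinC C p.1 p.2}, c * ENNReal.ofReal ((2⁻¹ : ℝ) ^ p.1.1) :=
        ENNReal.tsum_le_tsum fun p => hT _ _ p.2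
    _ = c * ∑' p : {p : ℕ × ℕ // MinC C p.1 p.2}, ENNReal.ofReal ((2⁻¹ : ℝ) ^ p.1.1) := ENNReal.tsum_mul_left
    _ ≤ _ := by gcongr; exact min_sum C

/-- the cells of a test -/
def cell (f : ℕ × List ℕ → Prop) (i : ℕ) (L : List ℕ) (j : ℕ) : Prop :=
  exLt L.length fun m => f (Nat.pair i m, L) ∧ rvalid m.unpair.1 ∧ rvalid m.unpair.2 ∧
    rl m.unpair.1 j L.length ∧ rg m.unpair.2 (j + 1) L.length

theorem P_cell {f : ℕ × List ℕ → Prop} (hf : PrimrecPred f) :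
    PrimrecPred fun x : ℕ × List ℕ × ℕ => cell f x.1 x.2.1 x.2.2 := by unfold cell; fun_prop

theorem cell_iff {f : ℕ × List ℕ → Prop} {i : ℕ} {O : ℕ → ℕ} {s j : ℕ} :
    cell f i (pre O s) j ↔ ∃ p q : ℚ, Encodable.encode (p, q) < s ∧ f (Nat.pair i (Encodable.encode (p, q)), pre O s) ∧
      (p : ℝ) < dv (j, s) ∧ dv (j + 1, s) < (q : ℝ) := by
  constructor
  · rintro ⟨m, hm, h1, h2, h3, h4, h5⟩
    rw [rvalid_iff] at h2 h3
    obtain ⟨p, hp⟩ := h2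
    obtain ⟨q, hq⟩ := h3
    rw [pre_length] at *
    have e : Encodable.encode (p, q) = m := by
      rw [encode_pair_rat, hp, hq, Nat.pair_unpair]
    refine ⟨p, q, by omega, by rw [e]; exact h1, ?_, ?_⟩
    · rw [← rl_iff, hp]; exact h4
    · rw [← rg_iff, hq]; exact h5
  · rintro ⟨p, q, h1, h2, h3, h4⟩
    refine ⟨_, by rw [pre_length]; exact h1, h2, ?_⟩
    rw [encode_pair_rat, Nat.unpair_pair, pre_length]
    simp only [rl_iff, rg_iff, rvalid_iff]
    exact ⟨⟨p, rfl⟩, ⟨q, rfl⟩, h3, h4⟩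

def MonoL (f : ℕ × List ℕ → Prop) : Prop := ∀ a (L L' : List ℕ), L <+: L' → f (a, L) → f (a, L')

theorem dv_div_le (j s t : ℕ) (h : t ≤ s) : dv (j / 2 ^ (s - t), t) ≤ dv (j, s) := by
  rw [← dv_scale _ t s h]
  unfold dv; simp only
  gcongr
  exact Nat.div_mul_le_self j _

theorem dv_div_le' (j s t : ℕ) (h : t ≤ s) : dv (j + 1, s) ≤ dv (j / 2 ^ (s - t) + 1, t) := by
  rw [← dv_scale _ t s h]
  unfold dv; simp only
  gcongr
  have := Nat.lt_div_mul_add (a := j) (b := 2 ^ (s - t)) (by positivity)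
  rw [add_mul, one_mul]; omega

theorem cell_mono {f : ℕ × List ℕ → Prop} (fm : MonoL f) {i : ℕ} {O : ℕ → ℕ} {t s j : ℕ} (hts : t ≤ s)
    (h : cell f i (pre O t) (j / 2 ^ (s - t))) : cell f i (pre O s) j := by
  rw [cell_iff] at h ⊢
  obtain ⟨p, q, h1, h2, h3, h4⟩ := h
  exact ⟨p, q, by omega, fm _ _ _ (pre_prefix _ hts) h2, lt_of_lt_of_le h3 (dv_div_le _ _ _ hts),
    lt_of_le_of_lt (dv_div_le' _ _ _ hts) h4⟩

theorem UC_cell {f : ℕ × List ℕ → Prop} (fm : MonoL f) {O : ℕ → ℕ} {W : Set ℕ} (hW : ∀ w, w ∈ W ↔ ∃ s, f (w, pre O s))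
    (i : ℕ) {x : ℝ} : x ∈ UC (fun s j => cell f i (pre O s) j) ↔ 0 ≤ x ∧ x ∈ testSet W i := by
  constructor
  · rintro ⟨h0, s, hs⟩
    refine ⟨h0, ?_⟩
    rw [cell_iff] at hs
    obtain ⟨p, q, h1, h2, h3, h4⟩ := hs
    exact ⟨p, q, (hW _).2 ⟨s, h2⟩, lt_of_lt_of_le h3 (lvl_le h0 s), (lt_lvl h0 s).trans h4⟩
  · rintro ⟨h0, p, q, hw, h1, h2⟩
    refine ⟨h0, ?_⟩
    obtain ⟨k, hk⟩ := (hW _).1 hw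
    obtain ⟨n, hn⟩ := exists_pow_lt_of_lt_one (show 0 < min (x - p) (q - x) by rw [lt_min_iff]; constructor <;> linarith) (show (2⁻¹ : ℝ) < 1 by norm_num)
    rw [lt_min_iff] at hn
    set s := max n (max k (Encodable.encode (p, q) + 1))
    have hsn : n ≤ s := le_max_left _ _
    have hsk : k ≤ s := le_trans (le_max_left _ _) (le_max_right _ _)
    have hse : Encodable.encode (p, q) + 1 ≤ s := le_trans (le_max_right _ _) (le_max_right _ _)
    have hp : (2⁻¹ : ℝ) ^ s ≤ 2⁻¹ ^ n := pow_le_pow_of_le_one (by norm_num) (by norm_num) hsn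
    refine ⟨s, cell_iff.2 ⟨p, q, by omega, fm _ _ _ (pre_prefix _ hsk) hk, ?_, ?_⟩⟩
    · have := lt_lvl h0 s
      rw [dv_succ] at this; linarith
    · have := lvl_le h0 s
      rw [dv_succ]; linarith

end RandProb

namespace RandProb
open Nat.Partrec (Code)

section
variable {α : Type} [Primcodable α]

theorem S1.at {O : ℕ → ℕ} {p : α × List ℕ → Prop} (hp : PrimrecPred p) {n : α → ℕ} (hn : Primrec n) :
    S1 O (fun x => p (x, pre O (n x))) := by
  have h : PrimrecPred fun x : α × List ℕ => n x.1 ≤ x.2.length ∧ p (x.1, x.2.take (n x.1)) := by fun_prop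
  refine (S1.primL h).of_eq fun a => ?_
  constructor
  · intro h
    refine ⟨n a, ?_⟩
    show _ ∧ _
    rw [pre_length, pre_take _ le_rfl]
    exact ⟨le_rfl, h⟩
  · rintro ⟨k, h1, h2⟩
    simp only [pre_length] at h1
    simp only [pre_take _ h1] at h2
    exact h2
end

def minL (f : ℕ × List ℕ → Prop) (i : ℕ) (L : List ℕ) (j : ℕ) : Prop :=
  cell f i L j ∧ allLt L.length fun t => ¬ cell f i (L.take t) (j / 2 ^ (L.length - t))

theorem P_minL {f : ℕ × List ℕ → Prop} (hf : PrimrecPred f) :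
    PrimrecPred fun x : ℕ × List ℕ × ℕ => minL f x.1 x.2.1 x.2.2 := by
  have := P_cell hf
  unfold minL
  have h1 : PrimrecPred fun x : ℕ × List ℕ × ℕ => allLt x.2.1.length fun t => ¬ cell f x.1 (x.2.1.take t) (x.2.2 / 2 ^ (x.2.1.length - t)) := by
    have h2 : PrimrecPred fun y : (ℕ × List ℕ × ℕ) × ℕ => cell f y.1.1 (y.1.2.1.take y.2) (y.1.2.2 / 2 ^ (y.1.2.1.length - y.2)) :=
      this.comp (f := fun y : (ℕ × List ℕ × ℕ) × ℕ => (y.1.1, y.1.2.1.take y.2, y.1.2.2 / 2 ^ (y.1.2.1.length - y.2))) (by fun_prop)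
    fun_prop
  fun_prop

theorem minL_iff {f : ℕ × List ℕ → Prop} {i : ℕ} {O : ℕ → ℕ} {s j : ℕ} :
    minL f i (pre O s) j ↔ MinC (fun s j => cell f i (pre O s) j) s j := by
  unfold minL MinC
  refine and_congr Iff.rfl ?_
  show (∀ t < (pre O s).length, _) ↔ _
  simp only [pre_length]
  refine forall₂_congr fun t ht => ?_
  rw [pre_take _ ht.le]

theorem test_form {O : ℕ → ℕ} {W : Set ℕ} (hW : CeIn O W) :
    ∃ f : ℕ × List ℕ → Prop, PrimrecPred f ∧ MonoL f ∧ ∀ w, w ∈ W ↔ ∃ s, f (w, pre O s) := by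
  rw [ceIn_iff] at hW
  obtain ⟨f, hf, fm, hp⟩ := hW.mono
  exact ⟨f, hf, fun a L L' h => fm a L L' h, hp⟩

theorem vol_UC_le {f : ℕ × List ℕ → Prop} (fm : MonoL f) {O : ℕ → ℕ} {W : Set ℕ} (hW : ∀ w, w ∈ W ↔ ∃ s, f (w, pre O s)) (i : ℕ)
    (hv : volume (testSet W i) ≤ ENNReal.ofReal ((2 : ℝ)⁻¹ ^ i)) :
    volume (UC (fun s j => cell f i (pre O s) j)) ≤ ENNReal.ofReal ((2 : ℝ)⁻¹ ^ i) :=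
  le_trans (measure_mono fun x hx => ((UC_cell fm hW i).1 hx).2) hv

theorem sum_random {O : ℕ → ℕ} {Ω β : ℝ} (k : ℕ) (hR : MLRandomIn O Ω) (h0 : 0 < Ω) (h1 : Ω ≤ 1) (hΩ : DLeft O Ω)
    (hb0 : 0 ≤ β) (hb1 : β ≤ 1) (hβ : DLeft O β) : MLRandomIn O ((2⁻¹ : ℝ) ^ k * Ω + β) := by
  intro W hW hvol
  obtain ⟨f, hf, fm, hfW⟩ := test_form hW
  obtain ⟨A, hA, A1, A2, A3, A4⟩ := approx h0.le h1 hΩ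
  obtain ⟨B, hB, B1, -, B3, B4⟩ := approx hb0 hb1 hβ
  -- hit: j/2^s0 ≤ A/2^(s+k) + B/2^s + 1/2^s0
  let hit : ℕ × ℕ × List ℕ → Prop := fun x => x.1 * 2 ^ (x.2.2.length + k) ≤
    A x.2.2 * 2 ^ x.2.1 + B x.2.2 * 2 ^ k * 2 ^ x.2.1 + 2 ^ (x.2.2.length + k)
  have hhit : PrimrecPred hit := by simp only [hit]; fun_prop
  have hit_iff : ∀ j s0 s, hit (j, s0, pre O s) ↔
      dv (j, s0) - 2⁻¹ ^ s0 ≤ (2⁻¹ : ℝ) ^ k * dv (A (pre O s), s) + dv (B (pre O s), s) := by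
    intro j s0 s
    simp only [hit, pre_length, dv]
    rw [← Nat.cast_le (α := ℝ)]
    push_cast
    rw [inv_pow, inv_pow]
    have p1 : (0 : ℝ) < 2 ^ k := by positivity
    have p2 : (0 : ℝ) < 2 ^ s := by positivity
    have p3 : (0 : ℝ) < 2 ^ s0 := by positivity
    rw [pow_add]
    rw [sub_le_iff_le_add, div_le_iff₀ p3]
    have e : (((2:ℝ) ^ k)⁻¹ * (↑(A (pre O s)) / 2 ^ s) + ↑(B (pre O s)) / 2 ^ s + (2 ^ s0)⁻¹) * 2 ^ s0 =
      (↑(A (pre O s)) * 2 ^ s0 + ↑(B (pre O s)) * 2 ^ k * 2 ^ s0 + 2 ^ s * 2 ^ k) / (2 ^ s * 2 ^ k) := by field_simp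
    rw [e, le_div_iff₀ (by positivity)]
  let first : ℕ × ℕ × List ℕ → Prop := fun x => hit x ∧ allLt x.2.2.length fun t => ¬ hit (x.1, x.2.1, x.2.2.take t)
  have hfirst : PrimrecPred first := by simp only [first]; fun_prop
  have first_iff : ∀ j s0 s, first (j, s0, pre O s) ↔ hit (j, s0, pre O s) ∧ ∀ t < s, ¬ hit (j, s0, pre O t) := by
    intro j s0 s
    refine and_congr Iff.rfl ?_
    show (∀ t < (pre O s).length, _) ↔ _
    simp only [pre_length]
    refine forall₂_congr fun t ht => ?_
    rw [pre_take _ ht.le]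
  -- data: s0, j, s
  let P : ℕ × (ℕ × ℕ) × (ℕ × ℕ) → Prop := fun x => ∃ y : ℕ × ℕ × ℕ,
    minL f (x.1 + k + 1) (pre O y.1) y.2.1 ∧ (first (y.2.1, y.1, pre O y.2.2) ∧
      x.2 = ((A (pre O y.2.2), y.2.2), (A (pre O y.2.2) * 2 ^ y.1 + 2 ^ (y.2.2 + k + 1), y.2.2 + y.1)))
  have hP : S1 O P := by
    refine S1.ex (p := fun z : (ℕ × (ℕ × ℕ) × (ℕ × ℕ)) × (ℕ × ℕ × ℕ) => minL f (z.1.1 + k + 1) (pre O z.2.1) z.2.2.1 ∧ (first (z.2.2.1, z.2.1, pre O z.2.2.2) ∧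
      z.1.2 = ((A (pre O z.2.2.2), z.2.2.2), (A (pre O z.2.2.2) * 2 ^ z.2.1 + 2 ^ (z.2.2.2 + k + 1), z.2.2.2 + z.2.1)))) ?_
    refine S1.and ?_ ?_
    · exact S1.at (p := fun w : ((ℕ × (ℕ × ℕ) × (ℕ × ℕ)) × (ℕ × ℕ × ℕ)) × List ℕ => minL f (w.1.1.1 + k + 1) w.2 w.1.2.2.1)
        ((P_minL hf).comp (f := fun w : ((ℕ × (ℕ × ℕ) × (ℕ × ℕ)) × (ℕ × ℕ × ℕ)) × List ℕ => (w.1.1.1 + k + 1, w.2, w.1.2.2.1)) (by fun_prop))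
        (n := fun z : (ℕ × (ℕ × ℕ) × (ℕ × ℕ)) × (ℕ × ℕ × ℕ) => z.2.1) (by fun_prop)
    · exact S1.at (p := fun w : ((ℕ × (ℕ × ℕ) × (ℕ × ℕ)) × (ℕ × ℕ × ℕ)) × List ℕ => first (w.1.2.2.1, w.1.2.1, w.2) ∧
        w.1.1.2 = ((A w.2, w.1.2.2.2), (A w.2 * 2 ^ w.1.2.1 + 2 ^ (w.1.2.2.2 + k + 1), w.1.2.2.2 + w.1.2.1)))
        (by fun_prop)
        (n := fun z : (ℕ × (ℕ × ℕ) × (ℕ × ℕ)) × (ℕ × ℕ × ℕ) => z.2.2.2) (by fun_prop)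
  have dv2 : ∀ s s0, dv (A (pre O s) * 2 ^ s0 + 2 ^ (s + k + 1), s + s0) = dv (A (pre O s), s) + 2 ^ (k + 1) * 2⁻¹ ^ s0 := by
    intro s s0
    unfold dv
    push_cast
    rw [inv_pow]
    field_simp
    ring
  have hPv : ∀ i, volume {x : ℝ | ∃ d, P (i, d) ∧ dv d.1 < x ∧ x < dv d.2} ≤ ENNReal.ofReal ((2 : ℝ)⁻¹ ^ i) := by
    intro i
    let T : ℕ → ℕ → Set ℝ := fun s0 j => {x | ∃ s, first (j, s0, pre O s) ∧ dv (A (pre O s), s) < x ∧ x < dv (A (pre O s), s) + 2 ^ (k + 1) * 2⁻¹ ^ s0}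
    have hT := min_cover (fun s j => cell f (i + k + 1) (pre O s) j) T (ENNReal.ofReal (2 ^ (k + 1))) (by
      intro s0 j _
      rw [← ENNReal.ofReal_mul (by positivity)]
      by_cases h : ∃ s, first (j, s0, pre O s)
      · obtain ⟨s, hs⟩ := h
        have : T s0 j ⊆ Set.Ioo (dv (A (pre O s), s)) (dv (A (pre O s), s) + 2 ^ (k + 1) * 2⁻¹ ^ s0) := by
          rintro x ⟨s', hs', hx⟩
          have : s' = s := by
            rw [first_iff] at hs hs'
            rcases lt_trichotomy s s' with h | h | h
            · exact absurd hs.1 (hs'.2 _ h)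
            · exact h.symm
            · exact absurd hs'.1 (hs.2 _ h)
          subst this; exact hx
        refine (measure_mono this).trans ?_
        rw [Real.volume_Ioo]
        apply ENNReal.ofReal_le_ofReal; linarith
      · have : T s0 j = ∅ := by
          ext x; simp only [Set.mem_empty_iff_false, iff_false]
          rintro ⟨s, hs, _⟩; exact h ⟨s, hs⟩
        rw [this]; simp)
    calc _ ≤ volume {x | ∃ s j, MinC (fun s j => cell f (i + k + 1) (pre O s) j) s j ∧ x ∈ T s j} := by
          refine measure_mono ?_
          rintro x ⟨d, ⟨⟨s0, j, s⟩, h1, h2, rfl⟩, h3, h4⟩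
          exact ⟨s0, j, minL_iff.1 h1, s, h2, h3, by rw [← dv2]; exact h4⟩
      _ ≤ _ := hT
      _ ≤ ENNReal.ofReal (2 ^ (k + 1)) * ENNReal.ofReal ((2 : ℝ)⁻¹ ^ (i + k + 1)) := by
          gcongr; exact vol_UC_le fm hfW _ (hvol _)
      _ = _ := by
          rw [← ENNReal.ofReal_mul (by positivity)]
          congr 1
          rw [add_assoc, pow_add, inv_pow, inv_pow]; field_simp; ring
  obtain ⟨i, hi⟩ := random_dyadic hR hP hPv
  refine ⟨i + k + 1, fun hα => ?_⟩
  have hα0 : 0 ≤ (2⁻¹ : ℝ) ^ k * Ω + β := by positivity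
  set α := (2⁻¹ : ℝ) ^ k * Ω + β
  obtain ⟨-, s1, hs1⟩ := (UC_cell fm hfW (i + k + 1)).2 ⟨hα0, hα⟩
  obtain ⟨s0, hs0, hmin⟩ := exists_min (C := fun s j => cell f (i + k + 1) (pre O s) j) hs1
  rw [lvl_div hs0] at hmin
  set j := lvl α s0
  have ht : Filter.Tendsto (fun s => (2⁻¹ : ℝ) ^ k * dv (A (pre O s), s) + dv (B (pre O s), s)) Filter.atTop (nhds α) :=
    (A4.const_mul _).add B4
  have hex : ∃ s, hit (j, s0, pre O s) := by
    have hlt : dv (j, s0) - 2⁻¹ ^ s0 < α := by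
      have := lvl_le hα0 s0
      have h2 : (0 : ℝ) < 2⁻¹ ^ s0 := by positivity
      linarith
    obtain ⟨s, hs⟩ := (ht.eventually (lt_mem_nhds hlt)).exists
    exact ⟨s, (hit_iff _ _ _).2 hs.le⟩
  set s := Nat.find hex
  have hs := Nat.find_spec hex
  have hfs : first (j, s0, pre O s) := (first_iff _ _ _).2 ⟨hs, fun t ht => Nat.find_min hex ht⟩
  refine hi _ ⟨(s0, j, s), minL_iff.2 hmin, hfs, rfl⟩ ⟨A2 h0 s, ?_⟩
  show Ω < dv (A (pre O s) * 2 ^ s0 + 2 ^ (s + k + 1), s + s0)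
  rw [dv2]
  rw [hit_iff] at hs
  have u1 := lt_lvl hα0 s0
  rw [dv_succ] at u1
  have u2 := B1 s
  have u3 : (2⁻¹ : ℝ) ^ k * (Ω - dv (A (pre O s), s)) < 2 * 2⁻¹ ^ s0 := by
    have : α = (2⁻¹ : ℝ) ^ k * Ω + β := rfl
    simp only [j, s] at *
    linarith
  have u4 : (2 : ℝ) ^ k * ((2⁻¹ : ℝ) ^ k * (Ω - dv (A (pre O s), s))) < 2 ^ k * (2 * 2⁻¹ ^ s0) := by gcongr
  have u5 : (2 : ℝ) ^ k * ((2⁻¹ : ℝ) ^ k * (Ω - dv (A (pre O s), s))) = Ω - dv (A (pre O s), s) := by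
    rw [← mul_assoc, ← mul_pow]; norm_num
  have u6 : (2 : ℝ) ^ k * (2 * 2⁻¹ ^ s0) = 2 ^ (k + 1) * 2⁻¹ ^ s0 := by rw [pow_succ]; ring
  rw [u5, u6] at u4
  linarith

end RandProb

namespace RandProb
open Nat.Partrec (Code)

/-! ### Kucera-Slaman -/

noncomputable def ksState (a b : ℕ → ℝ) (n : ℕ) : ℕ → ℕ × ℕ
  | 0 => (0, 0)
  | s + 1 => if a (ksState a b n s).1 + 2⁻¹ ^ n * b (ksState a b n s).1 ≤ a (s + 1) + 2⁻¹ ^ n * b (ksState a b n s).2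
      then (s + 1, (ksState a b n s).1) else ksState a b n s

theorem ksState_le (a b : ℕ → ℝ) (n s : ℕ) : (ksState a b n s).2 ≤ (ksState a b n s).1 ∧ (ksState a b n s).1 ≤ s := by
  induction s with
  | zero => simp [ksState]
  | succ s ih =>
    rw [ksState]
    split_ifs
    · exact ⟨by simp; omega, le_rfl⟩
    · omega

theorem ks_mono (a b : ℕ → ℝ) (n : ℕ) :
    Monotone fun s => a (ksState a b n s).1 - 2⁻¹ ^ n * b (ksState a b n s).2 := by
  refine monotone_nat_of_le_succ fun s => ?_
  conv_rhs => rw [ksState]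
  split_ifs with h
  · simp only; linarith
  · exact le_rfl

theorem ks_t1_mono (a b : ℕ → ℝ) (n : ℕ) : Monotone fun s => (ksState a b n s).1 := by
  refine monotone_nat_of_le_succ fun s => ?_
  have := ksState_le a b n s
  conv_rhs => rw [ksState]
  split_ifs with h
  · simp only; omega
  · exact le_rfl

def ksI (a b : ℕ → ℝ) (n : ℕ) (s : ℕ) : Set ℝ := Set.Ioo (a (ksState a b n s).1)
  (a (ksState a b n s).1 + 2⁻¹ ^ n * (b (ksState a b n s).1 - b (ksState a b n s).2) + 2⁻¹ ^ (n + (ksState a b n s).1))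

theorem ks_vol (a b : ℕ → ℝ) (hb : Monotone b) (hb0 : ∀ s, 0 ≤ b s) (hb1 : ∀ s, b s ≤ 1) (n : ℕ) :
    volume {x | ∃ s, x ∈ ksI a b n s} ≤ ENNReal.ofReal (3 * 2⁻¹ ^ n) := by
  have hp : (0 : ℝ) < 2⁻¹ ^ n := by positivity
  have key : ∀ N, volume {x | ∃ s ≤ N, x ∈ ksI a b n s} ≤ ENNReal.ofReal (2⁻¹ ^ n * b (ksState a b n N).1 + 2⁻¹ ^ n * (2 - 2⁻¹ ^ N)) := by
    intro N
    induction N with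
    | zero =>
      have : {x | ∃ s ≤ 0, x ∈ ksI a b n s} = ksI a b n 0 := by ext x; simp
      rw [this, ksI, Real.volume_Ioo]
      apply ENNReal.ofReal_le_ofReal
      simp only [ksState]
      have := hb0 0
      norm_num
      nlinarith
    | succ N ih =>
      have hN : (0 : ℝ) < 2⁻¹ ^ N := by positivity
      by_cases h : a (ksState a b n N).1 + 2⁻¹ ^ n * b (ksState a b n N).1 ≤ a (N + 1) + 2⁻¹ ^ n * b (ksState a b n N).2
      · have e : ksState a b n (N + 1) = (N + 1, (ksState a b n N).1) := by rw [ksState, if_pos h]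
        have hsub : {x | ∃ s ≤ N + 1, x ∈ ksI a b n s} ⊆ {x | ∃ s ≤ N, x ∈ ksI a b n s} ∪ ksI a b n (N + 1) := by
          rintro x ⟨s, hs, hx⟩
          rcases Nat.le_succ_iff.1 hs with h | h
          · exact Or.inl ⟨s, h, hx⟩
          · subst h; exact Or.inr hx
        have hle := ksState_le a b n N
        have hbm : b (ksState a b n N).1 ≤ b (N + 1) := hb (by omega)
        refine (measure_mono hsub).trans ((measure_union_le _ _).trans ?_)
        refine (add_le_add_left ih _).trans ?_
        rw [ksI, Real.volume_Ioo, e, ← ENNReal.ofReal_add]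
        · apply ENNReal.ofReal_le_ofReal
          simp only
          rw [pow_add, pow_succ]
          nlinarith
        · have := hb0 (ksState a b n N).1
          have h1 : (2⁻¹ : ℝ) ^ N ≤ 1 := pow_le_one₀ (by norm_num) (by norm_num)
          have : 0 ≤ 2 - (2⁻¹ : ℝ) ^ N := by linarith
          positivity
        · simp only
          have : 0 ≤ (2⁻¹ : ℝ) ^ n * (b (N + 1) - b (ksState a b n N).1) := mul_nonneg hp.le (by linarith)
          have h2 : (0 : ℝ) < 2⁻¹ ^ (n + (N + 1)) := by positivity
          linarith
      · have e : ksState a b n (N + 1) = ksState a b n N := by rw [ksState, if_neg h]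
        have hsub : {x | ∃ s ≤ N + 1, x ∈ ksI a b n s} ⊆ {x | ∃ s ≤ N, x ∈ ksI a b n s} := by
          rintro x ⟨s, hs, hx⟩
          rcases Nat.le_succ_iff.1 hs with h | h
          · exact ⟨s, h, hx⟩
          · subst h; refine ⟨N, le_rfl, ?_⟩; unfold ksI at *; rw [e] at hx; exact hx
        refine (measure_mono hsub).trans (ih.trans ?_)
        rw [e]
        apply ENNReal.ofReal_le_ofReal
        rw [pow_succ]; nlinarith
  have e : {x | ∃ s, x ∈ ksI a b n s} = ⋃ N, {x | ∃ s ≤ N, x ∈ ksI a b n s} := by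
    ext x; simp only [Set.mem_iUnion]
    constructor
    · rintro ⟨s, hs⟩; exact ⟨s, s, le_rfl, hs⟩
    · rintro ⟨N, s, _, hs⟩; exact ⟨s, hs⟩
  have hm : Monotone fun N => {x | ∃ s ≤ N, x ∈ ksI a b n s} := by
    rintro N M h x ⟨s, hs, hx⟩; exact ⟨s, hs.trans h, hx⟩
  rw [e, hm.measure_iUnion]
  refine iSup_le fun N => (key N).trans (ENNReal.ofReal_le_ofReal ?_)
  have := hb1 (ksState a b n N).1
  have h1 : (0 : ℝ) < 2⁻¹ ^ N := by positivity
  nlinarith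

theorem ks_code {O : ℕ → ℕ} {a b : ℕ → ℝ} (A B : List ℕ → ℕ) (ha : ∀ s, a s = dv (A (pre O s), s)) (hb : ∀ s, b s = dv (B (pre O s), s)) :
    ∀ n S s, s ≤ S → (natR s ((0 : ℕ), (0 : ℕ)) fun s r =>
    if A ((pre O S).take r.1) * 2 ^ (s + 1 - r.1) * 2 ^ n + B ((pre O S).take r.1) * 2 ^ (s + 1 - r.1) ≤
      A ((pre O S).take (s + 1)) * 2 ^ n + B ((pre O S).take r.2) * 2 ^ (s + 1 - r.2) then (s + 1, r.1) else r) = ksState a b n s := by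
    intro n S s
    set F : ℕ → ℕ × ℕ := fun s => natR s ((0 : ℕ), (0 : ℕ)) fun s r =>
      if A ((pre O S).take r.1) * 2 ^ (s + 1 - r.1) * 2 ^ n + B ((pre O S).take r.1) * 2 ^ (s + 1 - r.1) ≤
      A ((pre O S).take (s + 1)) * 2 ^ n + B ((pre O S).take r.2) * 2 ^ (s + 1 - r.2) then (s + 1, r.1) else r
    show s ≤ S → F s = _
    induction s with
    | zero => intro _; rfl
    | succ s ih =>
      intro hs
      have e : F (s + 1) = (fun r : ℕ × ℕ => if A ((pre O S).take r.1) * 2 ^ (s + 1 - r.1) * 2 ^ n + B ((pre O S).take r.1) * 2 ^ (s + 1 - r.1) ≤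
          A ((pre O S).take (s + 1)) * 2 ^ n + B ((pre O S).take r.2) * 2 ^ (s + 1 - r.2) then (s + 1, r.1) else r) (F s) := rfl
      rw [e, ih (by omega)]
      have hle := ksState_le a b n s
      simp only
      rw [pre_take _ hs, pre_take _ (show (ksState a b n s).1 ≤ S by omega), pre_take _ (show (ksState a b n s).2 ≤ S by omega)]
      rw [ksState]
      refine if_congr ?_ rfl rfl
      generalize ksState a b n s = r at *
      simp only [ha, hb]
      rw [← dv_scale _ r.1 (s+1) (by omega), ← dv_scale _ r.1 (s+1) (by omega),
        ← dv_scale _ r.2 (s+1) (by omega)]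
      simp only [dv]
      rw [← Nat.cast_le (α := ℝ)]
      push_cast
      have p1 : (0 : ℝ) < 2 ^ (s+1) := by positivity
      have p2 : (0 : ℝ) < 2 ^ n := by positivity
      rw [← div_le_div_iff_of_pos_right (show (0 : ℝ) < 2 ^ (s+1) * 2 ^ n by positivity)]
      apply Eq.to_iff
      congr 1
      · rw [inv_pow]; field_simp; try ring
      · rw [inv_pow]; field_simp; try ring

set_option maxHeartbeats 4000000 in
theorem kucera_slaman {O : ℕ → ℕ} {α β : ℝ} (hR : MLRandomIn O α) (h0 : 0 < α) (h1 : α ≤ 1) (hα : DLeft O α)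
    (hb0 : 0 ≤ β) (hb1 : β ≤ 1) (hβ : DLeft O β) (n0 : ℕ) : ∃ n ≥ n0, DLeft O (α - 2⁻¹ ^ n * β) := by
  obtain ⟨A, hA, A1, A2, A3, A4⟩ := approx h0.le h1 hα
  obtain ⟨B, hB, B1, -, B3, B4⟩ := approx hb0 hb1 hβ
  obtain ⟨a, ha'⟩ : ∃ a : ℕ → ℝ, a = fun s => dv (A (pre O s), s) := ⟨_, rfl⟩
  obtain ⟨b, hb'⟩ : ∃ b : ℕ → ℝ, b = fun s => dv (B (pre O s), s) := ⟨_, rfl⟩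
  rw [← ha'] at A3 A4
  rw [← hb'] at B3 B4
  have ha : ∀ s, a s = dv (A (pre O s), s) := fun s => by rw [ha']
  have hb : ∀ s, b s = dv (B (pre O s), s) := fun s => by rw [hb']
  clear ha' hb'
  simp only [← ha] at A1 A2
  simp only [← hb] at B1
  obtain ⟨stf, hstf, stf_eq⟩ : ∃ stf : ℕ × List ℕ × ℕ → ℕ × ℕ, Primrec stf ∧
      ∀ n S s, s ≤ S → stf (n, pre O S, s) = ksState a b n s := by
   refine ⟨fun z => natR z.2.2 ((0 : ℕ), (0 : ℕ)) fun s r =>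
    if A (z.2.1.take r.1) * 2 ^ (s + 1 - r.1) * 2 ^ z.1 + B (z.2.1.take r.1) * 2 ^ (s + 1 - r.1) ≤
      A (z.2.1.take (s + 1)) * 2 ^ z.1 + B (z.2.1.take r.2) * 2 ^ (s + 1 - r.2) then (s + 1, r.1) else r, by fun_prop, ?_⟩
   exact ks_code A B ha hb
  let P : ℕ × (ℕ × ℕ) × (ℕ × ℕ) → Prop := fun x => ∃ s : ℕ,
    x.2.1 = (A (pre O (ksState a b (x.1 + 2 + n0) s).1), (ksState a b (x.1 + 2 + n0) s).1) ∧
    x.2.2 = (A (pre O (ksState a b (x.1 + 2 + n0) s).1) * 2 ^ (x.1 + 2 + n0) + (B (pre O (ksState a b (x.1 + 2 + n0) s).1) -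
      B (pre O (ksState a b (x.1 + 2 + n0) s).2) * 2 ^ ((ksState a b (x.1 + 2 + n0) s).1 - (ksState a b (x.1 + 2 + n0) s).2)) + 1,
      x.1 + 2 + n0 + (ksState a b (x.1 + 2 + n0) s).1)
  have hP : S1 O P := by
    let Q : ((ℕ × (ℕ × ℕ) × (ℕ × ℕ)) × List ℕ) × (ℕ × ℕ) → Prop := fun y =>
      y.1.1.2.1 = (A (y.1.2.take y.2.1), y.2.1) ∧
      y.1.1.2.2 = (A (y.1.2.take y.2.1) * 2 ^ (y.1.1.1 + 2 + n0) + (B (y.1.2.take y.2.1) -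
      B (y.1.2.take y.2.2) * 2 ^ (y.2.1 - y.2.2)) + 1, y.1.1.1 + 2 + n0 + y.2.1)
    have h3 : Primrec fun y : (ℕ × (ℕ × ℕ) × (ℕ × ℕ)) × List ℕ => stf (y.1.1 + 2 + n0, y.2, y.2.length) :=
      hstf.comp (g := fun y : (ℕ × (ℕ × ℕ) × (ℕ × ℕ)) × List ℕ => (y.1.1 + 2 + n0, y.2, y.2.length)) (by fun_prop)
    have hQ0 : PrimrecPred Q := by simp only [Q]; fun_prop
    have hQ : PrimrecPred fun y : (ℕ × (ℕ × ℕ) × (ℕ × ℕ)) × List ℕ => Q (y, stf (y.1.1 + 2 + n0, y.2, y.2.length)) :=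
      hQ0.comp (f := fun y : (ℕ × (ℕ × ℕ) × (ℕ × ℕ)) × List ℕ => (y, stf (y.1.1 + 2 + n0, y.2, y.2.length))) (by fun_prop)
    refine (S1.primL hQ).of_eq fun x => exists_congr fun s => ?_
    simp only [Q, pre_length]
    rw [stf_eq _ _ _ le_rfl]
    have hle := ksState_le a b (x.1 + 2 + n0) s
    rw [pre_take _ (show (ksState a b (x.1 + 2 + n0) s).1 ≤ s by omega), pre_take _ (show (ksState a b (x.1 + 2 + n0) s).2 ≤ s by omega)]
  have endp : ∀ n s, dv (A (pre O (ksState a b n s).1) * 2 ^ n + (B (pre O (ksState a b n s).1) -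
      B (pre O (ksState a b n s).2) * 2 ^ ((ksState a b n s).1 - (ksState a b n s).2)) + 1, n + (ksState a b n s).1) =
      a (ksState a b n s).1 + 2⁻¹ ^ n * (b (ksState a b n s).1 - b (ksState a b n s).2) + 2⁻¹ ^ (n + (ksState a b n s).1) := by
    intro n s
    have hle := ksState_le a b n s
    set t1 := (ksState a b n s).1
    set t0 := (ksState a b n s).2
    have hbb : b t0 ≤ b t1 := B3 hle.1
    simp only [hb] at hbb
    rw [← dv_scale _ t0 t1 hle.1] at hbb
    simp only [ha, hb]
    rw [← dv_scale _ t0 t1 hle.1]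
    unfold dv at *
    simp only at *
    have p1 : (0 : ℝ) < 2 ^ t1 := by positivity
    rw [div_le_div_iff_of_pos_right p1, Nat.cast_le] at hbb
    rw [Nat.cast_add, Nat.cast_add, Nat.cast_sub hbb]
    push_cast
    rw [inv_pow, inv_pow]; field_simp
    ring
  obtain ⟨i, hi⟩ := random_dyadic hR hP (by
    intro i
    calc _ ≤ volume {x | ∃ s, x ∈ ksI a b (i + 2 + n0) s} := by
          refine measure_mono ?_
          rintro x ⟨⟨d1, d2⟩, ⟨s, e1, e2⟩, h1, h2⟩
          simp only at e1 e2
          rw [e1] at h1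
          simp only [← ha] at h1
          rw [e2, endp] at h2
          exact ⟨s, h1, h2⟩
      _ ≤ _ := ks_vol a b B3 (fun s => hb s ▸ dv_nonneg _) (fun s => (B1 s).trans hb1) _
      _ ≤ _ := by
        apply ENNReal.ofReal_le_ofReal
        have h1 : (2⁻¹ : ℝ) ^ n0 ≤ 1 := pow_le_one₀ (by norm_num) (by norm_num)
        have h2 : (0 : ℝ) < 2⁻¹ ^ i := by positivity
        rw [pow_add, pow_add]
        nlinarith)
  obtain ⟨n, hnn⟩ : ∃ n, n = i + 2 + n0 := ⟨_, rfl⟩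
  refine ⟨n, by omega, ?_⟩
  have hi : ∀ d : (ℕ × ℕ) × (ℕ × ℕ), (∃ s : ℕ,
    d.1 = (A (pre O (ksState a b n s).1), (ksState a b n s).1) ∧
    d.2 = (A (pre O (ksState a b n s).1) * 2 ^ n + (B (pre O (ksState a b n s).1) -
      B (pre O (ksState a b n s).2) * 2 ^ ((ksState a b n s).1 - (ksState a b n s).2)) + 1,
      n + (ksState a b n s).1)) → ¬ (dv d.1 < α ∧ α < dv d.2) := by subst hnn; exact hi
  have hn : (0 : ℝ) < 2⁻¹ ^ n := by positivity
  -- transitions infinitely often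
  have htr : ∀ s, ∃ s' > s, (ksState a b n s').2 = (ksState a b n s).1 ∧ (ksState a b n s').1 > s := by
    intro s
    have hα : a (ksState a b n s).1 + 2⁻¹ ^ n * (b (ksState a b n s).1 - b (ksState a b n s).2) < α := by
      by_contra hcon
      refine hi (_, _) ⟨s, rfl, rfl⟩ ⟨?_, ?_⟩
      · show dv (A (pre O (ksState a b n s).1), (ksState a b n s).1) < α
        rw [← ha]; exact A2 h0 _
      show α < dv (_, n + (ksState a b n s).1)
      rw [endp n]
      have : (0 : ℝ) < 2⁻¹ ^ (n + (ksState a b n s).1) := by positivity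
      linarith
    obtain ⟨s1, hs1⟩ := Filter.eventually_atTop.1 (A4.eventually (lt_mem_nhds hα))
    by_contra hno
    push Not at hno
    have hst : ∀ k, ksState a b n (s + k) = ksState a b n s := by
      intro k
      induction k with
      | zero => rfl
      | succ k ih =>
        rw [← add_assoc, ksState, ih]
        split_ifs with h
        · exfalso
          have e : ksState a b n (s + k + 1) = (s + k + 1, (ksState a b n s).1) := by rw [ksState, ih, if_pos h]
          have := hno (s + k + 1) (by omega) (by rw [e])
          rw [e] at this; simp only at this; omega
        · rfl
    have hh := hs1 (s + s1 + 1) (by omega)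
    have e2 := hst (s1 + 1)
    rw [← add_assoc, ksState, hst] at e2
    rw [if_pos (by linarith)] at e2
    have := congrArg Prod.fst e2
    have := ksState_le a b n s
    simp only at *
    omega
  have ht1 : Filter.Tendsto (fun s => (ksState a b n s).1) Filter.atTop Filter.atTop := by
    refine Filter.tendsto_atTop_atTop_of_monotone (ks_t1_mono a b n) fun m => ?_
    obtain ⟨s', _, _, h⟩ := htr m
    exact ⟨s', by omega⟩
  have hex : ∀ y < α - 2⁻¹ ^ n * β, ∃ s, y < a (ksState a b n s).1 - 2⁻¹ ^ n * b (ksState a b n s).2 := by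
    intro y hy
    set ε := (α - 2⁻¹ ^ n * β) - y
    have hc := (ht1.eventually (Filter.tendsto_atTop.1 Filter.tendsto_id 0)).and ((A4.comp ht1).eventually (lt_mem_nhds (show y + 2⁻¹ ^ n * β < α by linarith)))
    obtain ⟨s, _, hs⟩ := hc.exists
    obtain ⟨s', h1, h2, h3⟩ := htr s
    refine ⟨s, ?_⟩
    have := B1 (ksState a b n s).2
    simp only [Function.comp] at hs
    have h4 : 2⁻¹ ^ n * b (ksState a b n s).2 ≤ 2⁻¹ ^ n * β := by gcongr
    linarith
  have hbound : ∀ s, a (ksState a b n s).1 - 2⁻¹ ^ n * b (ksState a b n s).2 ≤ α - 2⁻¹ ^ n * β := by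
    intro s
    have ht0 : Filter.Tendsto (fun s => (ksState a b n s).2) Filter.atTop Filter.atTop := by
      have hm0 : Monotone fun s => (ksState a b n s).2 := by
        refine monotone_nat_of_le_succ fun s => ?_
        have := ksState_le a b n s
        conv_rhs => rw [ksState]
        split_ifs with h
        · exact this.1
        · exact le_rfl
      refine Filter.tendsto_atTop_atTop_of_monotone hm0 fun m => ?_
      obtain ⟨s', _, _, h⟩ := htr m
      obtain ⟨s'', _, h', _⟩ := htr s'
      exact ⟨s'', by omega⟩
    have hT : Filter.Tendsto (fun s => a (ksState a b n s).1 - 2⁻¹ ^ n * b (ksState a b n s).2) Filter.atTop (nhds (α - 2⁻¹ ^ n * β)) :=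
      (A4.comp ht1).sub ((B4.comp ht0).const_mul _)
    exact (ks_mono a b n).ge_of_tendsto hT s
  let st : List ℕ → ℕ × ℕ := fun L => stf (n, L, L.length)
  have hst : Primrec st := hstf.comp (g := fun L : List ℕ => (n, L, L.length)) (by fun_prop)
  have hsteq : ∀ s, st (pre O s) = ksState a b n s := by
    intro s; simp only [st, pre_length]; exact stf_eq _ _ _ le_rfl
  refine DLeft.of_approx (N := fun L => A (L.take (st L).1) * 2 ^ n - B (L.take (st L).2) * 2 ^ ((st L).1 - (st L).2))
    (D := fun L => n + (st L).1) (by fun_prop) (by fun_prop) fun x => ?_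
  have hval : ∀ s, dv x < dv (A ((pre O s).take (st (pre O s)).1) * 2 ^ n - B ((pre O s).take (st (pre O s)).2) * 2 ^ ((st (pre O s)).1 - (st (pre O s)).2), n + (st (pre O s)).1)
      ↔ dv x < a (ksState a b n s).1 - 2⁻¹ ^ n * b (ksState a b n s).2 := by
    intro s
    rw [hsteq]
    have hle := ksState_le a b n s
    rw [pre_take _ (show (ksState a b n s).1 ≤ s by omega), pre_take _ (show (ksState a b n s).2 ≤ s by omega)]
    set t1 := (ksState a b n s).1
    set t0 := (ksState a b n s).2
    simp only [ha, hb]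
    rw [← dv_scale _ t0 t1 hle.1]
    have hx := dv_nonneg x
    have e : dv (A (pre O t1), t1) - 2⁻¹ ^ n * dv (B (pre O t0) * 2 ^ (t1 - t0), t1) =
      (((A (pre O t1) * 2 ^ n : ℕ) : ℝ) - ((B (pre O t0) * 2 ^ (t1 - t0) : ℕ) : ℝ)) / 2 ^ (n + t1) := by
      unfold dv; push_cast; rw [inv_pow, pow_add]; field_simp
    rw [e]
    rcases le_total (B (pre O t0) * 2 ^ (t1 - t0)) (A (pre O t1) * 2 ^ n) with h | h
    · rw [← Nat.cast_sub h]; rfl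
    · rw [Nat.sub_eq_zero_of_le h]
      have h2 : (((A (pre O t1) * 2 ^ n : ℕ) : ℝ) - ((B (pre O t0) * 2 ^ (t1 - t0) : ℕ) : ℝ)) / 2 ^ (n + t1) ≤ 0 := by
        apply div_nonpos_of_nonpos_of_nonneg
        · have : ((A (pre O t1) * 2 ^ n : ℕ) : ℝ) ≤ ((B (pre O t0) * 2 ^ (t1 - t0) : ℕ) : ℝ) := by exact_mod_cast h
          linarith
        · positivity
      constructor
      · intro h3; simp [dv] at h3; exfalso; simp only [dv] at hx; linarith
      · intro h3; linarith
  simp only [hval]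
  exact ⟨fun h => hex _ h, fun ⟨s, hs⟩ => lt_of_lt_of_le hs (hbound s)⟩

end RandProb

namespace RandProb
open Nat.Partrec (Code)

/-! ### Existence of a random left-c.e. real -/

def ucell (e : ℕ) (L : List ℕ) (j : ℕ) : Prop := cell (fun y => conv e y.2 y.1) (e + 3) L j
@[fun_prop] theorem P_ucell : PrimrecPred fun x : ℕ × List ℕ × ℕ => ucell x.1 x.2.1 x.2.2 := by
  unfold ucell cell; fun_prop

def Adm (e : ℕ) (L : List ℕ) (j : ℕ) : Prop := e + 3 ≤ L.length ∧ ucell e L j ∧ j < 2 ^ L.length ∧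
  cnt (2 ^ L.length) (fun j' => ucell e L j') ≤ 2 ^ (L.length - (e + 3))
@[fun_prop] theorem P_Adm : PrimrecPred fun x : ℕ × List ℕ × ℕ => Adm x.1 x.2.1 x.2.2 := by
  unfold Adm; fun_prop

def cov (L : List ℕ) (r : ℕ) : Prop := 4 * (r + 1) ≤ 2 ^ L.length ∨ exLt L.length fun e => exLt (L.length + 1) fun t =>
  Adm e (L.take t) (r / 2 ^ (L.length - t)) ∨ Adm e (L.take t) (r / 2 ^ (L.length - t) + 1)
@[fun_prop] theorem P_cov : PrimrecPred fun x : List ℕ × ℕ => cov x.1 x.2 := by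
  unfold cov; fun_prop

noncomputable def rS (L : List ℕ) : ℕ := lst (2 ^ L.length) fun r => ¬ cov L r
@[fun_prop] theorem P_rS : Primrec rS := by unfold rS; fun_prop

theorem cov_iff {O : ℕ → ℕ} {s r : ℕ} : cov (pre O s) r ↔ 4 * (r + 1) ≤ 2 ^ s ∨ ∃ e < s, ∃ t ≤ s,
    Adm e (pre O t) (r / 2 ^ (s - t)) ∨ Adm e (pre O t) (r / 2 ^ (s - t) + 1) := by
  unfold cov
  rw [pre_length]
  refine or_congr Iff.rfl ?_
  show (∃ e < s, ∃ t < s + 1, _) ↔ _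
  refine exists_congr fun e => and_congr Iff.rfl (exists_congr fun t => ?_)
  rw [Nat.lt_succ_iff]
  refine and_congr_right fun ht => ?_
  rw [pre_take _ ht]

theorem ucell_mono {O : ℕ → ℕ} {e t s j : ℕ} (hts : t ≤ s) (h : ucell e (pre O t) (j / 2 ^ (s - t))) : ucell e (pre O s) j :=
  cell_mono (fun a L L' h => conv_mono h) hts h

theorem vol_level (C : ℕ → Prop) (s : ℕ) : volume {x : ℝ | 0 ≤ x ∧ lvl x s < 2 ^ s ∧ C (lvl x s)} =
    ENNReal.ofReal (dv (cnt (2 ^ s) C, s)) := by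
  have e : {x : ℝ | 0 ≤ x ∧ lvl x s < 2 ^ s ∧ C (lvl x s)} = ⋃ j ∈ (Finset.range (2 ^ s)).filter C, icell j s := by
    ext x
    simp only [Set.mem_iUnion, Finset.mem_filter, Finset.mem_range, mem_icell]
    constructor
    · rintro ⟨h1, h2, h3⟩; exact ⟨_, ⟨h2, h3⟩, h1, rfl⟩
    · rintro ⟨j, ⟨h2, h3⟩, h1, rfl⟩; exact ⟨h1, h2, h3⟩
  rw [e, measure_biUnion_finset]
  · simp only [volume_icell]
    rw [Finset.sum_const, cnt_eq, nsmul_eq_mul, ← ENNReal.ofReal_natCast, ← ENNReal.ofReal_mul (by positivity)]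
    congr 1
    unfold dv
    rw [inv_pow]; rfl
  · intro j _ j' _ hne
    refine Set.disjoint_left.2 fun x hx hx' => hne ?_
    rw [mem_icell] at hx hx'
    rw [← hx.2, hx'.2]
  · intro j _; exact measurableSet_Ico

theorem lvl_lt {x : ℝ} (h0 : 0 ≤ x) (s : ℕ) : lvl x s < 2 ^ s ↔ x < 1 := by
  unfold lvl
  rw [Nat.floor_lt (by positivity)]
  push_cast
  have : (0 : ℝ) < 2 ^ s := by positivity
  constructor
  · intro h; nlinarith
  · intro h; nlinarith

theorem vol_adm (O : ℕ → ℕ) (e : ℕ) : volume (UC fun s j => Adm e (pre O s) j) ≤ ENNReal.ofReal (2⁻¹ ^ (e + 3)) := by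
  have e1 : (UC fun s j => Adm e (pre O s) j) = ⋃ N, {x | 0 ≤ x ∧ ∃ s ≤ N, Adm e (pre O s) (lvl x s)} := by
    ext x
    simp only [UC, Set.mem_iUnion, Set.mem_setOf_eq]
    constructor
    · rintro ⟨h, s, hs⟩; exact ⟨s, h, s, le_rfl, hs⟩
    · rintro ⟨N, h, s, _, hs⟩; exact ⟨h, s, hs⟩
  have hm : Monotone fun N => {x : ℝ | 0 ≤ x ∧ ∃ s ≤ N, Adm e (pre O s) (lvl x s)} := by
    rintro N M h x ⟨h0, s, hs, hx⟩; exact ⟨h0, s, hs.trans h, hx⟩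
  rw [e1, hm.measure_iUnion]
  refine iSup_le fun N => ?_
  by_cases hN : ∃ s, s ≤ N ∧ e + 3 ≤ s ∧ cnt (2 ^ s) (fun j' => ucell e (pre O s) j') ≤ 2 ^ (s - (e + 3))
  · obtain ⟨s, ⟨hs1, hs2, hs3⟩, hmax⟩ : ∃ s, (s ≤ N ∧ e + 3 ≤ s ∧ cnt (2 ^ s) (fun j' => ucell e (pre O s) j') ≤ 2 ^ (s - (e + 3))) ∧
        ∀ s', (s' ≤ N ∧ e + 3 ≤ s' ∧ cnt (2 ^ s') (fun j' => ucell e (pre O s') j') ≤ 2 ^ (s' - (e + 3))) → s' ≤ s := by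
      obtain ⟨s0, hs0⟩ := hN
      refine ⟨_, Nat.findGreatest_spec (P := fun s => s ≤ N ∧ e + 3 ≤ s ∧ cnt (2 ^ s) (fun j' => ucell e (pre O s) j') ≤ 2 ^ (s - (e + 3))) hs0.1 hs0, ?_⟩
      intro s' hs'
      exact Nat.le_findGreatest hs'.1 hs'
    refine (measure_mono (t := {x : ℝ | 0 ≤ x ∧ lvl x s < 2 ^ s ∧ ucell e (pre O s) (lvl x s)}) ?_).trans ?_
    · rintro x ⟨h0, s', hs', h1, h2, h3, h4⟩
      simp only [pre_length] at h1 h3 h4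
      have hle := hmax s' ⟨hs', h1, h4⟩
      refine ⟨h0, (lvl_lt h0 _).2 ((lvl_lt h0 _).1 h3), ucell_mono hle ?_⟩
      rw [lvl_div hle]; exact h2
    · rw [vol_level]
      apply ENNReal.ofReal_le_ofReal
      unfold dv
      rw [div_le_iff₀ (by positivity)]
      have e2 : (2⁻¹ : ℝ) ^ (e + 3) * 2 ^ s = 2 ^ (s - (e + 3)) := by
        rw [inv_pow, inv_mul_eq_div, div_eq_iff (by positivity), ← pow_add]; congr 1; omega
      rw [e2]
      exact_mod_cast hs3
  · have : {x : ℝ | 0 ≤ x ∧ ∃ s ≤ N, Adm e (pre O s) (lvl x s)} = ∅ := by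
      ext x
      simp only [Set.mem_empty_iff_false, iff_false]
      rintro ⟨h0, s', hs', h1, h2, h3, h4⟩
      simp only [pre_length] at h1 h3 h4
      exact hN ⟨s', hs', h1, h4⟩
    rw [this]; simp

theorem rS_le (O : ℕ → ℕ) (s : ℕ) : rS (pre O s) ≤ 2 ^ s := by
  have := (lst_spec (2 ^ (pre O s).length) fun r => ¬ cov (pre O s) r).1
  rw [pre_length] at this
  unfold rS; rw [pre_length]; exact this

theorem cov_of_lt {O : ℕ → ℕ} {s r : ℕ} (h : r < rS (pre O s)) : cov (pre O s) r :=
  not_not.1 ((lst_spec (2 ^ (pre O s).length) fun r => ¬ cov (pre O s) r).2.2 r h)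

theorem le_rS {O : ℕ → ℕ} {s m : ℕ} (hm : m ≤ 2 ^ s) (h : ∀ r < m, cov (pre O s) r) : m ≤ rS (pre O s) := by
  by_contra hlt
  push Not at hlt
  have := (lst_spec (2 ^ (pre O s).length) fun r => ¬ cov (pre O s) r).2.1 (by
    show rS (pre O s) < _; rw [pre_length]; omega)
  exact this (h _ hlt)

theorem cov_mono {O : ℕ → ℕ} {s s' r : ℕ} (hs : s ≤ s') (h : cov (pre O s) (r / 2 ^ (s' - s))) : cov (pre O s') r := by
  rw [cov_iff] at h ⊢
  rcases h with h | ⟨e, he, t, ht, h⟩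
  · left
    have h1 : 2 ^ s' = 2 ^ s * 2 ^ (s' - s) := by rw [← pow_add]; congr 1; omega
    have := Nat.lt_div_mul_add (a := r) (b := 2 ^ (s' - s)) (by positivity)
    rw [h1]
    calc 4 * (r + 1) ≤ 4 * (r / 2 ^ (s' - s) + 1) * 2 ^ (s' - s) := by rw [mul_assoc, add_mul, one_mul]; omega
      _ ≤ _ := Nat.mul_le_mul_right _ h
  · right
    refine ⟨e, by omega, t, by omega, ?_⟩
    rw [Nat.div_div_eq_div_mul, ← pow_add] at h
    have e1 : s' - s + (s - t) = s' - t := by omega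
    rw [e1] at h; exact h

theorem rS_mono (O : ℕ → ℕ) : Monotone fun s => dv (rS (pre O s), s) := by
  intro s s' hs
  simp only
  rw [← dv_scale _ s s' hs]
  have : rS (pre O s) * 2 ^ (s' - s) ≤ rS (pre O s') := by
    refine le_rS ?_ fun r hr => cov_mono hs (cov_of_lt ?_)
    · have h1 : 2 ^ s' = 2 ^ s * 2 ^ (s' - s) := by rw [← pow_add]; congr 1; omega
      rw [h1]; exact Nat.mul_le_mul_right _ (rS_le O s)
    · rw [Nat.div_lt_iff_lt_mul (by positivity)]; exact hr
  unfold dv; simp only; gcongr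

theorem rS_bound (O : ℕ → ℕ) (s : ℕ) : dv (rS (pre O s), s) ≤ 3 / 4 := by
  let Fat : ℕ → Set ℝ := fun e => {x | ∃ t j, MinC (fun s j => Adm e (pre O s) j) t j ∧ x ∈ Set.Ico (dv (j, t) - 2⁻¹ ^ t) (dv (j + 1, t))}
  have hFat : ∀ e, volume (Fat e) ≤ ENNReal.ofReal (2⁻¹ ^ (e + 2)) := by
    intro e
    refine (min_cover _ (fun t j => Set.Ico (dv (j, t) - 2⁻¹ ^ t) (dv (j + 1, t))) 2 ?_).trans ?_
    · intro t j _
      rw [Real.volume_Ico, dv_succ, show (2 : ENNReal) = ENNReal.ofReal 2 by simp, ← ENNReal.ofReal_mul (by norm_num)]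
      apply ENNReal.ofReal_le_ofReal; linarith
    · calc _ ≤ 2 * ENNReal.ofReal (2⁻¹ ^ (e + 3)) := by gcongr; exact vol_adm O e
        _ = _ := by
          rw [show (2 : ENNReal) = ENNReal.ofReal 2 by simp, ← ENNReal.ofReal_mul (by norm_num)]
          congr 1; ring
  have hsub : Set.Ico 0 (dv (rS (pre O s), s)) ⊆ Set.Ico 0 (1/4) ∪ ⋃ e, Fat e := by
    rintro x ⟨h0, hx⟩
    have hl : lvl x s < rS (pre O s) := by
      unfold dv at hx
      rw [lt_div_iff₀ (by positivity)] at hx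
      unfold lvl
      rw [Nat.floor_lt (by positivity)]; exact hx
    have hc := cov_of_lt hl
    rw [cov_iff] at hc
    have key : ∀ e t j, Adm e (pre O t) j → dv (j, t) - 2⁻¹ ^ t ≤ x → x < dv (j + 1, t) → x ∈ Fat e := by
      intro e t j h h1 h2
      obtain ⟨u, hu, hmin⟩ := exists_min (C := fun s j => Adm e (pre O s) j) h
      refine ⟨u, _, hmin, ?_, ?_⟩
      · have h3 := dv_div_le j t u hu
        have h4 : (2⁻¹ : ℝ) ^ t ≤ 2⁻¹ ^ u := pow_le_pow_of_le_one (by norm_num) (by norm_num) hu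
        linarith
      · have h3 := dv_div_le' j t u hu
        linarith
    rcases hc with h | ⟨e, he, t, ht, h⟩
    · left
      refine ⟨h0, ?_⟩
      have := lt_lvl h0 s
      unfold dv at this
      rw [lt_div_iff₀ (by positivity)] at this
      have h2 : (4 * (lvl x s + 1) : ℝ) ≤ 2 ^ s := by exact_mod_cast h
      push_cast at this
      have : (0 : ℝ) < 2 ^ s := by positivity
      by_contra hcon
      nlinarith
    · right
      rw [lvl_div ht] at h
      have hp : (0 : ℝ) < 2⁻¹ ^ t := by positivity
      rw [Set.mem_iUnion]
      refine ⟨e, ?_⟩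
      have := lt_lvl h0 t
      have h3 := lvl_le h0 t
      rcases h with h | h
      · exact key e t _ h (by linarith) this
      · refine key e t _ h ?_ ?_
        · rw [dv_succ]; linarith
        · rw [dv_succ]; linarith
  have hv := measure_mono (μ := (volume : Measure ℝ)) hsub
  have hv2 := hv.trans (measure_union_le _ _)
  rw [Real.volume_Ico, Real.volume_Ico] at hv2
  have hs1 : HasSum (fun e : ℕ => (2⁻¹ : ℝ) ^ (e + 2)) (1 / 2) := by
    have h := (hasSum_geometric_of_lt_one (r := (2⁻¹ : ℝ)) (by norm_num) (by norm_num)).mul_right ((2⁻¹ : ℝ) ^ 2)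
    simp only [← pow_add] at h
    have e1 : (1-(2⁻¹:ℝ))⁻¹ * 2⁻¹^2 = 1/2 := by norm_num
    rw [e1] at h; exact h
  have hv3 : volume (⋃ e, Fat e) ≤ ENNReal.ofReal (1 / 2) := by
    refine (measure_iUnion_le _).trans ?_
    refine (ENNReal.tsum_le_tsum hFat).trans ?_
    rw [← ENNReal.ofReal_tsum_of_nonneg (fun n => by positivity) hs1.summable, hs1.tsum_eq]
  have hv4 := hv2.trans (add_le_add_right hv3 _)
  rw [← ENNReal.ofReal_add (by norm_num) (by norm_num)] at hv4
  rw [ENNReal.ofReal_le_ofReal_iff (by norm_num)] at hv4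
  linarith

theorem exists_omega (O : ℕ → ℕ) : ∃ Ω : ℝ, 0 < Ω ∧ Ω ≤ 1 ∧ DLeft O Ω ∧ MLRandomIn O Ω := by
  have hbd : BddAbove (Set.range fun s => dv (rS (pre O s), s)) := ⟨3 / 4, by rintro _ ⟨s, rfl⟩; exact rS_bound O s⟩
  obtain ⟨Ω, hΩ⟩ : ∃ Ω, Ω = ⨆ s, dv (rS (pre O s), s) := ⟨_, rfl⟩
  have hle : ∀ s, dv (rS (pre O s), s) ≤ Ω := fun s => hΩ ▸ le_ciSup hbd s
  have hlt : ∀ x, x < Ω ↔ ∃ s, x < dv (rS (pre O s), s) := fun x => by rw [hΩ]; exact lt_ciSup_iff hbd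
  have hΩ1 : Ω ≤ 3 / 4 := by rw [hΩ]; exact ciSup_le fun s => rS_bound O s
  have hΩ0 : 0 < Ω := by
    have h1 : 1 ≤ rS (pre O 2) := le_rS (by norm_num) fun r hr => cov_iff.2 (Or.inl (by
      have : r = 0 := by omega
      subst this; norm_num))
    refine lt_of_lt_of_le ?_ (hle 2)
    unfold dv
    have : (1 : ℝ) ≤ rS (pre O 2) := by exact_mod_cast h1
    positivity
  refine ⟨Ω, hΩ0, by linarith, ?_, ?_⟩
  · exact DLeft.of_approx (N := rS) (D := fun L => L.length) (by fun_prop) (by fun_prop) fun x => by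
      rw [hlt]; simp only [pre_length]
  · rintro W ⟨c, hW⟩ hvol
    by_contra hno
    push Not at hno
    set e := c.encode
    have hfW : ∀ w, w ∈ W ↔ ∃ s, conv e (pre O s) w := by
      intro w
      rw [← dom_iff, dec_encode, hW]; rfl
    have fm : MonoL (fun y => conv e y.2 y.1) := fun a L L' h => conv_mono h
    have hUC := fun x => UC_cell (f := fun y => conv e y.2 y.1) fm (O := O) hfW (e + 3) (x := x)
    have hv := vol_UC_le (f := fun y => conv e y.2 y.1) fm hfW _ (hvol (e + 3))
    obtain ⟨-, s1, hs1⟩ := (hUC Ω).2 ⟨hΩ0.le, hno _⟩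
    change ucell e (pre O s1) _ at hs1
    set s := max s1 (e + 3)
    have hs : ucell e (pre O s) (lvl Ω s) := ucell_mono (le_max_left _ _) (by rw [lvl_div (le_max_left _ _)]; exact hs1)
    have hse : e + 3 ≤ s := le_max_right _ _
    have hj := (lvl_lt hΩ0.le s).2 (by linarith)
    have hadm : Adm e (pre O s) (lvl Ω s) := by
      refine ⟨by rw [pre_length]; exact hse, hs, by rw [pre_length]; exact hj, ?_⟩
      rw [pre_length]
      have h1 := vol_level (fun j => ucell e (pre O s) j) s
      have h2 : volume {x : ℝ | 0 ≤ x ∧ lvl x s < 2 ^ s ∧ ucell e (pre O s) (lvl x s)} ≤ ENNReal.ofReal (2⁻¹ ^ (e + 3)) :=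
        (measure_mono (t := UC fun s j => cell (fun y => conv e y.2 y.1) (e+3) (pre O s) j) (by
          rintro x ⟨h1,h2,h3⟩; exact ⟨h1, s, h3⟩)).trans hv
      rw [h1, ENNReal.ofReal_le_ofReal_iff (by positivity)] at h2
      unfold dv at h2
      rw [div_le_iff₀ (by positivity)] at h2
      have e2 : (2⁻¹ : ℝ) ^ (e + 3) * 2 ^ s = 2 ^ (s - (e + 3)) := by
        rw [inv_pow, inv_mul_eq_div, div_eq_iff (by positivity), ← pow_add]; congr 1; omega
      rw [e2] at h2
      exact_mod_cast h2
    obtain ⟨j, hjd⟩ : ∃ j, j = lvl Ω s := ⟨_, rfl⟩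
    rw [← hjd] at hj hadm
    have hlo : dv (j, s) - 2⁻¹ ^ s < Ω := by
      have := lvl_le hΩ0.le s
      rw [← hjd] at this
      have h2 : (0 : ℝ) < 2⁻¹ ^ s := by positivity
      linarith
    obtain ⟨s2, hs2⟩ := (hlt _).1 hlo
    set s' := max s s2
    have hss : s ≤ s' := le_max_left _ _
    have hs3 : dv (j, s) - 2⁻¹ ^ s < dv (rS (pre O s'), s') := lt_of_lt_of_le hs2 (rS_mono O (le_max_right _ _))
    have hk : (j + 1) * 2 ^ (s' - s) ≤ rS (pre O s') := by
      refine le_rS ?_ fun r hr => ?_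
      · have h1 : 2 ^ s' = 2 ^ s * 2 ^ (s' - s) := by rw [← pow_add]; congr 1; omega
        rw [h1]; exact Nat.mul_le_mul_right _ hj
      · by_cases hr' : r < rS (pre O s')
        · exact cov_of_lt hr'
        · refine cov_iff.2 (Or.inr ⟨e, by omega, s, hss, ?_⟩)
          have h1 : r / 2 ^ (s' - s) < j + 1 := by rw [Nat.div_lt_iff_lt_mul (by positivity)]; exact hr
          have h2 : j ≤ r / 2 ^ (s' - s) + 1 := by
            by_contra hcon
            push Not at hcon
            have h3 : dv (r / 2 ^ (s' - s) + 1 + 1, s) ≤ dv (j, s) := by unfold dv; simp only; gcongr; omega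
            rw [dv_succ] at h3
            have h4 := dv_div_le' r s' s hss
            have h5 : dv (rS (pre O s'), s') ≤ dv (r + 1, s') := by unfold dv; simp only; gcongr; omega
            linarith
          rcases Nat.lt_or_ge (r / 2 ^ (s' - s)) j with h | h
          · right
            have : r / 2 ^ (s' - s) + 1 = j := by omega
            rw [this]; exact hadm
          · left
            have : r / 2 ^ (s' - s) = j := by omega
            rw [this]; exact hadm
    have h1 : dv ((j + 1) * 2 ^ (s' - s), s') ≤ dv (rS (pre O s'), s') := by
      unfold dv; simp only; gcongr
    rw [dv_scale _ _ _ hss] at h1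
    have h2 := lt_lvl hΩ0.le s
    rw [← hjd] at h2
    linarith [hle s']

end RandProb

namespace RandProb
open Nat.Partrec (Code)

/-! ### The measure on Cantor space -/

/-- initial segments of an oracle in Cantor space, as lists of numbers -/
abbrev px (X : Cantor) (s : ℕ) : List ℕ := pre (oX X) s

/-- the binary expansion of `j` with `s` bits -/
def nb (s j : ℕ) : List ℕ := (List.range s).map fun i => j / 2 ^ (s - 1 - i) % 2
@[fun_prop] theorem P_nb : Primrec fun x : ℕ × ℕ => nb x.1 x.2 := by unfold nb; fun_prop

theorem digits_lvl {y : ℝ} (h0 : 0 ≤ y) (n : ℕ) : digits y n = decide (lvl y (n + 1) % 2 = 1) := by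
  unfold digits lvl
  have h : (0 : ℝ) ≤ y * 2 ^ (n + 1) := by positivity
  rw [← Int.natCast_floor_eq_floor h]
  congr 1
  apply propext
  norm_cast

theorem px_digits {y : ℝ} (h0 : 0 ≤ y) (s : ℕ) : px (digits y) s = nb s (lvl y s) := by
  unfold px pre nb
  refine List.map_congr_left fun i hi => ?_
  rw [List.mem_range] at hi
  unfold oX
  rw [digits_lvl h0]
  have := lvl_div (x := y) (t := i + 1) (s := s) (by omega)
  have e : s - 1 - i = s - (i + 1) := by omega
  rw [e, this]
  rcases Nat.mod_two_eq_zero_or_one (lvl y (i + 1)) with h | h <;> simp [h]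

theorem measurable_digits : Measurable digits := by
  refine measurable_pi_lambda _ fun n => ?_
  unfold digits
  have h1 : Measurable fun x : ℝ => ⌊x * 2 ^ (n + 1)⌋ := Int.measurable_floor.comp (measurable_id.mul_const _)
  exact (measurable_of_countable fun z : ℤ => decide (z % 2 = 1)).comp h1

theorem mu_apply {S : Set Cantor} (hS : MeasurableSet S) :
    mu S = volume {y : ℝ | (0 ≤ y ∧ y < 1) ∧ digits y ∈ S} := by
  unfold mu
  rw [Measure.map_apply measurable_digits hS, Measure.restrict_apply (measurable_digits hS)]
  congr 1
  ext y
  simp only [Set.mem_inter_iff, Set.mem_preimage, Set.mem_Ico, Set.mem_ofPred_eq]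
  tauto

instance : IsProbabilityMeasure mu := by
  constructor
  rw [mu_apply MeasurableSet.univ]
  have : {y : ℝ | (0 ≤ y ∧ y < 1) ∧ digits y ∈ Set.univ} = Set.Ico 0 1 := by ext y; simp
  rw [this, Real.volume_Ico]; simp

theorem measurable_px (s : ℕ) (C : List ℕ → Prop) : MeasurableSet {X : Cantor | C (px X s)} := by
  have e : {X : Cantor | C (px X s)} = (fun X : Cantor => fun i : Fin s => X i) ⁻¹'
      {f | C ((List.range s).map fun i => if h : i < s then cond (f ⟨i, h⟩) 1 0 else 0)} := by
    ext X
    simp only [Set.mem_ofPred_eq, Set.mem_preimage]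
    have : px X s = (List.range s).map fun i => if h : i < s then cond (X i) 1 0 else 0 := by
      unfold px pre
      refine List.map_congr_left fun i hi => ?_
      rw [List.mem_range] at hi
      simp [hi, oX]
    rw [this]
  rw [e]
  refine MeasurableSet.preimage (Set.to_countable _).measurableSet ?_
  exact measurable_pi_lambda _ fun i => measurable_pi_apply _

theorem mu_level (C : List ℕ → Prop) (s : ℕ) :
    muR {X : Cantor | C (px X s)} = dv (cnt (2 ^ s) (fun j => C (nb s j)), s) := by
  unfold muR
  rw [mu_apply (measurable_px s C)]
  have e : {y : ℝ | (0 ≤ y ∧ y < 1) ∧ digits y ∈ {X : Cantor | C (px X s)}} =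
      {x : ℝ | 0 ≤ x ∧ lvl x s < 2 ^ s ∧ C (nb s (lvl x s))} := by
    ext y
    simp only [Set.mem_ofPred_eq, and_assoc]
    refine and_congr_right fun h0 => ?_
    rw [lvl_lt h0, px_digits h0]
  rw [e, vol_level (fun j => C (nb s j)), ENNReal.toReal_ofReal (dv_nonneg _)]

theorem muR_nonneg (S : Set Cantor) : 0 ≤ muR S := ENNReal.toReal_nonneg
theorem muR_le_one (S : Set Cantor) : muR S ≤ 1 := by
  unfold muR
  exact ENNReal.toReal_le_of_le_ofReal (by norm_num) (by simpa using prob_le_one)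

/-! ### Measurability and approximation of `COMPL` -/

/-- approximation to the halting problem -/
noncomputable def Cs (s n : ℕ) : ℕ := if conv n (List.replicate s 0) n then 1 else 0
@[fun_prop] theorem P_Cs : Primrec fun x : ℕ × ℕ => Cs x.1 x.2 := by unfold Cs; fun_prop

theorem pre_zero (s : ℕ) : pre (fun _ => 0) s = List.replicate s 0 := by
  unfold pre
  simp

/-- the halting problem -/
noncomputable abbrev K : ℕ → ℕ := chi HaltingSet

theorem mem_halting {n : ℕ} : n ∈ HaltingSet ↔ ∃ s, conv n (List.replicate s 0) n := by
  show iterJump 1 n = 1 ↔ _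
  simp only [← pre_zero]
  exact jump_conv

theorem Cs_zero_or (s n : ℕ) : Cs s n = 0 ∨ Cs s n = 1 := by unfold Cs; split <;> simp
theorem K_zero_or (n : ℕ) : K n = 0 ∨ K n = 1 := by unfold K chi; split <;> simp
theorem K_one {n : ℕ} : K n = 1 ↔ ∃ s, Cs s n = 1 := by
  have : K n = 1 ↔ n ∈ HaltingSet := by unfold K chi; split <;> simp_all
  rw [this, mem_halting]
  refine exists_congr fun s => ?_
  unfold Cs; split <;> simp_all
theorem Cs_mono {s t n : ℕ} (h : s ≤ t) (hs : Cs s n = 1) : Cs t n = 1 := by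
  unfold Cs at *
  rw [if_pos]
  rw [← pre_zero]
  refine conv_mono (pre_prefix _ h) ?_
  rw [pre_zero]
  by_contra hn
  rw [if_neg hn] at hs; omega
theorem Cs_le_K {s n : ℕ} (hs : Cs s n = 1) : K n = 1 := K_one.2 ⟨s, hs⟩
theorem Cs_ev (n : ℕ) : ∃ s0, ∀ s ≥ s0, Cs s n = K n := by
  by_cases h : K n = 1
  · obtain ⟨s, hs⟩ := K_one.1 h
    exact ⟨s, fun t ht => by rw [h, Cs_mono ht hs]⟩
  · refine ⟨0, fun s _ => ?_⟩
    rcases Cs_zero_or s n with h' | h'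
    · rw [h', (K_zero_or n).resolve_right h]
    · exact absurd (Cs_le_K h') h
theorem Cs_ev_lt (N : ℕ) : ∃ s0, ∀ s ≥ s0, ∀ n < N, Cs s n = K n := by
  induction N with
  | zero => exact ⟨0, by intros; omega⟩
  | succ N ih =>
    obtain ⟨a, ha⟩ := ih
    obtain ⟨b, hb⟩ := Cs_ev N
    refine ⟨max a b, fun s hs n hn => ?_⟩
    rcases Nat.lt_succ_iff_lt_or_eq.1 hn with h | rfl
    · exact ha s (le_trans (le_max_left _ _) hs) n h
    · exact hb s (le_trans (le_max_right _ _) hs)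

/-- characteristic list, up to `M`, of the `L`-approximation of the domain of machine `c` -/
noncomputable def chl (c : ℕ) (L : List ℕ) (M : ℕ) : List ℕ := (List.range M).map fun x => if conv c L x then 1 else 0
@[fun_prop] theorem P_chl : Primrec fun x : ℕ × List ℕ × ℕ => chl x.1 x.2.1 x.2.2 := by unfold chl; fun_prop

theorem mem_domSet {c : CodeO} {X : Cantor} {n : ℕ} : n ∈ domSet c X ↔ ∃ k, conv c.encode (px X k) n := by
  rw [← dom_iff, dec_encode]; rfl

theorem chl_ev (c : CodeO) (X : Cantor) (M : ℕ) : ∃ s0, ∀ s ≥ s0, chl c.encode (px X s) M = pre (chi (domSet c X)) M := by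
  induction M with
  | zero => exact ⟨0, fun s _ => by simp [chl, pre]⟩
  | succ M ih =>
    obtain ⟨a, ha⟩ := ih
    have : ∃ b, ∀ s ≥ b, (if conv c.encode (px X s) M then 1 else 0) = chi (domSet c X) M := by
      by_cases h : M ∈ domSet c X
      · obtain ⟨k, hk⟩ := mem_domSet.1 h
        exact ⟨k, fun s hs => by rw [if_pos (conv_mono (pre_prefix _ hs) hk)]; unfold chi; rw [if_pos h]⟩
      · refine ⟨0, fun s _ => ?_⟩
        rw [if_neg fun h' => h (mem_domSet.2 ⟨s, h'⟩)]; unfold chi; rw [if_neg h]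
    obtain ⟨b, hb⟩ := this
    refine ⟨max a b, fun s hs => ?_⟩
    have h1 := ha s (le_trans (le_max_left _ _) hs)
    have h2 := hb s (le_trans (le_max_right _ _) hs)
    rw [pre_succ, ← h1, ← h2]
    unfold chl
    rw [List.range_succ, List.map_append]; rfl

def GA (c E0 N M s : ℕ) (L : List ℕ) : Prop :=
  exLt E0 fun e => allLt N fun n => E e (chl c L M) n (Cs s n)

def G (c : CodeO) (E0 N M : ℕ) : Set Cantor :=
  {X | ∃ e < E0, ∀ n < N, E e (pre (chi (domSet c X)) M) n (K n)}

theorem GA_ev (c : CodeO) (E0 N M : ℕ) (X : Cantor) : ∃ s0, ∀ s ≥ s0, (GA c.encode E0 N M s (px X s) ↔ X ∈ G c E0 N M) := by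
  obtain ⟨a, ha⟩ := chl_ev c X M
  obtain ⟨b, hb⟩ := Cs_ev_lt N
  refine ⟨max a b, fun s hs => ?_⟩
  unfold GA G
  rw [ha s (le_trans (le_max_left _ _) hs)]
  refine exists_congr fun e => and_congr_right fun _ => forall_congr' fun n => forall_congr' fun hn => ?_
  beta_reduce
  rw [hb s (le_trans (le_max_right _ _) hs) n hn]

theorem measurable_G (c : CodeO) (E0 N M : ℕ) : MeasurableSet (G c E0 N M) := by
  have : G c E0 N M = ⋃ s0 : ℕ, ⋂ s : ℕ, {X | s0 ≤ s → GA c.encode E0 N M s (px X s)} := by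
    ext X
    simp only [Set.mem_iUnion, Set.mem_iInter, Set.mem_ofPred_eq]
    obtain ⟨a, ha⟩ := GA_ev c E0 N M X
    constructor
    · intro h; exact ⟨a, fun s hs => (ha s hs).2 h⟩
    · rintro ⟨b, hb⟩; exact (ha (max a b) (le_max_left _ _)).1 (hb _ (le_max_right _ _))
  rw [this]
  refine MeasurableSet.iUnion fun s0 => MeasurableSet.iInter fun s => ?_
  exact measurable_px s fun L => s0 ≤ s → GA c.encode E0 N M s L

theorem G_tendsto (c : CodeO) (E0 N M : ℕ) :
    Filter.Tendsto (fun s => dv (cnt (2 ^ s) (fun j => GA c.encode E0 N M s (nb s j)), s)) Filter.atTop (nhds (muR (G c E0 N M))) := by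
  simp only [← mu_level]
  unfold muR
  refine (ENNReal.tendsto_toReal (measure_ne_top _ _)).comp ?_
  refine tendsto_measure_of_tendsto_indicator (A := G c E0 N M) Filter.atTop (fun s => ?_) (B := Set.univ) MeasurableSet.univ (measure_ne_top _ _) ?_ ?_
  · exact measurable_px s (GA c.encode E0 N M s)
  · exact Filter.Eventually.of_forall fun s => Set.subset_univ _
  · intro X
    obtain ⟨a, ha⟩ := GA_ev c E0 N M X
    filter_upwards [Filter.eventually_ge_atTop a] with s hs
    exact ha s hs

theorem G_mono_M (c : CodeO) (E0 N : ℕ) : Monotone (G c E0 N) := by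
  rintro M M' h X ⟨e, he, H⟩
  exact ⟨e, he, fun n hn => E_mono (pre_prefix _ h) (H n hn)⟩
theorem G_mono_E (c : CodeO) {E0 E1 N M : ℕ} (h : E0 ≤ E1) : G c E0 N M ⊆ G c E1 N M := by
  rintro X ⟨e, he, H⟩; exact ⟨e, lt_of_lt_of_le he h, H⟩
theorem G_anti_N (c : CodeO) {E0 N N' M : ℕ} (h : N ≤ N') : G c E0 N' M ⊆ G c E0 N M := by
  rintro X ⟨e, he, H⟩; exact ⟨e, he, fun n hn => H n (lt_of_lt_of_le hn h)⟩

theorem mem_COMPL {c : CodeO} {X : Cantor} : X ∈ COMPL c ↔ ∃ e, ∀ n, ∃ M, E e (pre (chi (domSet c X)) M) n (K n) := by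
  show (∃ _, _) ↔ _
  constructor
  · rintro ⟨d, hd⟩
    refine ⟨d.encode, fun n => ?_⟩
    rw [← eval_iff, dec_encode, hd]; simp
  · rintro ⟨e, he⟩
    refine ⟨dec e, fun n => ?_⟩
    have := (eval_iff _ _ _ _).2 (he n)
    exact Part.eq_some_iff.2 this

theorem COMPL_eq (c : CodeO) : COMPL c = ⋃ E0, ⋂ N, ⋃ M, G c E0 N M := by
  ext X
  rw [mem_COMPL]
  simp only [Set.mem_iUnion, Set.mem_iInter]
  constructor
  · rintro ⟨e, he⟩
    refine ⟨e + 1, fun N => ?_⟩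
    obtain ⟨M, hM⟩ := unif (p := fun n M => E e (pre (chi (domSet c X)) M) n (K n)) (fun i k k' h => E_mono (pre_prefix _ h)) N (fun n _ => he n)
    exact ⟨M, e, by omega, hM⟩
  · rintro ⟨E0, h⟩
    by_contra hno
    push Not at hno
    choose f hf using hno
    -- a bound for all witnesses
    obtain ⟨N, hN⟩ : ∃ N, ∀ e < E0, f e < N := by
      refine ⟨((Finset.range E0).sup f) + 1, fun e he => ?_⟩
      exact Nat.lt_succ_of_le (Finset.le_sup (f := f) (Finset.mem_range.2 he))
    obtain ⟨M, e, he, H⟩ := h N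
    exact hf e M (H _ (hN e he))

theorem measurable_COMPL (c : CodeO) : MeasurableSet (COMPL c) := by
  rw [COMPL_eq]
  exact MeasurableSet.iUnion fun _ => MeasurableSet.iInter fun _ => MeasurableSet.iUnion fun _ => measurable_G _ _ _ _

theorem muR_tendsto_iUnion {S : ℕ → Set Cantor} (h : Monotone S) : Filter.Tendsto (fun n => muR (S n)) Filter.atTop (nhds (muR (⋃ n, S n))) :=
  (ENNReal.tendsto_toReal (measure_ne_top _ _)).comp (tendsto_measure_iUnion_atTop h)

theorem muR_tendsto_iInter {S : ℕ → Set Cantor} (h : Antitone S) (hm : ∀ n, MeasurableSet (S n)) :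
    Filter.Tendsto (fun n => muR (S n)) Filter.atTop (nhds (muR (⋂ n, S n))) :=
  (ENNReal.tendsto_toReal (measure_ne_top _ _)).comp (tendsto_measure_iInter_atTop (fun n => (hm n).nullMeasurableSet) h ⟨0, measure_ne_top _ _⟩)

theorem muR_mono {S T : Set Cantor} (h : S ⊆ T) : muR S ≤ muR T :=
  ENNReal.toReal_mono (measure_ne_top _ _) (measure_mono h)

theorem lt_muR_iUnion {S : ℕ → Set Cantor} (h : Monotone S) (x : ℝ) : x < muR (⋃ n, S n) ↔ ∃ n, x < muR (S n) := by
  constructor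
  · intro hx
    exact ((muR_tendsto_iUnion h).eventually (lt_mem_nhds hx)).exists
  · rintro ⟨n, hn⟩; exact lt_of_lt_of_le hn (muR_mono (Set.subset_iUnion _ _))

theorem lt_muR_COMPL (c : CodeO) (x : ℕ × ℕ) : dv x < muR (COMPL c) ↔
    ∃ y : ℕ × ℕ × ℕ, (dv x < dv y.2 ∧ ∀ N, ∃ z : (ℕ × ℕ × ℕ) × ℕ, dv y.2 < dv z.1.2 ∧ ∀ s, z.2 ≤ s →
      dv z.1.2 < dv (cnt (2 ^ s) (fun j => GA c.encode y.1 N z.1.1 s (nb s j)), s)) := by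
  rw [COMPL_eq, lt_muR_iUnion]
  swap
  · intro a b h X hX
    simp only [Set.mem_iInter, Set.mem_iUnion] at *
    intro N; obtain ⟨M, hM⟩ := hX N; exact ⟨M, G_mono_E c h hM⟩
  have key : ∀ E0 N (d : ℝ), 0 ≤ d → (d < muR (⋃ M, G c E0 N M) ↔ ∃ z : (ℕ × ℕ × ℕ) × ℕ, d < dv z.1.2 ∧ ∀ s, z.2 ≤ s →
      dv z.1.2 < dv (cnt (2 ^ s) (fun j => GA c.encode E0 N z.1.1 s (nb s j)), s)) := by
    intro E0 N d hd
    rw [lt_muR_iUnion (G_mono_M c E0 N)]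
    constructor
    · rintro ⟨M, hM⟩
      obtain ⟨w, hw1, hw2⟩ := exists_dv_between hd hM
      obtain ⟨s0, hs0⟩ := Filter.eventually_atTop.1 ((G_tendsto c E0 N M).eventually (lt_mem_nhds hw2))
      exact ⟨((M, w), s0), hw1, hs0⟩
    · rintro ⟨⟨⟨M, w⟩, s0⟩, h1, h2⟩
      refine ⟨M, lt_of_lt_of_le h1 (ge_of_tendsto (G_tendsto c E0 N M) ?_)⟩
      filter_upwards [Filter.eventually_ge_atTop s0] with s hs
      exact (h2 s hs).le
  constructor
  · rintro ⟨E0, h⟩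
    obtain ⟨w, hw1, hw2⟩ := exists_dv_between (dv_nonneg x) h
    refine ⟨(E0, w), hw1, fun N => ?_⟩
    rw [← key E0 N _ (dv_nonneg _)]
    exact lt_of_lt_of_le hw2 (muR_mono (Set.iInter_subset _ _))
  · rintro ⟨⟨E0, w⟩, h1, h2⟩
    refine ⟨E0, lt_of_lt_of_le h1 ?_⟩
    refine ge_of_tendsto (muR_tendsto_iInter ?_ ?_) (Filter.Eventually.of_forall fun N => ?_)
    · intro a b h X hX
      simp only [Set.mem_iUnion] at *
      obtain ⟨M, hM⟩ := hX; exact ⟨M, G_anti_N c h hM⟩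
    · exact fun N => MeasurableSet.iUnion fun _ => measurable_G _ _ _ _
    · exact ((key E0 N _ (dv_nonneg _)).2 (h2 N)).le

theorem dv_lt_iff (x y : ℕ × ℕ) : dv x < dv y ↔ x.1 * 2 ^ y.2 < y.1 * 2 ^ x.2 := by
  unfold dv
  rw [div_lt_div_iff₀ (by positivity) (by positivity)]
  norm_cast

theorem DLeft_COMPL (c : CodeO) : DLeft (iterJump 3) (muR (COMPL c)) := by
  unfold DLeft
  refine S1.of_eq ?_ (lt_muR_COMPL c)
  simp only [dv_lt_iff]
  have h0 : S1 (iterJump 0) (fun x : (((ℕ × ℕ × ℕ) × ℕ) × ((ℕ × ℕ × ℕ) × ℕ)) × ℕ =>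
      ¬ (Imp (x.1.2.2 ≤ x.2) (x.1.2.1.2.1 * 2 ^ x.2 < (cnt (2 ^ x.2) (fun j => GA c.encode x.1.1.1.1 x.1.1.2 x.1.2.1.1 x.2 (nb x.2 j))) * 2 ^ x.1.2.1.2.2))) := by
    refine S1.prim ?_
    unfold GA
    fun_prop
  have h1 := S1.jump_all h0
  have h2 : S1 (iterJump 1) (fun x : ((ℕ × ℕ × ℕ) × ℕ) × ((ℕ × ℕ × ℕ) × ℕ) => x.1.1.2.1 * 2 ^ x.2.1.2.2 < x.2.1.2.1 * 2 ^ x.1.1.2.2) :=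
    S1.prim (by fun_prop)
  have h3 := ((h2.and h1).ex).jump_not
  have h4 := S1.jump_all h3
  have h5 : S1 (iterJump 3) (fun x : (ℕ × ℕ) × (ℕ × ℕ × ℕ) => x.1.1 * 2 ^ x.2.2.2 < x.2.2.1 * 2 ^ x.1.2) :=
    S1.prim (by fun_prop)
  exact (h5.and (h4.comp (g := fun x : (ℕ × ℕ) × (ℕ × ℕ × ℕ) => x.2) (by fun_prop))).ex

end RandProb

namespace RandProb
open Nat.Partrec (Code)

/-! ### Sacks' theorem: non-c.e. sets are c.e. in almost no oracle -/

theorem density {A : Set ℝ} (hA : A ⊆ Set.Ico 0 1) (hpos : 0 < volume A) :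
    ∃ s j, 2⁻¹ * ENNReal.ofReal ((2⁻¹ : ℝ) ^ s) < volume (A ∩ icell j s) := by
  have hfin : volume A ≠ ⊤ := ne_top_of_le_ne_top (by rw [Real.volume_Ico]; exact ENNReal.ofReal_ne_top) (measure_mono hA)
  have h2 : volume A < 2 * volume A := by
    rw [two_mul]; exact ENNReal.lt_add_right hfin hpos.ne'
  obtain ⟨U, hAU, hU, hvU⟩ := A.exists_isOpen_lt_of_lt _ h2
  by_contra hno
  push Not at hno
  have hcov := min_cover (fun s j => icell j s ⊆ U) (fun s j => A ∩ icell j s) 2⁻¹ (fun s j _ => hno s j)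
  have hUC : UC (fun s j => icell j s ⊆ U) ⊆ U := by
    rintro x ⟨h0, s, hs⟩
    exact hs (mem_icell_lvl h0 s)
  have hsub : A ⊆ {x | ∃ s j, MinC (fun s j => icell j s ⊆ U) s j ∧ x ∈ A ∩ icell j s} := by
    intro x hx
    have h0 := (hA hx).1
    obtain ⟨ε, hε, hball⟩ := Metric.isOpen_iff.1 hU x (hAU hx)
    obtain ⟨s, hs⟩ := exists_pow_lt_of_lt_one hε (by norm_num : (2⁻¹ : ℝ) < 1)
    have hc : icell (lvl x s) s ⊆ U := by
      intro y hy
      apply hball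
      have hx' := mem_icell_lvl h0 s
      unfold icell at hy hx'
      rw [dv_succ] at hy hx'
      rw [Metric.mem_ball, Real.dist_eq, abs_lt]
      constructor <;> linarith [hy.1, hy.2, hx'.1, hx'.2]
    obtain ⟨t, hts, ht⟩ := exists_min (C := fun s j => icell j s ⊆ U) hc
    rw [lvl_div hts] at ht
    exact ⟨t, _, ht, hx, mem_icell_lvl h0 t⟩
  have h3 := (measure_mono hsub).trans (hcov.trans (mul_le_mul_right (measure_mono hUC) _))
  have h4 : (2⁻¹ : ENNReal) * volume U < 2⁻¹ * (2 * volume A) :=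
    ENNReal.mul_lt_mul_right (by simp) (by simp) hvU
  rw [← mul_assoc, ENNReal.inv_mul_cancel (by simp) (by simp), one_mul] at h4
  exact absurd (h3.trans_lt h4) (lt_irrefl _)

theorem sacks {p : ℕ → Prop} (hp : ¬ S1 (fun _ => 0) p) : mu {X | S1 (oX X) p} = 0 := by
  have e : {X | S1 (oX X) p} = ⋃ c : ℕ, {X | ∀ n, p n ↔ ∃ k, conv c (px X k) n} := by
    ext X
    simp only [Set.mem_iUnion, Set.mem_ofPred_eq]
    have : S1 (oX X) p ↔ CeIn (oX X) {n | p n} := (ceIn_iff (S := {n | p n})).symm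
    rw [this]
    constructor
    · rintro ⟨c, hc⟩
      refine ⟨c.encode, fun n => ?_⟩
      rw [← dom_iff, dec_encode]
      exact Set.ext_iff.1 hc n
    · rintro ⟨c, hc⟩
      refine ⟨dec c, Set.ext fun n => ?_⟩
      exact (hc n).trans (dom_iff _ _ _).symm
  rw [e, measure_iUnion_null_iff]
  intro c
  by_contra hne
  apply hp
  set S : Set Cantor := {X | ∀ n, p n ↔ ∃ k, conv c (px X k) n} with hS
  have hSm : MeasurableSet S := by
    have : S = ⋂ n, {X | p n ↔ X ∈ ⋃ k, {X | conv c (px X k) n}} := by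
      ext X; simp [hS]
    rw [this]
    refine MeasurableSet.iInter fun n => ?_
    have hm : MeasurableSet (⋃ k, {X : Cantor | conv c (px X k) n}) := MeasurableSet.iUnion fun k => measurable_px k (fun L => conv c L n)
    by_cases hn : p n
    · simp only [hn, true_iff]; exact hm
    · simp only [hn, false_iff]; exact hm.compl
  rw [mu_apply hSm] at hne
  set A := {y : ℝ | (0 ≤ y ∧ y < 1) ∧ digits y ∈ S} with hA
  obtain ⟨s, j, hsj⟩ := density (A := A) (fun y hy => hy.1) (pos_iff_ne_zero.2 hne)
  -- majority vote
  have hSg : S1 (fun _ => 0) (fun n => ∃ t, (s ≤ t ∧ 2 ^ t < 2 * 2 ^ s * cnt (2 ^ t) (fun j' => j' / 2 ^ (t - s) = j ∧ conv c (nb t j') n))) := by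
    refine S1.ex (p := fun x : ℕ × ℕ => (s ≤ x.2 ∧ 2 ^ x.2 < 2 * 2 ^ s * cnt (2 ^ x.2) (fun j' => j' / 2 ^ (x.2 - s) = j ∧ conv c (nb x.2 j') x.1))) (S1.prim ?_)
    fun_prop
  refine hSg.of_eq fun n => ?_
  let B : ℕ → Set ℝ := fun t => {x : ℝ | 0 ≤ x ∧ lvl x t < 2 ^ t ∧ (lvl x t / 2 ^ (t - s) = j ∧ conv c (nb t (lvl x t)) n)}
  have hB : ∀ t, s ≤ t → ∀ x, x ∈ B t ↔ (0 ≤ x ∧ x < 1) ∧ x ∈ icell j s ∧ conv c (px (digits x) t) n := by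
    intro t ht x
    show (0 ≤ x ∧ lvl x t < 2 ^ t ∧ (lvl x t / 2 ^ (t - s) = j ∧ conv c (nb t (lvl x t)) n)) ↔ _
    rw [mem_icell]
    by_cases h0 : 0 ≤ x
    · rw [lvl_lt h0, lvl_div ht, px_digits h0]; tauto
    · tauto
  have hvB : ∀ t, (2⁻¹ * ENNReal.ofReal ((2⁻¹ : ℝ) ^ s) < volume (B t)) ↔
      2 ^ t < 2 * 2 ^ s * cnt (2 ^ t) (fun j' => j' / 2 ^ (t - s) = j ∧ conv c (nb t j') n) := by
    intro t
    rw [show volume (B t) = _ from vol_level (fun j' => j' / 2 ^ (t - s) = j ∧ conv c (nb t j') n) t]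
    have : (2⁻¹ : ENNReal) = ENNReal.ofReal 2⁻¹ := by
      rw [ENNReal.ofReal_inv_of_pos (by norm_num)]; simp
    rw [this, ← ENNReal.ofReal_mul (by norm_num), ENNReal.ofReal_lt_ofReal_iff_of_nonneg (by positivity)]
    unfold dv
    generalize cnt (2 ^ t) (fun j' => j' / 2 ^ (t - s) = j ∧ conv c (nb t j') n) = q
    rw [lt_div_iff₀ (by positivity), inv_pow]
    rw [← Nat.cast_lt (α := ℝ)]
    push_cast
    have h2 : (0 : ℝ) < 2 ^ s := by positivity
    rw [show (2⁻¹ : ℝ) * (2 ^ s)⁻¹ * 2 ^ t = 2 ^ t / (2 * 2 ^ s) by field_simp, div_lt_iff₀ (by positivity), mul_comm (q : ℝ)]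
  have hAB : p n ↔ ∃ t, s ≤ t ∧ 2⁻¹ * ENNReal.ofReal ((2⁻¹ : ℝ) ^ s) < volume (B t) := by
    constructor
    · intro hn
      have hsub : A ∩ icell j s ⊆ ⋃ t, B (s + t) := by
        rintro y ⟨⟨hy1, hy2⟩, hy3⟩
        obtain ⟨k, hk⟩ := (hy2 n).1 hn
        refine Set.mem_iUnion.2 ⟨k, (hB _ (by omega) y).2 ⟨hy1, hy3, ?_⟩⟩
        exact conv_mono (pre_prefix _ (by omega)) hk
      have hmono : Monotone fun t => B (s + t) := by
        intro a b hab y hy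
        obtain ⟨h1, h2, h3⟩ := (hB _ (by omega) y).1 hy
        exact (hB _ (by omega) y).2 ⟨h1, h2, conv_mono (pre_prefix _ (by omega)) h3⟩
      have hlt := hsj.trans_le (measure_mono hsub)
      obtain ⟨t, ht⟩ := ((tendsto_measure_iUnion_atTop hmono).eventually (lt_mem_nhds hlt)).exists
      exact ⟨s + t, by omega, ht⟩
    · rintro ⟨t, hst, ht⟩
      by_contra hn
      have hdisj : Disjoint (A ∩ icell j s) (B t) := by
        refine Set.disjoint_left.2 fun y hy hy' => hn ?_
        exact (hy.1.2 n).2 ⟨t, ((hB t hst y).1 hy').2.2⟩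
      have hAm : MeasurableSet (A ∩ icell j s) := by
        refine MeasurableSet.inter ?_ measurableSet_Ico
        exact (measurableSet_Ico (a := (0 : ℝ)) (b := 1)).inter (measurable_digits hSm)
      have hu := measure_union' (μ := volume) hdisj hAm
      have hle : volume ((A ∩ icell j s) ∪ B t) ≤ ENNReal.ofReal ((2⁻¹ : ℝ) ^ s) := by
        rw [← volume_icell j s]
        refine measure_mono (Set.union_subset Set.inter_subset_right fun y hy => ((hB t hst y).1 hy).2.1)
      have := ENNReal.add_lt_add hsj ht
      rw [← hu, ← add_mul, ENNReal.inv_two_add_inv_two, one_mul] at this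
      exact absurd (this.trans_le hle) (lt_irrefl _)
  rw [hAB]
  exact exists_congr fun t => and_congr_right fun _ => hvB t

end RandProb

namespace RandProb
open Nat.Partrec (Code)

/-! ### The thickness construction -/

def good (e : ℕ) (L : List ℕ) (n s : ℕ) : Prop :=
  allLt n fun x => conv e L x ∧ Imp (x + 1 < n) (E e L x (Cs s x))
@[fun_prop] theorem P_good : PrimrecPred fun x : ℕ × List ℕ × ℕ × ℕ => good x.1 x.2.1 x.2.2.1 x.2.2.2 := by
  unfold good; fun_prop

def blocked (e : ℕ) (L : List ℕ) (s z : ℕ) : Prop :=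
  exLt (L.length + 1) fun n => good e L n s ∧ ¬ good e (L.take z) n s
@[fun_prop] theorem P_blocked : PrimrecPred fun x : ℕ × List ℕ × ℕ × ℕ => blocked x.1 x.2.1 x.2.2.1 x.2.2.2 := by
  unfold blocked; fun_prop

def enter (A : ℕ × List ℕ → Prop) (s : ℕ) (st : List ℕ × ℕ) (P : List ℕ) (z : ℕ) : Prop :=
  A (z, P) ∧ allLt (z.unpair.1 + 1) fun e => ¬ blocked e (st.1.take st.2) s z

noncomputable def step (A : ℕ × List ℕ → Prop) (s : ℕ) (st : List ℕ × ℕ) (P : List ℕ) : List ℕ × ℕ :=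
  ((List.range (s + 1)).map fun z => if st.1.getD z 0 = 1 ∨ enter A s st P z then 1 else 0,
    lst (s + 1) fun z => enter A s st P z ∧ ¬ st.1.getD z 0 = 1)

noncomputable def St (A : ℕ × List ℕ → Prop) (L : List ℕ) : List ℕ × ℕ :=
  natR L.length ([], 0) fun s st => step A s st (L.take s)

theorem P_St {A : ℕ × List ℕ → Prop} (hA : PrimrecPred A) : Primrec (St A) := by
  unfold St step enter
  fun_prop

theorem step_snd (A : ℕ × List ℕ → Prop) (s : ℕ) (st : List ℕ × ℕ) (P : List ℕ) : (step A s st P).2 =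
    lst (s + 1) fun z => enter A s st P z ∧ ¬ st.1.getD z 0 = 1 := rfl
theorem step_fst (A : ℕ × List ℕ → Prop) (s : ℕ) (st : List ℕ × ℕ) (P : List ℕ) : (step A s st P).1 =
    (List.range (s + 1)).map fun z => if st.1.getD z 0 = 1 ∨ enter A s st P z then 1 else 0 := rfl

theorem St_succ (A : ℕ × List ℕ → Prop) (O : ℕ → ℕ) (s : ℕ) :
    St A (pre O (s + 1)) = step A s (St A (pre O s)) (pre O s) := by
  have key : ∀ k ≤ s, (natR k ([], 0) fun s' st => step A s' st ((pre O (s + 1)).take s')) =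
      (natR k ([], 0) fun s' st => step A s' st ((pre O s).take s')) := by
    intro k
    induction k with
    | zero => intro _; rfl
    | succ k ih =>
      intro hk
      show step A k (natR k ([], 0) fun s' st => step A s' st ((pre O (s + 1)).take s')) _ = step A k (natR k ([], 0) fun s' st => step A s' st ((pre O s).take s')) _
      rw [ih (by omega), pre_take _ (by omega), pre_take _ (by omega)]
  unfold St
  simp only [pre_length]
  show step A s (natR s ([], 0) fun s' st => step A s' st ((pre O (s + 1)).take s')) _ = _
  rw [key s le_rfl, pre_take _ (by omega)]

/-- characteristic function of a predicate -/
noncomputable def ch (p : ℕ → Prop) (z : ℕ) : ℕ := if p z then 1 else 0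

structure Constr (A : ℕ × List ℕ → Prop) (O : ℕ → ℕ) (b : ℕ → ℕ → Prop) (a : ℕ → ℕ) : Prop where
  b_zero : ∀ z, ¬ b 0 z
  a_le : ∀ s, a s ≤ s
  b_lt : ∀ s z, b s z → z < s
  b_succ : ∀ s z, b (s + 1) z ↔ b s z ∨ (z ≤ s ∧ A (z, pre O s) ∧ ∀ e ≤ z.unpair.1, ¬ blocked e (pre (ch (b s)) (a s)) s z)
  a_keep : ∀ s z, z < a (s + 1) → b (s + 1) z → b s z
  a_new : ∀ s, a (s + 1) < s + 1 → b (s + 1) (a (s + 1)) ∧ ¬ b s (a (s + 1))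

noncomputable def sb (A : ℕ × List ℕ → Prop) (O : ℕ → ℕ) (s z : ℕ) : Prop := (St A (pre O s)).1.getD z 0 = 1
noncomputable def sa (A : ℕ × List ℕ → Prop) (O : ℕ → ℕ) (s : ℕ) : ℕ := (St A (pre O s)).2

theorem sa_zero (A : ℕ × List ℕ → Prop) (O : ℕ → ℕ) : sa A O 0 = 0 := rfl

theorem St_len (A : ℕ × List ℕ → Prop) (O : ℕ → ℕ) (s : ℕ) : (St A (pre O s)).1.length = s := by
  cases s with
  | zero => rfl
  | succ s => rw [St_succ]; simp [step]

theorem sa_le (A : ℕ × List ℕ → Prop) (O : ℕ → ℕ) (s : ℕ) : sa A O s ≤ s := by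
  cases s with
  | zero => exact le_rfl
  | succ s => unfold sa; rw [St_succ, step_snd]; exact (lst_spec _ _).1

theorem getD_map_range (f : ℕ → ℕ) (n z : ℕ) : ((List.range n).map f).getD z 0 = if z < n then f z else 0 := by
  by_cases h : z < n
  · simp [List.getD, h]
  · simp [List.getD, h]

theorem sb_lt (A : ℕ × List ℕ → Prop) (O : ℕ → ℕ) (s z : ℕ) (h : sb A O s z) : z < s := by
  unfold sb at h
  by_contra hz
  have : (St A (pre O s)).1.getD z 0 = 0 := List.getD_eq_default _ _ (by rw [St_len]; omega)
  omega

theorem sb_succ (A : ℕ × List ℕ → Prop) (O : ℕ → ℕ) (s z : ℕ) :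
    sb A O (s + 1) z ↔ z ≤ s ∧ (sb A O s z ∨ enter A s (St A (pre O s)) (pre O s) z) := by
  unfold sb
  rw [St_succ, step_fst, getD_map_range]
  by_cases h : z < s + 1
  · rw [if_pos h]
    have h' : z ≤ s := by omega
    split
    · rename_i h1; exact ⟨fun _ => ⟨h', h1⟩, fun _ => rfl⟩
    · rename_i h1; exact ⟨fun h => by omega, fun h => absurd h.2 h1⟩
  · rw [if_neg h]
    exact ⟨fun h => by omega, fun h => by omega⟩

theorem St_eq (A : ℕ × List ℕ → Prop) (O : ℕ → ℕ) (s : ℕ) : (St A (pre O s)).1 = pre (ch (sb A O s)) s := by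
  cases s with
  | zero => rfl
  | succ s =>
    rw [St_succ, step_fst]
    unfold pre
    refine List.map_congr_left fun z hz => ?_
    rw [List.mem_range] at hz
    have h := sb_succ A O s z
    unfold ch
    by_cases hs : sb A O (s + 1) z
    · rw [if_pos hs]; exact if_pos (h.1 hs).2
    · rw [if_neg hs]; exact if_neg fun h' => hs (h.2 ⟨by omega, h'⟩)

theorem St_take (A : ℕ × List ℕ → Prop) (O : ℕ → ℕ) (s : ℕ) :
    (St A (pre O s)).1.take (St A (pre O s)).2 = pre (ch (sb A O s)) (sa A O s) := by
  rw [St_eq]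
  exact pre_take _ (sa_le A O s)

theorem constr (A : ℕ × List ℕ → Prop) (O : ℕ → ℕ) : Constr A O (sb A O) (sa A O) where
  b_zero z h := by have := sb_lt A O 0 z h; omega
  a_le := sa_le A O
  b_lt := sb_lt A O
  b_succ s z := by
    rw [sb_succ]
    unfold enter
    rw [St_take]
    have h := sb_lt A O s z
    have e : (allLt (z.unpair.1 + 1) fun e => ¬ blocked e (pre (ch (sb A O s)) (sa A O s)) s z) ↔
      ∀ e ≤ z.unpair.1, ¬ blocked e (pre (ch (sb A O s)) (sa A O s)) s z :=
      forall_congr' fun e => by rw [Nat.lt_succ_iff]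
    rw [e]
    constructor
    · rintro ⟨h1, h2 | h2⟩
      · exact Or.inl h2
      · exact Or.inr ⟨h1, h2⟩
    · rintro (h2 | ⟨h1, h2⟩)
      · exact ⟨(h h2).le, Or.inl h2⟩
      · exact ⟨h1, Or.inr h2⟩
  a_keep s z h hb := by
    unfold sa at h
    rw [St_succ, step_snd] at h
    have := (lst_spec _ _).2.2 z h
    rw [sb_succ] at hb
    rcases hb.2 with h' | h'
    · exact h'
    · by_contra hn; exact this ⟨h', hn⟩
  a_new s h := by
    unfold sa at h ⊢
    rw [St_succ, step_snd] at h ⊢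
    have := (lst_spec _ _).2.1 h
    exact ⟨(sb_succ A O s _).2 ⟨Nat.lt_succ_iff.1 h, Or.inr this.1⟩, this.2⟩

end RandProb

namespace RandProb
open Nat.Partrec (Code)

section Thick
variable {A : ℕ × List ℕ → Prop} {O : ℕ → ℕ} {b : ℕ → ℕ → Prop} {a : ℕ → ℕ}

theorem Constr.mono (H : Constr A O b a) {s t z : ℕ} (h : s ≤ t) (hs : b s z) : b t z := by
  induction h with
  | refl => exact hs
  | step _ ih => exact (H.b_succ _ _).2 (Or.inl ih)

/-- the set built -/
def BB (b : ℕ → ℕ → Prop) : Set ℕ := {z | ∃ s, b s z}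

theorem Constr.stab (H : Constr A O b a) (m : ℕ) : ∃ N, ∀ z < m, ∀ s, b s z → b N z := by
  induction m with
  | zero => exact ⟨0, by intros; omega⟩
  | succ m ih =>
    obtain ⟨N, hN⟩ := ih
    by_cases hm : ∃ s, b s m
    · obtain ⟨s, hs⟩ := hm
      refine ⟨max N s, fun z hz t ht => ?_⟩
      rcases Nat.lt_succ_iff_lt_or_eq.1 hz with h | rfl
      · exact H.mono (le_max_left _ _) (hN z h t ht)
      · exact H.mono (le_max_right _ _) hs
    · refine ⟨N, fun z hz t ht => ?_⟩
      rcases Nat.lt_succ_iff_lt_or_eq.1 hz with h | rfl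
      · exact hN z h t ht
      · exact absurd ⟨t, ht⟩ hm

theorem Constr.a_large (H : Constr A O b a) (m : ℕ) : ∃ N, ∀ t ≥ N, m ≤ a t := by
  obtain ⟨N, hN⟩ := H.stab m
  refine ⟨N + m + 1, fun t ht => ?_⟩
  obtain ⟨t, rfl⟩ : ∃ u, t = u + 1 := ⟨t - 1, by omega⟩
  by_contra hlt
  obtain ⟨h1, h2⟩ := H.a_new t (by omega)
  exact h2 (H.mono (by omega) (hN _ (by omega) _ h1))

/-- `t` is a true stage -/
def TrueSt (b : ℕ → ℕ → Prop) (a : ℕ → ℕ) (t : ℕ) : Prop := ∀ z < a t, z ∈ BB b → b t z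

theorem Constr.true_stage (H : Constr A O b a) (m N : ℕ) : ∃ t, N ≤ t ∧ m ≤ a t ∧ TrueSt b a t := by
  obtain ⟨N', hN'⟩ := H.a_large m
  have hex : ∃ v, ∃ t, max N N' ≤ t ∧ a t = v := ⟨_, _, le_rfl, rfl⟩
  obtain ⟨t, ht, hv⟩ := Nat.find_spec hex
  have hmin : ∀ u ≥ t, a t ≤ a u := fun u hu => by
    rw [hv]; exact Nat.find_min' hex ⟨u, le_trans ht hu, rfl⟩
  refine ⟨t, le_trans (le_max_left _ _) ht, hN' t (le_trans (le_max_right _ _) ht), fun z hz ⟨s, hs⟩ => ?_⟩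
  have key : ∀ k, b (t + k) z → b t z := by
    intro k
    induction k with
    | zero => exact id
    | succ k ih => exact fun h => ih (H.a_keep _ _ (lt_of_lt_of_le hz (hmin _ (by omega))) h)
  exact key s (H.mono (by omega) hs)

theorem TrueSt.eq {t : ℕ} (h : TrueSt b a t) : pre (ch (b t)) (a t) = pre (chi (BB b)) (a t) := by
  refine pre_congr fun z hz => ?_
  unfold ch chi
  by_cases hb : b t z
  · rw [if_pos hb, if_pos (show z ∈ BB b from ⟨t, hb⟩)]
  · rw [if_neg hb, if_neg fun h' => hb (h z hz h')]

/-- `Φ_e(B) = K` -/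
def Comp (e : ℕ) (B : Set ℕ) : Prop := ∀ x, ∃ M, E e (pre (chi B) M) x (K x)

theorem Constr.unblocked (H : Constr A O b a) {e : ℕ} (he : ¬ Comp e (BB b)) :
    ∃ m, ∃ N, ∀ t ≥ N, m ≤ a t → TrueSt b a t → ∀ z ≥ m, ¬ blocked e (pre (ch (b t)) (a t)) t z := by
  have hex : ∃ x, ¬ ∃ M, E e (pre (chi (BB b)) M) x (K x) := by
    by_contra h; push Not at h; exact he h
  obtain ⟨x0, hx0, hlt⟩ : ∃ x, (¬ ∃ M, E e (pre (chi (BB b)) M) x (K x)) ∧ ∀ y < x, ∃ M, E e (pre (chi (BB b)) M) y (K y) :=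
    ⟨Nat.find hex, Nat.find_spec hex, fun y hy => by simpa using Nat.find_min hex hy⟩
  obtain ⟨M, hM⟩ := unif (p := fun n M => E e (pre (chi (BB b)) M) n (K n)) (fun i k k' h => E_mono (pre_prefix _ h)) x0 hlt
  obtain ⟨N, hN⟩ := Cs_ev_lt (x0 + 1)
  obtain ⟨M', hM'⟩ : ∃ M', (∃ k, conv e (pre (chi (BB b)) k) x0) → conv e (pre (chi (BB b)) M') x0 := by
    by_cases h : ∃ k, conv e (pre (chi (BB b)) k) x0
    · obtain ⟨k, hk⟩ := h; exact ⟨k, fun _ => hk⟩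
    · exact ⟨0, fun h' => absurd h' h⟩
  refine ⟨max M M', N, fun t ht hm hT z hz => ?_⟩
  rintro ⟨n, hn, hg, hng⟩
  apply hng
  rw [hT.eq] at hg ⊢
  have htake : (pre (chi (BB b)) (a t)).take z = pre (chi (BB b)) (min z (a t)) := by
    rcases le_total z (a t) with h | h
    · rw [pre_take _ h, min_eq_left h]
    · rw [min_eq_right h, List.take_of_length_le (by simpa using h)]
  rw [htake]
  have hle : max M M' ≤ min z (a t) := le_min hz hm
  have hn1 : n ≤ x0 + 1 := by
    by_contra hc
    have := (hg x0 (by omega)).2 (by omega)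
    rw [hN t ht x0 (by omega)] at this
    exact hx0 ⟨_, this⟩
  intro x hx
  rcases Nat.lt_or_ge x x0 with h | h
  · have h1 := E_mono (pre_prefix _ (le_trans (le_max_left _ _) hle)) (hM x h)
    refine ⟨conv_iff.2 ⟨_, h1⟩, fun _ => ?_⟩
    rw [hN t ht x (by omega)]; exact h1
  · have hx0' : x = x0 := by omega
    subst hx0'
    refine ⟨conv_mono (pre_prefix _ (le_trans (le_max_right _ _) hle)) (hM' ⟨_, (hg x hx).1⟩), fun h' => by omega⟩

theorem Constr.sub (H : Constr A O b a) {z : ℕ} (hz : z ∈ BB b) : ∃ s, A (z, pre O s) := by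
  obtain ⟨s, hs⟩ := hz
  induction s with
  | zero => exact absurd hs (H.b_zero z)
  | succ s ih =>
    rcases (H.b_succ s z).1 hs with h | h
    · exact ih h
    · exact ⟨s, h.2.1⟩

theorem Constr.thick (H : Constr A O b a) (hA : ∀ z s t, s ≤ t → A (z, pre O s) → A (z, pre O t)) {i : ℕ}
    (hi : ∀ e ≤ i, ¬ Comp e (BB b)) : ∃ m, ∀ z ≥ m, z.unpair.1 = i → (∃ s, A (z, pre O s)) → z ∈ BB b := by
  have huni : ∃ m, ∀ e < i + 1, ∃ N, ∀ t ≥ N, m ≤ a t → TrueSt b a t → ∀ z ≥ m, ¬ blocked e (pre (ch (b t)) (a t)) t z := by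
    refine unif (p := fun e m => ∃ N, ∀ t ≥ N, m ≤ a t → TrueSt b a t → ∀ z ≥ m, ¬ blocked e (pre (ch (b t)) (a t)) t z) ?_ _ ?_
    · rintro e k k' hk ⟨N, hN⟩
      exact ⟨N, fun t ht hm hT z hz => hN t ht (le_trans hk hm) hT z (le_trans hk hz)⟩
    · exact fun e he => H.unblocked (hi e (by omega))
  obtain ⟨m, hm⟩ := huni
  obtain ⟨N, hN⟩ := unif (p := fun e N => ∀ t ≥ N, m ≤ a t → TrueSt b a t → ∀ z ≥ m, ¬ blocked e (pre (ch (b t)) (a t)) t z)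
    (fun e k k' hk h t ht => h t (le_trans hk ht)) _ hm
  refine ⟨m, fun z hz hcol ⟨s, hs⟩ => ?_⟩
  obtain ⟨t, ht, hmt, hT⟩ := H.true_stage m (max N (max s z))
  refine ⟨t + 1, (H.b_succ t z).2 (Or.inr ⟨?_, hA z s t ?_ hs, fun e he => ?_⟩)⟩
  · exact le_trans (le_trans (le_max_right _ _) (le_max_right _ _)) ht
  · exact le_trans (le_trans (le_max_left _ _) (le_max_right _ _)) ht
  · exact hN e (by omega) t (le_trans (le_max_left _ _) ht) hmt hT z hz

theorem Constr.preserve (H : Constr A O b a) {e n s : ℕ} (hc : Comp e (BB b))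
    (hg : good e (pre (ch (b s)) (a s)) (n + 1) s)
    (hcor : ∀ z < a s, z.unpair.1 < e → z ∈ BB b → b s z)
    (h0 : E e (pre (ch (b s)) (a s)) n 0) : K n ≠ 1 := by
  intro hK
  set L := pre (ch (b s)) (a s) with hL
  -- least disagreement
  have hex : ∃ x, x ≤ n ∧ ∃ v, E e L x v ∧ v ≠ K x := ⟨n, le_rfl, 0, h0, by omega⟩
  obtain ⟨x, ⟨hxn, v, hv, hne⟩, hmin⟩ : ∃ x, (x ≤ n ∧ ∃ v, E e L x v ∧ v ≠ K x) ∧ ∀ y < x, ¬ (y ≤ n ∧ ∃ v, E e L y v ∧ v ≠ K y) :=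
    ⟨Nat.find hex, Nat.find_spec hex, fun y hy => Nat.find_min hex hy⟩
  have hval : ∀ y < x, E e L y (K y) ∧ Cs s y = K y := by
    intro y hy
    have h1 := (hg y (by omega)).2 (by omega)
    have h2 : Cs s y = K y := by
      by_contra hn; exact hmin y hy ⟨by omega, _, h1, hn⟩
    exact ⟨h2 ▸ h1, h2⟩
  have hCt : ∀ t ≥ s, ∀ y < x, Cs t y = K y := by
    intro t ht y hy
    have h2 := (hval y hy).2
    rcases K_zero_or y with h | h
    · rcases Cs_zero_or t y with h' | h'
      · rw [h, h']
      · have := Cs_le_K h'; omega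
    · rw [h]; exact Cs_mono ht (by omega)
  have hgood : ∀ t ≥ s, ∀ L', good e L' (x + 1) t ↔ good e L' (x + 1) s := by
    intro t ht L'
    refine forall_congr' fun y => forall_congr' fun hy => and_congr_right fun _ => ?_
    refine forall_congr' fun hy' => ?_
    rw [hCt t ht y (by omega), hCt s le_rfl y (by omega)]
  have hgx : good e L (x + 1) s := by
    intro y hy
    refine ⟨(hg y (by omega)).1, fun hy' => ?_⟩
    exact (hg y (by omega)).2 (by omega)
  have hLen : L.length = a s := by rw [hL, pre_length]
  have hexu : ∃ u, u ≤ a s ∧ good e (L.take u) (x + 1) s := ⟨a s, le_rfl, by rwa [List.take_of_length_le (by rw [hLen])]⟩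
  obtain ⟨u, ⟨hua, hu⟩, humin⟩ : ∃ u, (u ≤ a s ∧ good e (L.take u) (x + 1) s) ∧ ∀ w < u, ¬ (w ≤ a s ∧ good e (L.take w) (x + 1) s) :=
    ⟨Nat.find hexu, Nat.find_spec hexu, fun y hy => Nat.find_min hexu hy⟩
  have hpres : ∀ k, (∀ z < u, b (s + k) z → b s z) ∧ u ≤ a (s + k) := by
    intro k
    induction k with
    | zero => exact ⟨fun z _ h => h, hua⟩
    | succ k ih =>
      obtain ⟨ih1, ih2⟩ := ih
      have htk : ∀ w ≤ u, (pre (ch (b (s + k))) (a (s + k))).take w = L.take w := by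
        intro w hw
        rw [pre_take _ (le_trans hw ih2), hL, pre_take _ (le_trans hw hua)]
        refine pre_congr fun z hz => ?_
        unfold ch
        by_cases hb : b s z
        · rw [if_pos hb, if_pos (H.mono (by omega) hb)]
        · rw [if_neg hb, if_neg fun h => hb (ih1 z (by omega) h)]
      have h1 : ∀ z < u, b (s + k + 1) z → b s z := by
        intro z hz hb
        by_cases hcol : z.unpair.1 < e
        · exact hcor z (by omega) hcol ⟨_, hb⟩
        rcases (H.b_succ _ _).1 hb with h | ⟨-, -, h⟩
        · exact ih1 z hz h
        · exfalso
          apply h e (by omega)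
          have hgt : good e (pre (ch (b (s + k))) (a (s + k))) (x + 1) (s + k) := by
            rw [hgood _ (by omega)]
            intro y hy
            have := hu y hy
            rw [← htk u le_rfl] at this
            exact ⟨conv_mono (List.take_prefix _ _) this.1, fun h => E_mono (List.take_prefix _ _) (this.2 h)⟩
          refine ⟨x + 1, ?_, hgt, ?_⟩
          · obtain ⟨w, hw⟩ := conv_iff.1 (hgt x (by omega)).1
            have := E_bound hw
            omega
          · rw [hgood _ (by omega), htk z hz.le]
            exact fun h => humin z hz ⟨by omega, h⟩
      refine ⟨h1, ?_⟩
      by_contra hlt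
      have hle := H.a_le s
      obtain ⟨h2, h3⟩ := H.a_new (s + k) (by show a (s + (k + 1)) < _; omega)
      exact h3 (H.mono (by omega) (h1 _ (by show a (s + (k + 1)) < _; omega) h2))
  have hfin : L.take u = pre (chi (BB b)) u := by
    rw [hL, pre_take _ hua]
    refine pre_congr fun z hz => ?_
    unfold ch chi
    by_cases hb : b s z
    · rw [if_pos hb, if_pos (show z ∈ BB b from ⟨s, hb⟩)]
    · rw [if_neg hb, if_neg]
      rintro ⟨t, ht⟩
      exact hb ((hpres t).1 z hz (H.mono (by omega) ht))
  obtain ⟨w, hw⟩ := conv_iff.1 (hu x (by omega)).1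
  have hwv : w = v := E_unique (E_mono (List.take_prefix _ _) hw) hv
  rw [hfin] at hw
  obtain ⟨M, hM⟩ := hc x
  have := E_unique (E_mono (pre_prefix _ (le_max_left u M)) hw) (E_mono (pre_prefix _ (le_max_right u M)) hM)
  exact hne (hwv ▸ this)

theorem Constr.exists_good (H : Constr A O b a) {e n : ℕ} (hc : Comp e (BB b)) (hK : K n ≠ 1) :
    ∃ s, good e (pre (ch (b s)) (a s)) (n + 1) s ∧ (∀ z < a s, z.unpair.1 < e → z ∈ BB b → b s z) ∧
      E e (pre (ch (b s)) (a s)) n 0 := by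
  obtain ⟨M, hM⟩ := unif (p := fun n M => E e (pre (chi (BB b)) M) n (K n)) (fun i k k' h => E_mono (pre_prefix _ h)) (n + 1) (fun x _ => hc x)
  obtain ⟨N, hN⟩ := Cs_ev_lt (n + 1)
  obtain ⟨t, ht, hmt, hT⟩ := H.true_stage M N
  refine ⟨t, ?_, fun z hz _ h => hT z hz h, ?_⟩
  · rw [hT.eq]
    intro x hx
    have h1 := E_mono (pre_prefix _ hmt) (hM x hx)
    exact ⟨conv_iff.2 ⟨_, h1⟩, fun _ => by rw [hN t ht x hx]; exact h1⟩
  · rw [hT.eq]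
    have h1 := E_mono (pre_prefix _ hmt) (hM n (by omega))
    rwa [(K_zero_or n).resolve_right hK] at h1

end Thick

theorem thick_Sg {A : ℕ × List ℕ → Prop} (hA : PrimrecPred A) (O : ℕ → ℕ) {e : ℕ} (hc : Comp e (BB (sb A O)))
    (hlow : S1 O (fun z => z.unpair.1 < e ∧ z ∉ BB (sb A O))) : S1 O (fun n => K n ≠ 1) := by
  have H := constr A O
  have hP := P_St hA
  have h1 : S1 O (fun x : ℕ × ℕ => good e (pre (ch (sb A O x.2)) (sa A O x.2)) (x.1 + 1) x.2 ∧ E e (pre (ch (sb A O x.2)) (sa A O x.2)) x.1 0) := by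
    have hp : PrimrecPred fun y : (ℕ × ℕ) × List ℕ => good e ((St A y.2).1.take (St A y.2).2) (y.1.1 + 1) y.1.2 ∧ E e ((St A y.2).1.take (St A y.2).2) y.1.1 0 := by
      fun_prop
    refine (S1.at (O := O) (p := fun y : (ℕ × ℕ) × List ℕ => good e ((St A y.2).1.take (St A y.2).2) (y.1.1 + 1) y.1.2 ∧ E e ((St A y.2).1.take (St A y.2).2) y.1.1 0) hp (n := fun x : ℕ × ℕ => x.2) (by fun_prop)).of_eq fun x => ?_
    rw [St_take]
  have h2 : S1 O (fun x : ℕ × ℕ => x.2 < sa A O x.1 → x.2.unpair.1 < e → sb A O x.1 x.2 ∨ x.2 ∉ BB (sb A O)) := by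
    have hp : PrimrecPred fun y : (ℕ × ℕ) × List ℕ => ¬ y.1.2 < (St A y.2).2 ∨ ¬ y.1.2.unpair.1 < e ∨ (St A y.2).1.getD y.1.2 0 = 1 := by
      fun_prop
    have := (S1.at (O := O) (p := fun y : (ℕ × ℕ) × List ℕ => ¬ y.1.2 < (St A y.2).2 ∨ ¬ y.1.2.unpair.1 < e ∨ (St A y.2).1.getD y.1.2 0 = 1) hp (n := fun x : ℕ × ℕ => x.1) (by fun_prop)).or
      (hlow.comp (g := fun x : ℕ × ℕ => x.2) (by fun_prop))
    refine this.of_eq fun x => ?_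
    show (x.2 < sa A O x.1 → x.2.unpair.1 < e → sb A O x.1 x.2 ∨ x.2 ∉ BB (sb A O)) ↔ ((¬ x.2 < sa A O x.1 ∨ ¬ x.2.unpair.1 < e ∨ sb A O x.1 x.2) ∨ x.2.unpair.1 < e ∧ x.2 ∉ BB (sb A O))
    tauto
  have h3 := S1.all_lt h2 (n := fun s => s) (by fun_prop)
  refine ((h1.and (h3.comp (g := fun x : ℕ × ℕ => x.2) (by fun_prop))).ex).of_eq fun n => ?_
  constructor
  · intro hK
    obtain ⟨s, hs1, hs2, hs3⟩ := H.exists_good hc hK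
    refine ⟨s, ⟨hs1, hs3⟩, fun z hz hza hze => ?_⟩
    by_cases hB : z ∈ BB (sb A O)
    · exact Or.inl (hs2 z hza hze hB)
    · exact Or.inr hB
  · rintro ⟨s, ⟨hs1, hs3⟩, hs2⟩
    refine H.preserve hc hs1 (fun z hz hze hB => ?_) hs3
    rcases hs2 z (lt_of_lt_of_le hz (H.a_le s)) hz hze with h | h
    · exact h
    · exact absurd hB h

theorem thick {A : ℕ × List ℕ → Prop} (hA : PrimrecPred A) : ∃ c : CodeO, ∀ X : Cantor,
    (∀ z s t, s ≤ t → A (z, px X s) → A (z, px X t)) →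
    (∀ z ∈ domSet c X, ∃ s, A (z, px X s)) ∧
    (∀ i, (∀ e ≤ i, ¬ Comp e (domSet c X)) → ∃ m, ∀ z ≥ m, z.unpair.1 = i → (∃ s, A (z, px X s)) → z ∈ domSet c X) ∧
    (∀ e, Comp e (domSet c X) → S1 (oX X) (fun z => z.unpair.1 < e ∧ z ∉ domSet c X) → S1 (oX X) (fun n => K n ≠ 1)) := by
  have hP := P_St hA
  have hS : Sg oX (fun X z => z ∈ BB (sb A (oX X))) := by
    refine (Sg.primL (O := oX) (p := fun y : ℕ × List ℕ => (St A y.2).1.getD y.1 0 = 1) (by fun_prop)).of_eq fun X z => ?_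
    exact Iff.rfl
  obtain ⟨c, hc⟩ := exists_code_dom hS
  refine ⟨c, fun X hX => ?_⟩
  have e : domSet c X = BB (sb A (oX X)) := Set.ext fun z => hc X z
  rw [e]
  have H := constr A (oX X)
  exact ⟨fun z hz => H.sub hz, fun i hi => H.thick hX hi, fun e he hl => thick_Sg hA (oX X) he hl⟩

end RandProb

namespace RandProb
open Nat.Partrec (Code)

/-! ### Realizing a left-c.e. real as a completeness probability -/

theorem S1.fin {O : ℕ → ℕ} {p q : ℕ → Prop} (hp : S1 O p) (m : ℕ) (h : ∀ z ≥ m, (q z ↔ p z)) : S1 O q := by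
  have h1 : S1 O (fun z : ℕ => m ≤ z) := S1.prim (by fun_prop)
  have h2 : S1 O (fun z : ℕ => exMem ((List.range m).filter (fun z => decide (q z))) fun y => y = z) := S1.prim (by fun_prop)
  refine ((h1.and hp).or h2).of_eq fun z => ?_
  simp only [exMem, List.mem_filter, List.mem_range, decide_eq_true_eq]
  constructor
  · intro hq
    by_cases hz : m ≤ z
    · exact Or.inl ⟨hz, (h z hz).1 hq⟩
    · exact Or.inr ⟨z, ⟨by omega, hq⟩, rfl⟩
  · rintro (⟨hz, h'⟩ | ⟨y, ⟨_, hy⟩, rfl⟩)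
    · exact (h z hz).2 h'
    · exact hy

theorem S1.cols {O : ℕ → ℕ} {q : ℕ → Prop} (n : ℕ) (h : ∀ i < n, S1 O (fun z : ℕ => z.unpair.1 = i ∧ q z)) :
    S1 O (fun z : ℕ => z.unpair.1 < n ∧ q z) := by
  induction n with
  | zero => exact (S1.prim (p := fun _ : ℕ => False) (by fun_prop)).of_eq fun z => by simp
  | succ n ih =>
    refine ((ih fun i hi => h i (by omega)).or (h n (by omega))).of_eq fun z => ?_
    have : z.unpair.1 < n + 1 ↔ z.unpair.1 < n ∨ z.unpair.1 = n := by omega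
    rw [this]; tauto

section Core
variable {O : ℕ → ℕ} {B : Set ℕ} {Af : ℕ → Prop} {act : ℕ → Prop} {r : ℕ → ℕ → ℕ → Prop}

theorem core_low (h1 : ∀ z ∈ B, Af z)
    (h2 : ∀ i, (∀ e ≤ i, ¬ Comp e B) → ∃ m, ∀ z ≥ m, z.unpair.1 = i → Af z → z ∈ B)
    (h3 : ∀ e, Comp e B → S1 O (fun z => z.unpair.1 < e ∧ z ∉ B) → S1 O (fun n => K n ≠ 1))
    (hO : ¬ S1 O (fun n => K n ≠ 1)) (i : ℕ)
    (hc : ∀ i' < i, S1 O (fun z : ℕ => z.unpair.1 = i' ∧ ¬ Af z)) : ∀ e ≤ i, ¬ Comp e B := by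
  intro e
  induction e using Nat.strong_induction_on with
  | _ e ih =>
    intro he hC
    refine hO (h3 e hC (S1.cols e fun i' hi' => ?_))
    obtain ⟨m, hm⟩ := h2 i' fun e' he' => ih e' (by omega) (by omega)
    refine (hc i' (by omega)).fin m fun z hz => ?_
    constructor
    · rintro ⟨a, b⟩; exact ⟨a, fun h => b (hm z hz a h)⟩
    · rintro ⟨a, b⟩; exact ⟨a, fun h => b (h1 z h)⟩

theorem core_false {i : ℕ}
    (hAf : ∀ z, Af z ↔ act z.unpair.1 ∧ ((∃ b ≤ z.unpair.2.unpair.1, ∀ c < z.unpair.2.unpair.2, r z.unpair.1 b c) ∨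
      ∃ n ≤ z.unpair.2.unpair.1, K n = 1 ∧ Cs z.unpair.2.unpair.2 n = 0))
    (hi : ¬ (act i ∧ ∀ b, ∃ c, ¬ r i b c)) : S1 O (fun z : ℕ => z.unpair.1 = i ∧ ¬ Af z) := by
  by_cases ha : act i
  · have hex : ∃ b, ∀ c, r i b c := by
      by_contra h; push Not at h; exact hi ⟨ha, h⟩
    set b0 := Nat.find hex with hb0
    have hb0s := Nat.find_spec hex
    have hbl : ∀ b < b0, ∃ c, ¬ r i b c := fun b hb => by
      have := Nat.find_min hex hb; push Not at this; exact this
    obtain ⟨h0, hh0⟩ := unif (p := fun b k => ∃ c < k, ¬ r i b c) (by rintro b k k' hk ⟨c, hc, h⟩; exact ⟨c, by omega, h⟩) b0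
      (fun b hb => by obtain ⟨c, hc⟩ := hbl b hb; exact ⟨c + 1, c, by omega, hc⟩)
    obtain ⟨s0, hs0⟩ := Cs_ev_lt b0
    refine (S1.prim (p := fun z : ℕ => z.unpair.1 = i ∧ z.unpair.2.unpair.1 < b0 ∧ max h0 s0 ≤ z.unpair.2.unpair.2) (by fun_prop)).fin
      (Nat.pair i (Nat.pair b0 (max h0 s0))) fun z hz => ?_
    rw [hAf]
    constructor
    · rintro ⟨rfl, hn⟩
      have hb : z.unpair.2.unpair.1 < b0 := by
        by_contra hge
        exact hn ⟨ha, Or.inl ⟨b0, by omega, fun c _ => hb0s c⟩⟩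
      refine ⟨rfl, hb, ?_⟩
      by_contra hlt
      have e : z = Nat.pair z.unpair.1 (Nat.pair z.unpair.2.unpair.1 z.unpair.2.unpair.2) := by simp
      have l1 := Nat.pair_lt_pair_left z.unpair.2.unpair.2 hb
      have l2 := Nat.pair_lt_pair_right b0 (not_le.1 hlt)
      have l3 := Nat.pair_lt_pair_right z.unpair.1 (l1.trans l2)
      rw [← e] at l3
      exact absurd hz (not_le.2 l3)
    · rintro ⟨rfl, hb, hh⟩
      refine ⟨rfl, ?_⟩
      rintro ⟨-, ⟨b, hb', h⟩ | ⟨n, hn, hK, hC⟩⟩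
      · obtain ⟨c, hc, hr⟩ := hh0 b (by omega)
        exact hr (h c (by omega))
      · rw [hs0 _ (by omega) n (by omega), hK] at hC
        exact absurd hC (by norm_num)
  · refine (S1.prim (p := fun z : ℕ => z.unpair.1 = i) (by fun_prop)).of_eq fun z => ?_
    rw [hAf]
    constructor
    · exact fun h => h.1
    · rintro rfl; exact ⟨rfl, fun h => ha h.1⟩

theorem core_true {i : ℕ}
    (hAf : ∀ z, Af z ↔ act z.unpair.1 ∧ ((∃ b ≤ z.unpair.2.unpair.1, ∀ c < z.unpair.2.unpair.2, r z.unpair.1 b c) ∨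
      ∃ n ≤ z.unpair.2.unpair.1, K n = 1 ∧ Cs z.unpair.2.unpair.2 n = 0))
    (h1 : ∀ z ∈ B, Af z) {m : ℕ} (hm : ∀ z ≥ m, z.unpair.1 = i → Af z → z ∈ B)
    (hi : act i ∧ ∀ b, ∃ c, ¬ r i b c) : TuringLEs HaltingSet B := by
  have hS : S1 (chi B) (fun x : ℕ × ℕ => ∃ h, m ≤ Nat.pair i (Nat.pair x.1 h) ∧ Nat.pair i (Nat.pair x.1 h) ∉ B ∧ x.2 = Cs h x.1) := by
    have := S1.ex (O := chi B) (p := fun y : (ℕ × ℕ) × ℕ => m ≤ Nat.pair i (Nat.pair y.1.1 y.2) ∧ Nat.pair i (Nat.pair y.1.1 y.2) ∉ B ∧ y.1.2 = Cs y.2 y.1.1)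
      (((S1.at (O := chi B) (p := fun w : ((ℕ × ℕ) × ℕ) × List ℕ => m ≤ Nat.pair i (Nat.pair w.1.1.1 w.1.2) ∧
        w.2.getD (Nat.pair i (Nat.pair w.1.1.1 w.1.2)) 0 = 0 ∧ w.1.1.2 = Cs w.1.2 w.1.1.1) (by fun_prop)
        (n := fun y : (ℕ × ℕ) × ℕ => Nat.pair i (Nat.pair y.1.1 y.2) + 1) (by fun_prop))).of_eq fun y => by
          simp only [List.getD_eq_getElem?_getD, pre_getElem?]
          simp [chi])
    exact this
  have key : ∀ n h, m ≤ Nat.pair i (Nat.pair n h) → Nat.pair i (Nat.pair n h) ∉ B → Cs h n = K n := by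
    intro n h hz hB
    have hA : ¬ Af (Nat.pair i (Nat.pair n h)) := fun ha => hB (hm _ hz (by simp) ha)
    rw [hAf] at hA
    simp only [Nat.unpair_pair] at hA
    by_contra hne
    refine hA ⟨hi.1, Or.inr ⟨n, le_rfl, ?_, ?_⟩⟩
    · rcases K_zero_or n with h' | h'
      · exfalso
        rcases Cs_zero_or h n with h'' | h''
        · exact hne (h''.trans h'.symm)
        · rw [Cs_le_K h''] at h'; exact absurd h' (by norm_num)
      · exact h'
    · rcases Cs_zero_or h n with h'' | h''
      · exact h''
      · exact absurd (h''.trans (Cs_le_K h'').symm) hne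
  have hex : ∀ n, ∃ h, m ≤ Nat.pair i (Nat.pair n h) ∧ Nat.pair i (Nat.pair n h) ∉ B := by
    intro n
    obtain ⟨h0, hh0⟩ := unif (p := fun b k => ∃ c < k, ¬ r i b c) (by rintro b k k' hk ⟨c, hc, h⟩; exact ⟨c, by omega, h⟩) (n + 1)
      (fun b hb => by obtain ⟨c, hc⟩ := hi.2 b; exact ⟨c + 1, c, by omega, hc⟩)
    obtain ⟨s0, hs0⟩ := Cs_ev_lt (n + 1)
    refine ⟨max m (max h0 s0), ?_, fun hB => ?_⟩
    · have e1 := Nat.right_le_pair i (Nat.pair n (max m (max h0 s0)))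
      have e2 := Nat.right_le_pair n (max m (max h0 s0))
      have e3 := le_max_left m (max h0 s0)
      omega
    · have := (hAf _).1 (h1 _ hB)
      simp only [Nat.unpair_pair] at this
      obtain ⟨-, ⟨b, hb', h⟩ | ⟨k, hk, hK, hC⟩⟩ := this
      · obtain ⟨c, hc, hr⟩ := hh0 b (by omega)
        exact hr (h c (by omega))
      · rw [hs0 _ (by omega) k (by omega), hK] at hC
        exact absurd hC (by norm_num)
  obtain ⟨c, hc⟩ := exists_code_graph (O := fun _ : Unit => chi B) hS (by
    rintro - n v w ⟨h, a1, a2, a3⟩ ⟨h', b1, b2, b3⟩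
    simp only at *
    rw [a3, b3, key n h a1 a2, key n h' b1 b2])
  refine ⟨c, fun n => Part.eq_some_iff.2 ((hc () n _).2 ?_)⟩
  obtain ⟨h, a1, a2⟩ := hex n
  exact ⟨h, a1, a2, (key n h a1 a2).symm⟩

theorem core {c : CodeO} {X : Cantor} (hAf : ∀ z, Af z ↔ act z.unpair.1 ∧ ((∃ b ≤ z.unpair.2.unpair.1, ∀ c < z.unpair.2.unpair.2, r z.unpair.1 b c) ∨
      ∃ n ≤ z.unpair.2.unpair.1, K n = 1 ∧ Cs z.unpair.2.unpair.2 n = 0))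
    (h1 : ∀ z ∈ domSet c X, Af z)
    (h2 : ∀ i, (∀ e ≤ i, ¬ Comp e (domSet c X)) → ∃ m, ∀ z ≥ m, z.unpair.1 = i → Af z → z ∈ domSet c X)
    (h3 : ∀ e, Comp e (domSet c X) → S1 O (fun z => z.unpair.1 < e ∧ z ∉ domSet c X) → S1 O (fun n => K n ≠ 1))
    (hO : ¬ S1 O (fun n => K n ≠ 1)) : X ∈ COMPL c ↔ ∃ i, act i ∧ ∀ b, ∃ c, ¬ r i b c := by
  constructor
  · intro hX
    by_contra hno
    push Not at hno
    obtain ⟨e, he⟩ := mem_COMPL.1 hX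
    exact core_low h1 h2 h3 hO e (fun i' _ => core_false hAf (by push Not; exact hno i')) e le_rfl he
  · intro hex
    have hl := core_low h1 h2 h3 hO (Nat.find hex) (fun i' hi' => core_false hAf (Nat.find_min hex hi'))
    obtain ⟨m, hm⟩ := h2 _ hl
    exact core_true hAf h1 hm (Nat.find_spec hex)

end Core

end RandProb

namespace RandProb
open Nat.Partrec (Code)

/-- the number coded by the first `t` bits -/
def valL (t : ℕ) (L : List ℕ) : ℕ := natR t 0 fun i r => 2 * r + L.getD i 0
@[fun_prop] theorem P_valL : Primrec fun x : ℕ × List ℕ => valL x.1 x.2 := by unfold valL; fun_prop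

theorem valL_succ (t : ℕ) (L : List ℕ) : valL (t + 1) L = 2 * valL t L + L.getD t 0 := rfl

theorem valL_digits {y : ℝ} (h0 : 0 ≤ y) (h1 : y < 1) {t s : ℕ} (h : t ≤ s) : valL t (px (digits y) s) = lvl y t := by
  induction t with
  | zero =>
    have := (lvl_lt h0 0).2 h1
    simp [valL, natR] at *; omega
  | succ t ih =>
    rw [valL_succ, ih (by omega), List.getD_eq_getElem?_getD, pre_getElem?, if_pos (by omega)]
    have h2 := lvl_div (x := y) (t := t) (s := t + 1) (by omega)
    have h3 : t + 1 - t = 1 := by omega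
    rw [h3, pow_one] at h2
    have h4 : oX (digits y) t = lvl y (t + 1) % 2 := by
      unfold oX; rw [digits_lvl h0]
      rcases Nat.mod_two_eq_zero_or_one (lvl y (t + 1)) with h | h <;> simp [h]
    rw [Option.getD_some, h4]; omega

theorem lvl_lt_dv {y : ℝ} (h0 : 0 ≤ y) (j t : ℕ) : lvl y t < j ↔ y < dv (j, t) := by
  have p : (0 : ℝ) < 2 ^ t := by positivity
  constructor
  · intro h
    refine (lt_lvl h0 t).trans_le ?_
    unfold dv
    have : ((lvl y t + 1 : ℕ) : ℝ) ≤ j := by exact_mod_cast h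
    exact div_le_div_of_nonneg_right this p.le
  · intro h
    by_contra hge
    have : ((j : ℕ) : ℝ) ≤ (lvl y t : ℕ) := by exact_mod_cast not_lt.1 hge
    have h2 : dv (j, t) ≤ dv (lvl y t, t) := div_le_div_of_nonneg_right this p.le
    linarith [lvl_le h0 t]

/-- the enumeration fed to the thickness construction -/
def AA (R : ((((ℕ × ℕ) × ℕ) × ℕ) × ℕ) × List ℕ → Prop) (z : ℕ) (L : List ℕ) : Prop :=
  (z.unpair.1.unpair.1.unpair.2 ≤ L.length ∧ valL z.unpair.1.unpair.1.unpair.2 L < z.unpair.1.unpair.1.unpair.1) ∧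
  ((exLt (z.unpair.2.unpair.1 + 1) fun b => allLt z.unpair.2.unpair.2 fun c => exLt (L.length) fun d =>
      R (((((z.unpair.1.unpair.1.unpair.1, z.unpair.1.unpair.1.unpair.2), z.unpair.1.unpair.2), b), c), List.replicate d 0)) ∨
    exLt (z.unpair.2.unpair.1 + 1) fun n => Cs L.length n = 1 ∧ Cs z.unpair.2.unpair.2 n = 0)

theorem P_AA {R : ((((ℕ × ℕ) × ℕ) × ℕ) × ℕ) × List ℕ → Prop} (hR : PrimrecPred R) :
    PrimrecPred fun x : ℕ × List ℕ => AA R x.1 x.2 := by unfold AA; fun_prop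

theorem valL_px (X : Cantor) {t s s' : ℕ} (h : t ≤ s) (h' : s ≤ s') : valL t (px X s) = valL t (px X s') := by
  induction t with
  | zero => rfl
  | succ t ih =>
    rw [valL_succ, valL_succ, ih (by omega), List.getD_eq_getElem?_getD, List.getD_eq_getElem?_getD, pre_getElem?, pre_getElem?,
      if_pos (by omega), if_pos (by omega)]

theorem AA_mono {R : ((((ℕ × ℕ) × ℕ) × ℕ) × ℕ) × List ℕ → Prop} (X : Cantor) (z s t : ℕ) (h : s ≤ t)
    (hA : AA R z (px X s)) : AA R z (px X t) := by
  unfold AA at hA ⊢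
  simp only [pre_length] at hA ⊢
  obtain ⟨⟨a1, a2⟩, h3⟩ := hA
  refine ⟨⟨by omega, by rwa [← valL_px X a1 h]⟩, ?_⟩
  rcases h3 with ⟨b, hb, h3⟩ | ⟨n, hn, h3, h4⟩
  · refine Or.inl ⟨b, hb, fun c hc => ?_⟩
    obtain ⟨d, hd, h5⟩ := h3 c hc
    exact ⟨d, by omega, h5⟩
  · exact Or.inr ⟨n, hn, Cs_mono h h3, h4⟩

theorem AA_iff {R : ((((ℕ × ℕ) × ℕ) × ℕ) × ℕ) × List ℕ → Prop} {y : ℝ} (h0 : 0 ≤ y) (h1 : y < 1) (z : ℕ) :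
    (∃ s, AA R z (px (digits y) s)) ↔ (y < dv (z.unpair.1.unpair.1.unpair.1, z.unpair.1.unpair.1.unpair.2)) ∧
      ((∃ b ≤ z.unpair.2.unpair.1, ∀ c < z.unpair.2.unpair.2, ∃ d,
        R (((((z.unpair.1.unpair.1.unpair.1, z.unpair.1.unpair.1.unpair.2), z.unpair.1.unpair.2), b), c), List.replicate d 0)) ∨
      ∃ n ≤ z.unpair.2.unpair.1, K n = 1 ∧ Cs z.unpair.2.unpair.2 n = 0) := by
  constructor
  · rintro ⟨s, ⟨a1, a2⟩, h⟩
    rw [pre_length] at a1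
    rw [valL_digits h0 h1 a1, lvl_lt_dv h0] at a2
    refine ⟨a2, ?_⟩
    rcases h with ⟨b, hb, h3⟩ | ⟨n, hn, h3, h4⟩
    · refine Or.inl ⟨b, by omega, fun c hc => ?_⟩
      obtain ⟨d, hd, h5⟩ := h3 c hc
      exact ⟨d, h5⟩
    · exact Or.inr ⟨n, by omega, Cs_le_K h3, h4⟩
  · rintro ⟨a, h⟩
    have hact : ∀ s, z.unpair.1.unpair.1.unpair.2 ≤ s → (z.unpair.1.unpair.1.unpair.2 ≤ (px (digits y) s).length ∧
        valL z.unpair.1.unpair.1.unpair.2 (px (digits y) s) < z.unpair.1.unpair.1.unpair.1) := fun s hs => by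
      rw [pre_length, valL_digits h0 h1 hs, lvl_lt_dv h0]
      exact ⟨hs, a⟩
    rcases h with ⟨b, hb, h3⟩ | ⟨n, hn, h3, h4⟩
    · obtain ⟨k, hk⟩ := unif (p := fun c k => ∃ d < k, R (((((z.unpair.1.unpair.1.unpair.1, z.unpair.1.unpair.1.unpair.2), z.unpair.1.unpair.2), b), c), List.replicate d 0))
        (by rintro b k k' hk ⟨c, hc, h⟩; exact ⟨c, by omega, h⟩) z.unpair.2.unpair.2
        (fun c hc => by obtain ⟨d, hd⟩ := h3 c hc; exact ⟨d + 1, d, by omega, hd⟩)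
      refine ⟨max k z.unpair.1.unpair.1.unpair.2, hact _ (le_max_right _ _), Or.inl ⟨b, by omega, fun c hc => ?_⟩⟩
      obtain ⟨d, hd, h⟩ := hk c hc
      exact ⟨d, by rw [pre_length]; omega, h⟩
    · obtain ⟨s, hs⟩ := K_one.1 h3
      refine ⟨max s z.unpair.1.unpair.1.unpair.2, hact _ (le_max_right _ _), Or.inr ⟨n, by omega, ?_, h4⟩⟩
      rw [pre_length]
      exact Cs_mono (le_max_left _ _) hs

theorem not_S1_K : ¬ S1 (fun _ => 0) (fun n => K n ≠ 1) := by
  intro h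
  refine diag (fun _ => 0) (h.of_eq fun e => ?_)
  rw [not_iff_not, K, chi]
  by_cases he : e ∈ HaltingSet
  · simp only [he, if_true, iff_true]; exact he
  · simp only [he, if_false]; simp; exact he

theorem realize {γ : ℝ} (h0 : 0 ≤ γ) (h1 : γ ≤ 1) (hγ : DLeft (iterJump 3) γ) : ∃ c, muR (COMPL c) = γ := by
  obtain ⟨r1, hr1, e1⟩ := post2 (O := iterJump 2) hγ
  obtain ⟨r2, hr2, e2⟩ := post2 (O := iterJump 1) hr1
  obtain ⟨r3, hr3, e3⟩ := post2 (O := iterJump 0) hr2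
  obtain ⟨R, hR, hRe⟩ := hr3
  have hRe' : ∀ a, r3 a ↔ ∃ k, R (a, List.replicate k 0) := fun a => by
    refine (hRe () a).trans ?_
    simp only [show iterJump 0 = fun _ => 0 from rfl, pre_zero]
  have hp : ∀ x : ℕ × ℕ, dv x < γ ↔ ∃ a, ∀ b, ∃ c, ¬ r3 (((x, a), b), c) := fun x => by
    rw [e1]
    refine exists_congr fun a => ?_
    rw [e2]; push Not
    exact forall_congr' fun b => e3 _
  obtain ⟨c, hc⟩ := thick (P_AA hR)
  refine ⟨c, ?_⟩
  have hae : ∀ᵐ y ∂(volume.restrict (Set.Ico (0 : ℝ) 1)), ¬ S1 (oX (digits y)) (fun n => K n ≠ 1) := by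
    have := sacks not_S1_K
    have h2 : ∀ᵐ X ∂mu, ¬ S1 (oX X) (fun n => K n ≠ 1) := by
      rw [ae_iff]; simpa using this
    exact ae_of_ae_map measurable_digits.aemeasurable h2
  have key : ∀ᵐ y ∂(volume.restrict (Set.Ico (0 : ℝ) 1)), (digits y ∈ COMPL c ↔ y ∈ Set.Iio γ) := by
    filter_upwards [hae, ae_restrict_mem measurableSet_Ico] with y hy hm
    obtain ⟨t1, t2, t3⟩ := hc (digits y) (AA_mono (digits y))
    have := core (O := oX (digits y)) (act := fun i => y < dv (i.unpair.1.unpair.1, i.unpair.1.unpair.2))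
      (r := fun i b c => ∃ d, R (((((i.unpair.1.unpair.1, i.unpair.1.unpair.2), i.unpair.2), b), c), List.replicate d 0))
      (AA_iff (R := R) hm.1 hm.2) t1 t2 t3 hy
    rw [this, Set.mem_Iio]
    constructor
    · rintro ⟨i, ha, hb⟩
      refine ha.trans ((hp _).2 ⟨i.unpair.2, fun b => ?_⟩)
      obtain ⟨c, hc⟩ := hb b
      exact ⟨c, by rwa [hRe']⟩
    · intro hy
      obtain ⟨x, hx1, hx2⟩ := exists_dv_between hm.1 hy
      obtain ⟨a, ha⟩ := (hp x).1 hx2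
      refine ⟨Nat.pair (Nat.pair x.1 x.2) a, by simpa using hx1, fun b => ?_⟩
      obtain ⟨c, hc⟩ := ha b
      refine ⟨c, ?_⟩
      rw [hRe'] at hc
      simpa using hc
  have hmu : mu (COMPL c) = ENNReal.ofReal γ := by
    unfold mu
    rw [Measure.map_apply measurable_digits (measurable_COMPL c)]
    have : (digits ⁻¹' COMPL c : Set ℝ) =ᵐ[volume.restrict (Set.Ico (0 : ℝ) 1)] Set.Iio γ := by
      filter_upwards [key] with y hy
      exact propext hy
    rw [measure_congr this, Measure.restrict_apply measurableSet_Iio]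
    have e : Set.Iio γ ∩ Set.Ico (0 : ℝ) 1 = Set.Ico 0 γ := by
      ext y; simp only [Set.mem_inter_iff, Set.mem_Iio, Set.mem_Ico]
      constructor
      · rintro ⟨a, b, _⟩; exact ⟨b, a⟩
      · rintro ⟨a, b⟩; exact ⟨b, a, by linarith⟩
    rw [e, Real.volume_Ico, sub_zero]
  rw [muR, hmu, ENNReal.toReal_ofReal h0]

end RandProb

namespace RandProb
open Nat.Partrec (Code)

/-! ### Measure of cylinders -/

/-- 0/1 value of a bit -/
def bn (b : Bool) : ℕ := cond b 1 0

theorem digits_pre {y : ℝ} (h0 : 0 ≤ y) {b : Bool} (hb : 0 ≤ 2 * y - bn b) (hb' : 2 * y - bn b < 1) :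
    digits y = prepend [b] (digits (2 * y - bn b)) := by
  funext n
  cases n with
  | zero =>
    have hf : ⌊y * 2 ^ (0 + 1)⌋ = bn b := by
      rw [Int.floor_eq_iff]; push_cast; constructor <;> linarith
    unfold digits prepend
    rw [hf]
    cases b <;> simp [bn]
  | succ n =>
    have e : (2 * y - bn b) * 2 ^ (n + 1) = y * 2 ^ (n + 1 + 1) - ((bn b * 2 ^ (n + 1) : ℤ) : ℝ) := by
      push_cast; ring
    unfold digits prepend
    simp only [List.length_singleton, Nat.add_sub_cancel]
    rw [if_neg (by omega), e, Int.floor_sub_intCast]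
    congr 1
    rw [pow_succ (2 : ℤ) n]
    generalize ⌊y * 2 ^ (n + 1 + 1)⌋ = w
    generalize (2 : ℤ) ^ n = q
    have : (bn b : ℤ) * (q * 2) = 2 * ((bn b : ℤ) * q) := by ring
    rw [this, eq_iff_iff]; omega

theorem measurable_prepend (b : Bool) : Measurable (prepend [b]) := by
  refine measurable_pi_iff.2 fun n => ?_
  unfold prepend
  by_cases h : n < [b].length
  · simp only [h, if_true]; exact measurable_const
  · simp only [h, if_false]; exact measurable_pi_apply _

theorem mu_split {S : Set Cantor} (hS : MeasurableSet S) :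
    muR S = 2⁻¹ * muR {X | prepend [false] X ∈ S} + 2⁻¹ * muR {X | prepend [true] X ∈ S} := by
  have hm : ∀ b, MeasurableSet {X | prepend [b] X ∈ S} := fun b => measurable_prepend b hS
  have hT : ∀ b, MeasurableSet {y : ℝ | (0 ≤ y ∧ y < 1) ∧ digits y ∈ {X | prepend [b] X ∈ S}} := fun b =>
    (measurableSet_Ico (a := (0 : ℝ)) (b := 1)).inter (measurable_digits (hm b))
  set T : Bool → Set ℝ := fun b => {y : ℝ | (0 ≤ y ∧ y < 1) ∧ digits y ∈ {X | prepend [b] X ∈ S}} with hTd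
  have hvol : ∀ b, volume ((fun y : ℝ => 2 * y) ⁻¹' ((fun y : ℝ => y + (-(bn b : ℝ))) ⁻¹' (T b))) =
      ENNReal.ofReal 2⁻¹ * mu {X | prepend [b] X ∈ S} := fun b => by
    rw [Real.volume_preimage_mul_left (by norm_num), measure_preimage_add_right, mu_apply (hm b)]
    norm_num [hTd]
  have hmeas : ∀ b, MeasurableSet ((fun y : ℝ => 2 * y) ⁻¹' ((fun y : ℝ => y + (-(bn b : ℝ))) ⁻¹' (T b))) := fun b => by
    have : MeasurableSet ((fun y : ℝ => y + (-(bn b : ℝ))) ⁻¹' (T b)) := (measurable_id.add_const _) (hT b)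
    exact (measurable_id.const_mul 2) this
  have hU : {y : ℝ | (0 ≤ y ∧ y < 1) ∧ digits y ∈ S} =
      ((fun y : ℝ => 2 * y) ⁻¹' ((fun y : ℝ => y + (-(bn false : ℝ))) ⁻¹' (T false))) ∪
      ((fun y : ℝ => 2 * y) ⁻¹' ((fun y : ℝ => y + (-(bn true : ℝ))) ⁻¹' (T true))) := by
    ext y
    simp only [hTd, Set.mem_union, Set.mem_preimage, Set.mem_ofPred_eq, ← sub_eq_add_neg]
    constructor
    · rintro ⟨⟨h0, h1⟩, h⟩
      by_cases hy : 2 * y < 1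
      · have a1 : 0 ≤ 2 * y - bn false := by simp [bn]; linarith
        have a2 : 2 * y - bn false < 1 := by simp [bn]; linarith
        exact Or.inl ⟨⟨a1, a2⟩, by rwa [← digits_pre h0 a1 a2]⟩
      · have a1 : 0 ≤ 2 * y - bn true := by simp [bn]; linarith
        have a2 : 2 * y - bn true < 1 := by simp [bn]; linarith
        exact Or.inr ⟨⟨a1, a2⟩, by rwa [← digits_pre h0 a1 a2]⟩
    · rintro (⟨⟨a1, a2⟩, h⟩ | ⟨⟨a1, a2⟩, h⟩)
      · have b1 : 0 ≤ y := by simp [bn] at a1; linarith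
        have b2 : y < 1 := by simp [bn] at a2; linarith
        exact ⟨⟨b1, b2⟩, by rwa [digits_pre b1 a1 a2]⟩
      · have b1 : 0 ≤ y := by simp [bn] at a1; linarith
        have b2 : y < 1 := by simp [bn] at a2; linarith
        exact ⟨⟨b1, b2⟩, by rwa [digits_pre b1 a1 a2]⟩
  have hd : Disjoint ((fun y : ℝ => 2 * y) ⁻¹' ((fun y : ℝ => y + (-(bn false : ℝ))) ⁻¹' (T false)))
      ((fun y : ℝ => 2 * y) ⁻¹' ((fun y : ℝ => y + (-(bn true : ℝ))) ⁻¹' (T true))) := by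
    rw [Set.disjoint_left]
    intro y h h'
    simp only [hTd, Set.mem_preimage, Set.mem_ofPred_eq, ← sub_eq_add_neg] at h h'
    have := h.1.2
    have h2 := h'.1.1
    simp [bn] at this h2
    linarith
  have hmu : mu S = ENNReal.ofReal 2⁻¹ * mu {X | prepend [false] X ∈ S} + ENNReal.ofReal 2⁻¹ * mu {X | prepend [true] X ∈ S} := by
    rw [mu_apply hS, hU, measure_union hd (hmeas true), hvol, hvol]
  unfold muR
  rw [hmu, ENNReal.toReal_add (ENNReal.mul_ne_top ENNReal.ofReal_ne_top (measure_ne_top _ _))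
    (ENNReal.mul_ne_top ENNReal.ofReal_ne_top (measure_ne_top _ _)), ENNReal.toReal_mul, ENNReal.toReal_mul,
    ENNReal.toReal_ofReal (by norm_num)]

theorem prepend_nil (X : Cantor) : prepend [] X = X := by funext n; simp [prepend]

theorem prepend_cons (b : Bool) (σ : List Bool) (X : Cantor) : prepend (b :: σ) X = prepend [b] (prepend σ X) := by
  funext n
  cases n with
  | zero => simp [prepend]
  | succ n =>
    simp only [prepend, List.length_cons, List.length_nil, List.getD_cons_succ]
    by_cases h : n < σ.length
    · simp [h]
    · simp [h]

theorem prepend_inj {b b' : Bool} {X Y : Cantor} (h : prepend [b] X = prepend [b'] Y) : b = b' ∧ X = Y := by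
  constructor
  · have := congrFun h 0; simpa [prepend] using this
  · funext n
    have := congrFun h (n + 1); simpa [prepend] using this

theorem mu_cyl (σ : List Bool) : ∀ {S T : Set Cantor}, MeasurableSet S → MeasurableSet T →
    (∀ X, prepend σ X ∉ T) → (∀ X, (∀ Y, X ≠ prepend σ Y) → (X ∈ S ↔ X ∈ T)) →
    muR S = 2⁻¹ ^ σ.length * muR {X | prepend σ X ∈ S} + muR T := by
  induction σ with
  | nil =>
    intro S T hS hT h1 h2
    have : T = ∅ := Set.eq_empty_of_forall_notMem fun X hX => h1 X (by rwa [prepend_nil])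
    subst this
    simp [prepend_nil, muR]
  | cons b σ ih =>
    intro S T hS hT h1 h2
    have hbit : ∀ b', b' ≠ b → {X | prepend [b'] X ∈ S} = {X | prepend [b'] X ∈ T} := fun b' hb' => by
      ext X
      refine h2 _ fun Y hY => ?_
      rw [prepend_cons b σ Y] at hY
      exact hb' (prepend_inj hY).1
    have := ih (S := {X | prepend [b] X ∈ S}) (T := {X | prepend [b] X ∈ T}) (measurable_prepend b hS) (measurable_prepend b hT)
      (fun X hX => h1 X (by rw [prepend_cons]; exact hX)) (fun X hX => h2 _ fun Y hY => by
        rw [prepend_cons b σ Y] at hY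
        exact hX Y (prepend_inj hY).2)
    have e : {X | prepend σ X ∈ {X | prepend [b] X ∈ S}} = {X | prepend (b :: σ) X ∈ S} := by
      ext X; simp only [Set.mem_ofPred_eq]; rw [← prepend_cons]
    rw [e] at this
    rw [mu_split hS, mu_split hT, List.length_cons, pow_succ]
    cases b with
    | false => rw [hbit true (by simp), this]; ring
    | true => rw [hbit false (by simp), this]; ring

end RandProb

namespace RandProb
open Nat.Partrec (Code)

/-! ### Building machines -/

/-- tail of a sequence after `m` bits -/
def shift (m : ℕ) (X : Cantor) : Cantor := fun i => X (m + i)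

theorem shift_prepend (σ : List Bool) (X : Cantor) : shift σ.length (prepend σ X) = X := by
  funext i; simp [shift, prepend]

theorem px_drop (X : Cantor) (m k : ℕ) : (px X (m + k)).drop m = px (shift m X) k := by
  apply List.ext_getElem?
  intro i
  rw [List.getElem?_drop, pre_getElem?, pre_getElem?]
  by_cases h : i < k <;> simp [h, oX, shift]

theorem eval_enc (O : ℕ → ℕ) (c : CodeO) (n v : ℕ) : v ∈ c.eval O n ↔ ∃ k, E c.encode (pre O k) n v := by
  rw [← eval_iff, dec_encode]

theorem px_getD (X : Cantor) {k i : ℕ} (h : i < k) : (px X k).getD i 0 = bn (X i) := by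
  rw [List.getD_eq_getElem?_getD, pre_getElem?, if_pos h]; rfl

theorem bn_one {b : Bool} : bn b = 1 ↔ b = true := by cases b <;> simp [bn]
theorem bn_zero {b : Bool} : bn b = 0 ↔ b = false := by cases b <;> simp [bn]

theorem exists_br (c1 c2 : CodeO) : ∃ c, (∀ X n, evalO (prepend [false] X) c n = evalO X c1 n) ∧
    ∀ X n, evalO (prepend [true] X) c n = evalO X c2 n := by
  have hS : Sg oX (fun X (x : ℕ × ℕ) => (X 0 = false ∧ x.2 ∈ c1.eval (oX (shift 1 X)) x.1) ∨ (X 0 = true ∧ x.2 ∈ c2.eval (oX (shift 1 X)) x.1)) := by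
    refine (Sg.primL (O := oX) (p := fun y : (ℕ × ℕ) × List ℕ => 0 < y.2.length ∧
      ((y.2.getD 0 0 = 0 ∧ E c1.encode (y.2.drop 1) y.1.1 y.1.2) ∨ (y.2.getD 0 0 = 1 ∧ E c2.encode (y.2.drop 1) y.1.1 y.1.2))) (by fun_prop)).of_eq ?_
    rintro X ⟨n, v⟩
    simp only [eval_enc, pre_length]
    constructor
    · rintro (⟨h, k, hk⟩ | ⟨h, k, hk⟩)
      · refine ⟨1 + k, by omega, Or.inl ⟨?_, ?_⟩⟩
        · rw [px_getD X (by omega), h]; rfl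
        · rwa [px_drop]
      · refine ⟨1 + k, by omega, Or.inr ⟨?_, ?_⟩⟩
        · rw [px_getD X (by omega), h]; rfl
        · rwa [px_drop]
    · rintro ⟨k, hk, h⟩
      obtain ⟨k, rfl⟩ : ∃ j, k = 1 + j := ⟨k - 1, by omega⟩
      rw [px_drop, px_getD X (by omega), bn_one, bn_zero] at h
      rcases h with ⟨a, b⟩ | ⟨a, b⟩
      · exact Or.inl ⟨a, k, b⟩
      · exact Or.inr ⟨a, k, b⟩
  obtain ⟨c, hc⟩ := exists_code_graph hS (by
    rintro X n v w (⟨a, h⟩ | ⟨a, h⟩) (⟨b, h'⟩ | ⟨b, h'⟩)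
    · exact Part.mem_unique h h'
    · rw [a] at b; cases b
    · rw [a] at b; cases b
    · exact Part.mem_unique h h')
  refine ⟨c, fun X n => Part.ext fun v => ?_, fun X n => Part.ext fun v => ?_⟩
  · have := shift_prepend [false] X
    have e : prepend [false] X 0 = false := rfl
    unfold evalO
    rw [hc]
    simp only [List.length_singleton] at this
    simp [this, e]
  · have := shift_prepend [true] X
    have e : prepend [true] X 0 = true := rfl
    unfold evalO
    rw [hc]
    simp only [List.length_singleton] at this
    simp [this, e]

theorem COMPL_congr {c d : CodeO} {X Y : Cantor} (h : ∀ n, evalO X c n = evalO Y d n) : X ∈ COMPL c ↔ Y ∈ COMPL d := by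
  have : domSet c X = domSet d Y := by
    ext n; show (evalO X c n).Dom ↔ (evalO Y d n).Dom; rw [h]
  show TuringLEs _ _ ↔ TuringLEs _ _
  rw [this]

theorem muR_br {c1 c2 c : CodeO} (h : (∀ X n, evalO (prepend [false] X) c n = evalO X c1 n) ∧
    ∀ X n, evalO (prepend [true] X) c n = evalO X c2 n) : muR (COMPL c) = 2⁻¹ * muR (COMPL c1) + 2⁻¹ * muR (COMPL c2) := by
  rw [mu_split (measurable_COMPL c)]
  congr 3
  · ext X; exact COMPL_congr (h.1 X)
  · ext X; exact COMPL_congr (h.2 X)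

theorem universal_br {c1 c2 c : CodeO} (h : (∀ X n, evalO (prepend [false] X) c n = evalO X c1 n) ∧
    ∀ X n, evalO (prepend [true] X) c n = evalO X c2 n) (hu : UniversalOM c2) : UniversalOM c := by
  obtain ⟨σ, ⟨f, hf, hfe⟩, hpf, hσ⟩ := hu
  refine ⟨fun d => true :: σ d, ⟨fun m => Nat.pair (Encodable.encode true) (f m) + 1, ?_, fun d => ?_⟩, ?_, ?_⟩
  · exact (Primrec.to_comp (f := fun m : ℕ => Nat.pair (Encodable.encode true) m + 1) (by fun_prop)).comp hf
  · show Nat.pair (Encodable.encode true) (f d.encode) + 1 = _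
    rw [hfe]; rfl
  · rintro _ ⟨d, rfl⟩ _ ⟨d', rfl⟩ hp
    have := (List.cons_prefix_cons.1 hp).2
    exact congrArg (List.cons true) (hpf _ ⟨d, rfl⟩ _ ⟨d', rfl⟩ this)
  · intro d X n
    rw [prepend_cons, h.2, hσ]

theorem exists_universal : ∃ u, UniversalOM u := by
  have hS : Sg oX (fun X (x : ℕ × ℕ) => ∃ m, (∀ i < m, X i = true) ∧ X m = false ∧ x.2 ∈ (dec m).eval (oX (shift (m + 1) X)) x.1) := by
    refine (Sg.primL (O := oX) (p := fun y : (ℕ × ℕ) × List ℕ => exLt y.2.length fun m =>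
      (allLt m fun i => y.2.getD i 0 = 1) ∧ y.2.getD m 0 = 0 ∧ E m (y.2.drop (m + 1)) y.1.1 y.1.2) (by fun_prop)).of_eq ?_
    rintro X ⟨n, v⟩
    simp only [eval_iff, pre_length]
    constructor
    · rintro ⟨m, a, b, k, hk⟩
      refine ⟨m + 1 + k, m, by omega, fun i hi => ?_, ?_, ?_⟩
      · show (px X _).getD i 0 = 1
        rw [px_getD X (by omega), a i hi]; rfl
      · rw [px_getD X (by omega), b]; rfl
      · rwa [px_drop]
    · rintro ⟨k, m, hk, a, b, h⟩
      obtain ⟨k, rfl⟩ : ∃ j, k = m + 1 + j := ⟨k - (m + 1), by omega⟩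
      rw [px_getD X (by omega), bn_zero] at b
      rw [px_drop] at h
      refine ⟨m, fun i hi => ?_, b, k, h⟩
      have : (px X _).getD i 0 = 1 := a i hi
      rwa [px_getD X (by omega), bn_one] at this
  obtain ⟨u, hu⟩ := exists_code_graph hS (by
    rintro X n v w ⟨m, a, b, h⟩ ⟨m', a', b', h'⟩
    have : m = m' := by
      rcases lt_trichotomy m m' with hl | hl | hl
      · rw [a' m hl] at b; cases b
      · exact hl
      · rw [a m' hl] at b'; cases b'
    subst this
    exact Part.mem_unique h h')
  have hg : Primrec fun m : ℕ => List.replicate m true ++ [false] := by fun_prop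
  have hlen : ∀ m, (List.replicate m true ++ [false]).length = m + 1 := fun m => by simp
  refine ⟨u, fun d => List.replicate d.encode true ++ [false], ⟨fun m => Encodable.encode (List.replicate m true ++ [false]), ?_, fun _ => rfl⟩, ?_, ?_⟩
  · exact (Primrec.encode.comp hg).to_comp
  · rintro _ ⟨d, rfl⟩ _ ⟨d', rfl⟩ hp
    simp only at hp ⊢
    have hl := hp.length_le
    rw [hlen, hlen] at hl
    have : d.encode = d'.encode := by
      by_contra hne
      obtain ⟨t, ht⟩ := hp
      have := congrArg (fun l => l[d.encode]?) ht
      have hlt : d.encode < d'.encode := by omega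
      simp [List.getElem?_append, hlt] at this
    rw [this]
  · intro d X n
    have hs := shift_prepend (List.replicate d.encode true ++ [false]) X
    rw [hlen] at hs
    have hb : ∀ i < d.encode, prepend (List.replicate d.encode true ++ [false]) X i = true := fun i hi => by
      unfold prepend
      rw [hlen, if_pos (by omega), List.getD_eq_getElem?_getD, List.getElem?_append_left (by simpa using hi)]
      simp [hi]
    have hz : prepend (List.replicate d.encode true ++ [false]) X d.encode = false := by
      unfold prepend
      rw [hlen, if_pos (by omega), List.getD_eq_getElem?_getD, List.getElem?_append_right (by simp)]
      simp
    refine Part.ext fun v => ?_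
    unfold evalO
    rw [hu]
    constructor
    · rintro ⟨m, a, b, h⟩
      have : m = d.encode := by
        rcases lt_trichotomy m d.encode with hl | hl | hl
        · rw [hb m hl] at b; cases b
        · exact hl
        · rw [a _ hl] at hz; cases hz
      subst this
      rw [hs, dec_encode] at h; exact h
    · intro h
      refine ⟨d.encode, hb, hz, ?_⟩
      rw [hs, dec_encode]; exact h

theorem not_complete_empty : ¬ TuringLEs HaltingSet ∅ := by
  rintro ⟨c, hc⟩
  have e : chi (∅ : Set ℕ) = fun _ => 0 := by funext n; simp [chi]
  rw [e] at hc
  refine not_S1_K ((S1.primL (O := fun _ => 0) (p := fun y : ℕ × List ℕ => E c.encode y.2 y.1 0) (by fun_prop)).of_eq fun n => ?_)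
  have := eval_enc (fun _ => 0) c n 0
  rw [hc, Part.mem_some_iff] at this
  refine Iff.trans ?_ this
  have := K_zero_or n
  unfold K at *
  omega

theorem exists_cut (u : CodeO) (σ : List Bool) : ∃ c, (∀ X, prepend σ X ∉ COMPL c) ∧
    ∀ X, (∀ Y, X ≠ prepend σ Y) → (X ∈ COMPL u ↔ X ∈ COMPL c) := by
  have hS : Sg oX (fun X (x : ℕ × ℕ) => x.2 ∈ u.eval (oX X) x.1 ∧ ∃ i < σ.length, bn (X i) ≠ bn (σ.getD i false)) := by
    refine (Sg.and (Sg.primL (O := oX) (p := fun y : (ℕ × ℕ) × List ℕ => E u.encode y.2 y.1.1 y.1.2) (by fun_prop))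
      (Sg.primL (O := oX) (p := fun y : (ℕ × ℕ) × List ℕ => σ.length ≤ y.2.length ∧ exLt σ.length fun i => y.2.getD i 0 ≠ (σ.map bn).getD i 0) (by fun_prop))).of_eq ?_
    rintro X ⟨n, v⟩
    simp only [eval_enc, pre_length]
    refine and_congr Iff.rfl ?_
    have hmap : ∀ i < σ.length, (σ.map bn).getD i 0 = bn (σ.getD i false) := fun i hi => by
      simp [hi]
    constructor
    · rintro ⟨i, hi, h⟩
      exact ⟨σ.length, le_rfl, i, hi, by show (px X _).getD i 0 ≠ _; rwa [px_getD X hi, hmap i hi]⟩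
    · rintro ⟨k, hk, i, hi, h⟩
      refine ⟨i, hi, ?_⟩
      replace h : (px X _).getD i 0 ≠ _ := h
      rwa [px_getD X (by omega), hmap i hi] at h
  obtain ⟨c, hc⟩ := exists_code_graph hS (by
    rintro X n v w ⟨a, -⟩ ⟨b, -⟩
    exact Part.mem_unique a b)
  refine ⟨c, fun X hX => ?_, fun X hX => COMPL_congr fun n => Part.ext fun v => ?_⟩
  · have : domSet c (prepend σ X) = ∅ := by
      refine Set.eq_empty_of_forall_notMem fun n hn => ?_
      obtain ⟨v, hv⟩ := Part.dom_iff_mem.1 hn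
      obtain ⟨-, i, hi, h⟩ := (hc _ n v).1 hv
      exact h (by simp [prepend, hi])
    have hX' : TuringLEs HaltingSet (domSet c (prepend σ X)) := hX
    rw [this] at hX'
    exact not_complete_empty hX'
  · refine Iff.symm ((hc X n v).trans ?_)
    refine ⟨fun h => h.1, fun h => ⟨h, ?_⟩⟩
    by_contra hno
    push Not at hno
    refine hX (shift σ.length X) (funext fun i => ?_)
    unfold prepend shift
    by_cases hi : i < σ.length
    · rw [if_pos hi]
      have := hno i hi
      revert this
      cases X i <;> cases σ.getD i false <;> simp [bn]
    · rw [if_neg hi]; congr 1; omega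

theorem part_a (u : CodeO) (hu : UniversalOM u) :
    NRandom 4 (muR (COMPL u)) ∧ LeftCeIn (iterJump 3) (muR (COMPL u)) := by
  refine ⟨?_, (leftCe_iff (muR_nonneg _)).2 (DLeft_COMPL u)⟩
  obtain ⟨σ, -, -, hσ⟩ := hu
  obtain ⟨Ω, h0, h1, hΩ, hR⟩ := exists_omega (iterJump 3)
  obtain ⟨c, hc⟩ := realize h0.le h1 hΩ
  obtain ⟨d, hd1, hd2⟩ := exists_cut u (σ c)
  have e := mu_cyl (σ c) (measurable_COMPL u) (measurable_COMPL d) hd1 hd2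
  have e2 : {X | prepend (σ c) X ∈ COMPL u} = COMPL c := by
    ext X; exact COMPL_congr (hσ c X)
  rw [e2, hc] at e
  rw [e]
  exact sum_random _ hR h0 h1 hΩ (muR_nonneg _) (muR_le_one _) (DLeft_COMPL d)

theorem exists_iter (c u0 : CodeO) (h : UniversalOM u0) (k : ℕ) : ∃ u, UniversalOM u ∧
    muR (COMPL u) = (1 - 2⁻¹ ^ k) * muR (COMPL c) + 2⁻¹ ^ k * muR (COMPL u0) := by
  induction k with
  | zero => exact ⟨u0, h, by simp⟩
  | succ k ih =>
    obtain ⟨u, hu, e⟩ := ih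
    obtain ⟨v, hv⟩ := exists_br c u
    refine ⟨v, universal_br hv hu, ?_⟩
    rw [muR_br hv, e]; ring

theorem part_b (α : ℝ) (h0 : 0 < α) (h1 : α < 1) (hR : NRandom 4 α) (hL : LeftCeIn (iterJump 3) α) :
    ∃ u : CodeO, UniversalOM u ∧ muR (COMPL u) = α := by
  obtain ⟨u0, hu0⟩ := exists_universal
  obtain ⟨n0, hn0⟩ := exists_pow_lt_of_lt_one (lt_min h0 (sub_pos.2 h1)) (by norm_num : (2⁻¹ : ℝ) < 1)
  obtain ⟨k, hk, hD⟩ := kucera_slaman (O := iterJump 3) hR h0 h1.le ((leftCe_iff h0.le).1 hL) (muR_nonneg (COMPL u0)) (muR_le_one _)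
    (DLeft_COMPL u0) n0
  have hkk : (2⁻¹ : ℝ) ^ k ≤ 2⁻¹ ^ n0 := pow_le_pow_of_le_one (by norm_num) (by norm_num) hk
  have hq : (0 : ℝ) < 2⁻¹ ^ k := by positivity
  have hk1 : (2⁻¹ : ℝ) ^ k < α := hkk.trans_lt (hn0.trans_le (min_le_left _ _))
  have hk2 : (2⁻¹ : ℝ) ^ k < 1 - α := hkk.trans_lt (hn0.trans_le (min_le_right _ _))
  have b0 := muR_nonneg (COMPL u0)
  have b1 := muR_le_one (COMPL u0)
  have hpos : (0 : ℝ) < 1 - 2⁻¹ ^ k := by linarith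
  have hm : (2⁻¹ : ℝ) ^ k * muR (COMPL u0) ≤ 2⁻¹ ^ k := mul_le_of_le_one_right hq.le b1
  have hm0 : 0 ≤ (2⁻¹ : ℝ) ^ k * muR (COMPL u0) := by positivity
  have g0 : 0 ≤ (α - 2⁻¹ ^ k * muR (COMPL u0)) / (1 - 2⁻¹ ^ k) := div_nonneg (by linarith) hpos.le
  have g1 : (α - 2⁻¹ ^ k * muR (COMPL u0)) / (1 - 2⁻¹ ^ k) ≤ 1 := by rw [div_le_one hpos]; linarith
  have gD : DLeft (iterJump 3) ((α - 2⁻¹ ^ k * muR (COMPL u0)) / (1 - 2⁻¹ ^ k)) := by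
    refine (S1.comp hD (g := fun x : ℕ × ℕ => (x.1 * (2 ^ k - 1), x.2 + k)) (by fun_prop)).of_eq fun x => ?_
    rw [lt_div_iff₀ hpos]
    have : dv (x.1 * (2 ^ k - 1), x.2 + k) = dv x * (1 - 2⁻¹ ^ k) := by
      unfold dv
      have : 1 ≤ 2 ^ k := Nat.one_le_two_pow
      push_cast [this]
      rw [inv_pow, pow_add]; field_simp
    rw [this]
  obtain ⟨c, hc⟩ := realize g0 g1 gD
  obtain ⟨u, hu, e⟩ := exists_iter c u0 hu0 k
  refine ⟨u, hu, ?_⟩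
  rw [e, hc, mul_div_cancel₀ _ hpos.ne']; ring

end RandProb

namespace RandProb

/-- **Completeness probability for universal oracle machines.**
The probability that a universal oracle machine computes a function whose domain computes
the halting problem is a 4-random `∅'''`-left-c.e. real; conversely, every 4-random
`∅'''`-left-c.e. real in `(0,1)` is such a probability for some universal oracle machine. -/
theorem completeness_probability_characterization :
    (∀ u : CodeO, UniversalOM u →
        NRandom 4 (muR (COMPL u)) ∧ LeftCeIn (iterJump 3) (muR (COMPL u))) ∧
    (∀ α : ℝ, 0 < α → α < 1 → NRandom 4 α → LeftCeIn (iterJump 3) α →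
        ∃ u : CodeO, UniversalOM u ∧ muR (COMPL u) = α) :=
  ⟨part_a, part_b⟩

end RandProb
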